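/- For every prime number p, the class number of the number field ℚ((2p)^{1/3}) is not divisible by p. -/

import Mathlib

namespace PureCubic

open ArithmeticFunction Finset

/-- The nontrivial Dirichlet character modulo `6`. -/
def chiSix : ArithmeticFunction ℤ where
  toFun n := if n % 6 = 1 then 1 else if n % 6 = 5 then -1 else 0
  map_zero' := by simp

/-- The indicator function of the integers coprime to `M > 1`. -/
def coprimeInd (M : ℕ) : ArithmeticFunction ℤ where
  toFun n := if n ≠ 0 ∧ n.Coprime M then 1 else 0
  map_zero' := by simp

lemma chiSix_apply (n : ℕ) :
    chiSix n = if n % 6 = 1 then 1 else if n % 6 = 5 then -1 else 0 := rfl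

lemma coprimeInd_apply (M n : ℕ) :
    coprimeInd M n = if n ≠ 0 ∧ n.Coprime M then 1 else 0 := rfl

lemma chiSix_mul (m n : ℕ) : chiSix (m * n) = chiSix m * chiSix n := by
  simp only [chiSix_apply, Nat.mul_mod m n]
  have h1 := Nat.mod_lt m (show 6 > 0 by norm_num)
  have h2 := Nat.mod_lt n (show 6 > 0 by norm_num)
  generalize m % 6 = a at *
  generalize n % 6 = b at *
  interval_cases a <;> interval_cases b <;> simp

lemma chiSix_pow (m k : ℕ) : chiSix (m ^ k) = chiSix m ^ k := by
  induction k with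
  | zero => simp [chiSix_apply]
  | succ k ih => rw [pow_succ, chiSix_mul, ih, pow_succ]

lemma isMultiplicative_chiSix : chiSix.IsMultiplicative :=
  ⟨by simp [chiSix_apply], fun _ => chiSix_mul _ _⟩

lemma isMultiplicative_coprimeInd (M : ℕ) : (coprimeInd M).IsMultiplicative := by
  refine ⟨by simp [coprimeInd_apply], fun {m n} _ => ?_⟩
  simp only [coprimeInd_apply, Nat.coprime_mul_iff_left, mul_ne_zero_iff]
  split_ifs <;> simp_all

/-- The Dirichlet convolution `ζ * 1_{(·, M) = 1} * χ₆`. -/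
def majorant (M : ℕ) : ArithmeticFunction ℤ :=
  (coprimeInd M * ((zeta : ArithmeticFunction ℕ) : ArithmeticFunction ℤ)) * chiSix

lemma isMultiplicative_majorant (M : ℕ) : (majorant M).IsMultiplicative :=
  ((isMultiplicative_coprimeInd M).mul isMultiplicative_zeta.natCast).mul isMultiplicative_chiSix

lemma mul_apply_prime_pow (f g : ArithmeticFunction ℤ) {q : ℕ} (hq : q.Prime) (k : ℕ) :
    (f * g) (q ^ k) = ∑ i ∈ range (k + 1), f (q ^ i) * g (q ^ (k - i)) := by
  rw [mul_apply, Nat.sum_divisorsAntidiagonal (fun a b => f a * g b),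
    Nat.sum_divisors_prime_pow hq]
  refine sum_congr rfl fun i hi => ?_
  rw [Nat.pow_div (by simp at hi; omega) hq.pos]

lemma coprimeInd_mul_zeta_prime_pow (M : ℕ) {q : ℕ} (hq : q.Prime) (k : ℕ) :
    (coprimeInd M * ((zeta : ArithmeticFunction ℕ) : ArithmeticFunction ℤ)) (q ^ k) = if q ∣ M then 1 else (k : ℤ) + 1 := by
  rw [coe_mul_zeta_apply, Nat.sum_divisors_prime_pow hq]
  split_ifs with h
  · rw [sum_range_succ', sum_eq_zero]
    · simp [coprimeInd_apply]
    · intro i _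
      have : ¬ (q ^ (i + 1)).Coprime M := by
        rw [Nat.coprime_pow_left_iff (by omega), hq.coprime_iff_not_dvd]; simpa
      simp [coprimeInd_apply, this]
  · rw [sum_eq_card_nsmul (b := 1)]
    · simp
    · intro i _
      have : (q ^ i).Coprime M := Nat.Coprime.pow_left _ (hq.coprime_iff_not_dvd.2 h)
      simp [coprimeInd_apply, this, hq.ne_zero]

lemma majorant_prime_pow_of_dvd {M q : ℕ} (hq : q.Prime) (h6 : q ∣ 6) (k : ℕ) :
    majorant M (q ^ k) = if q ∣ M then 1 else (k : ℤ) + 1 := by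
  have h0 : chiSix q = 0 := by
    have : q ≤ 6 := Nat.le_of_dvd (by norm_num) h6
    interval_cases q <;> revert h6 <;> simp [chiSix_apply]
    exact absurd hq (by norm_num)
  rw [majorant, mul_apply_prime_pow _ _ hq, sum_range_succ, sum_eq_zero]
  · simp [coprimeInd_mul_zeta_prime_pow M hq, chiSix_apply]
  · intro i hi
    rw [chiSix_pow, h0, zero_pow (by simp at hi; omega), mul_zero]

lemma majorant_prime_pow_of_mod_three_eq_one {M q : ℕ} (hM : M ∣ 6) (hq : q.Prime)
    (h6 : q % 3 = 1) (k : ℕ) :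
    majorant M (q ^ k) = (((k + 1) * (k + 2) / 2 : ℕ) : ℤ) := by
  have h2 : q % 2 = 1 := by
    rcases hq.eq_two_or_odd with h | h
    · omega
    · exact h
  have h0 : chiSix q = 1 := by rw [chiSix_apply, if_pos (by omega)]
  have h3 : ¬ q ∣ M := fun h => by
    have h6' := h.trans hM
    have : q ≤ 6 := Nat.le_of_dvd (by norm_num) h6'
    interval_cases q <;> first | omega | exact absurd hq (by norm_num)
  rw [majorant, mul_apply_prime_pow _ _ hq]
  simp only [chiSix_pow, h0, one_pow, mul_one, coprimeInd_mul_zeta_prime_pow M hq, if_neg h3]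
  have := Finset.sum_range_id_mul_two (k + 2)
  rw [show (k + 1) * (k + 2) / 2 = ∑ i ∈ range (k + 2), i by
    simp at this; rw [mul_comm (k+1), ← this]; simp]
  rw [sum_range_succ' _ (k + 1)]
  simp

lemma majorant_prime_pow_of_mod_three_eq_two {M q : ℕ} (hM : M ∣ 6) (hq : q.Prime)
    (h6 : q % 3 = 2) (hq2 : q ≠ 2) (k : ℕ) :
    majorant M (q ^ k) = ((k / 2 + 1 : ℕ) : ℤ) := by
  have h2 : q % 2 = 1 := by
    rcases hq.eq_two_or_odd with h | h
    · omega
    · exact h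
  have h0 : chiSix q = -1 := by rw [chiSix_apply, if_neg (by omega), if_pos (by omega)]
  have h3 : ¬ q ∣ M := fun h => by
    have h6' := h.trans hM
    have : q ≤ 6 := Nat.le_of_dvd (by norm_num) h6'
    interval_cases q <;> omega
  rw [majorant, mul_apply_prime_pow _ _ hq]
  simp only [chiSix_pow, h0, coprimeInd_mul_zeta_prime_pow M hq, if_neg h3]
  have key : ∀ k : ℕ, ∑ i ∈ range (k + 1), ((i : ℤ) + 1) * (-1) ^ (k - i) =
      ((k / 2 + 1 : ℕ) : ℤ) := by
    intro k
    induction k with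
    | zero => simp
    | succ k ih =>
      rw [sum_range_succ]
      have : ∑ i ∈ range (k + 1), ((i : ℤ) + 1) * (-1) ^ (k + 1 - i)
          = - ∑ i ∈ range (k + 1), ((i : ℤ) + 1) * (-1) ^ (k - i) := by
        rw [← sum_neg_distrib]
        refine sum_congr rfl fun i hi => ?_
        rw [show k + 1 - i = (k - i) + 1 by simp at hi; omega, pow_succ]; ring
      rw [this, ih]
      simp
      omega
  exact key k

end PureCubic

namespace PureCubic

open ArithmeticFunction Finset

lemma sum_chiSix_mul_le {h : ℕ → ℤ} (hanti : ∀ n, 0 < n → h (n + 1) ≤ h n) (hpos : ∀ n, 0 ≤ h n) (D : ℕ) :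
    ∑ d ∈ Ioc 0 (D + 1), chiSix d * h d ≤
      h 1 - if (D + 1) % 6 = 5 ∨ (D + 1) % 6 = 0 then h (D + 1) else 0 := by
  induction D with
  | zero => simp [chiSix_apply]
  | succ D ih =>
    rw [sum_Ioc_succ_top (by omega), chiSix_apply]
    have h1 := hanti (D + 1) (by omega)
    have h2 := hpos (D + 1 + 1)
    split_ifs at ih ⊢ <;> omega

lemma sum_majorant_le {M : ℕ} (N : ℕ) :
    ∑ n ∈ Ioc 0 N, majorant M n ≤ ∑ e ∈ Ioc 0 N, coprimeInd M e * ((N / e : ℕ) : ℤ) := by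
  rcases N with _ | N
  · simp
  have hnn : ∀ m, 0 ≤ (coprimeInd M * ((zeta : ArithmeticFunction ℕ) : ArithmeticFunction ℤ)) m := by
    intro m
    rw [coe_mul_zeta_apply]
    refine sum_nonneg fun i _ => ?_
    rw [coprimeInd_apply]; split_ifs <;> simp
  rw [majorant, mul_comm, sum_Ioc_mul_eq_sum_sum]
  refine (sum_chiSix_mul_le (h := fun n => ∑ m ∈ Ioc 0 ((N + 1) / n),
    (coprimeInd M * ((zeta : ArithmeticFunction ℕ) : ArithmeticFunction ℤ)) m) ?_ ?_ N).trans ?_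
  · intro n hn
    refine sum_le_sum_of_subset_of_nonneg (fun x hx => ?_) fun i _ _ => hnn i
    have : (N + 1) / (n + 1) ≤ (N + 1) / n := Nat.div_le_div_left (by omega) hn
    simp at hx ⊢; omega
  · exact fun n => sum_nonneg fun i _ => hnn i
  · have : 0 ≤ (if (N + 1) % 6 = 5 ∨ (N + 1) % 6 = 0 then ∑ m ∈ Ioc 0 ((N + 1) / (N + 1)),
      (coprimeInd M * ((zeta : ArithmeticFunction ℕ) : ArithmeticFunction ℤ)) m else 0) := by
      split_ifs
      · exact sum_nonneg fun i _ => hnn i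
      · exact le_rfl
    simp only [Nat.div_one]
    rw [← sum_Ioc_mul_zeta_eq_sum]
    linarith [this]

/-- The sum of the reciprocals of the positive integers up to `N` that are coprime to `M`. -/
noncomputable def coprimeHarmonic (M N : ℕ) : ℝ := ∑ e ∈ Ioc 0 N, (coprimeInd M e : ℝ) / e

lemma sum_majorant_le_mul_coprimeHarmonic {M : ℕ} (N : ℕ) :
    ((∑ n ∈ Ioc 0 N, majorant M n : ℤ) : ℝ) ≤ N * coprimeHarmonic M N := by
  refine (Int.cast_le.2 (sum_majorant_le N)).trans ?_
  rw [coprimeHarmonic, mul_sum, Int.cast_sum]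
  refine sum_le_sum fun e _ => ?_
  push_cast
  have h0 : (0 : ℝ) ≤ (coprimeInd M e : ℝ) := by
    rw [coprimeInd_apply]; split_ifs <;> simp
  calc _ ≤ (coprimeInd M e : ℝ) * ((N : ℝ) / e) := mul_le_mul_of_nonneg_left Nat.cast_div_le h0
    _ = _ := by ring

lemma coprimeHarmonic_succ (M N : ℕ) : coprimeHarmonic M (N + 1) =
    coprimeHarmonic M N + if (N + 1).Coprime M then 1 / ((N : ℝ) + 1) else 0 := by
  rw [coprimeHarmonic, sum_Ioc_succ_top (by omega), ← coprimeHarmonic, coprimeInd_apply]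
  simp; split_ifs <;> simp

lemma two_mul_add_le_log {x : ℝ} (h0 : 0 ≤ x) (h1 : x < 1) :
    2 * (x + x ^ 3 / 3) ≤ Real.log ((1 + x) / (1 - x)) := by
  have := Real.sum_range_le_log_div h0 h1 2
  simp [sum_range_succ] at this
  linarith

lemma coprimeHarmonic_two_even (j : ℕ) :
    coprimeHarmonic 2 (2 * j + 2) ≤ (Real.log (2 * j + 2) + 2) / 2 := by
  induction j with
  | zero =>
    rw [coprimeHarmonic_succ, coprimeHarmonic_succ]
    have := Real.log_pos (show (1 : ℝ) < 2 by norm_num)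
    simp [coprimeHarmonic]; linarith
  | succ j ih =>
    rw [show 2 * (j + 1) + 2 = 2 * j + 2 + 1 + 1 by ring, coprimeHarmonic_succ, coprimeHarmonic_succ,
      if_pos (by rw [Nat.coprime_two_right]; exact ⟨j + 1, by ring⟩),
      if_neg (by rw [Nat.coprime_two_right, Nat.not_odd_iff_even]; exact ⟨j + 2, by ring⟩)]
    have hj : (0 : ℝ) ≤ j := j.cast_nonneg
    have hx : (1 : ℝ) / (2 * j + 3) < 1 := by rw [div_lt_one] <;> linarith
    have hx0 : (0 : ℝ) < 1 / (2 * j + 3) := by positivity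
    have := two_mul_add_le_log hx0.le hx
    rw [show (1 + 1 / (2 * (j : ℝ) + 3)) / (1 - 1 / (2 * j + 3)) = (2 * (j + 1) + 2) / (2 * j + 2) by
      rw [div_eq_div_iff (by linarith) (by linarith)]; field_simp; ring,
      Real.log_div (by positivity) (by positivity)] at this
    push_cast
    rw [show (2 * (j : ℝ) + 2 + 1) = 2 * j + 3 by ring]
    have h3 : 0 < (1 / (2 * (j : ℝ) + 3)) ^ 3 := by positivity
    linarith

lemma coprimeHarmonic_two_le {N : ℕ} (hN : 0 < N) :
    coprimeHarmonic 2 N ≤ (Real.log N + 2) / 2 + 1 / N := by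
  have h0 : (0 : ℝ) < 1 / N := by positivity
  obtain ⟨j, rfl | rfl⟩ : ∃ j, N = 2 * j + 2 ∨ N = 2 * j + 1 := ⟨(N - 1) / 2, by omega⟩
  · have := coprimeHarmonic_two_even j
    push_cast at *; linarith
  rcases j with _ | j
  · simp [coprimeHarmonic, coprimeInd_apply]
  · have := coprimeHarmonic_two_even j
    rw [show 2 * (j + 1) + 1 = 2 * j + 2 + 1 by ring, coprimeHarmonic_succ,
      if_pos (by rw [Nat.coprime_two_right]; exact ⟨j + 1, by ring⟩)]
    have := Real.log_le_log (show (0 : ℝ) < 2 * j + 2 by positivity)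
      (show (2 * j + 2 : ℝ) ≤ 2 * j + 2 + 1 by linarith)
    push_cast at *
    linarith

lemma coprime_six_iff (n : ℕ) : n.Coprime 6 ↔ n % 6 = 1 ∨ n % 6 = 5 := by
  rw [Nat.coprime_iff_gcd_eq_one, Nat.gcd_comm, Nat.gcd_rec, Nat.gcd_comm]
  have := Nat.mod_lt n (show 6 > 0 by norm_num)
  generalize n % 6 = a at *
  interval_cases a <;> simp

lemma coprimeHarmonic_six_values (j : ℕ) :
    coprimeHarmonic 6 (6 * j + 4) = coprimeHarmonic 6 (6 * j + 3) ∧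
    coprimeHarmonic 6 (6 * j + 5) = coprimeHarmonic 6 (6 * j + 3) + 1 / (6 * j + 5) ∧
    coprimeHarmonic 6 (6 * j + 6) = coprimeHarmonic 6 (6 * j + 3) + 1 / (6 * j + 5) ∧
    coprimeHarmonic 6 (6 * j + 7) =
      coprimeHarmonic 6 (6 * j + 3) + 1 / (6 * j + 5) + 1 / (6 * j + 7) ∧
    coprimeHarmonic 6 (6 * j + 8) = coprimeHarmonic 6 (6 * j + 7) ∧
    coprimeHarmonic 6 (6 * j + 9) = coprimeHarmonic 6 (6 * j + 7) := by
  have h1 := coprimeHarmonic_succ 6 (6 * j + 3)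
  have h2 := coprimeHarmonic_succ 6 (6 * j + 4)
  have h3 := coprimeHarmonic_succ 6 (6 * j + 5)
  have h4 := coprimeHarmonic_succ 6 (6 * j + 6)
  have h5 := coprimeHarmonic_succ 6 (6 * j + 7)
  have h6 := coprimeHarmonic_succ 6 (6 * j + 8)
  rw [if_neg (by rw [coprime_six_iff]; omega), add_zero] at h1 h3 h5 h6
  rw [if_pos (by rw [coprime_six_iff]; omega)] at h2 h4
  push_cast at h2 h4
  rw [show 6 * (j : ℝ) + 4 + 1 = 6 * j + 5 by ring] at h2
  rw [show 6 * (j : ℝ) + 6 + 1 = 6 * j + 7 by ring] at h4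
  refine ⟨h1, ?_, ?_, ?_, h5, ?_⟩
  · rw [← h1, ← h2]
  · rw [← h1, ← h2, ← h3]
  · rw [← h1, ← h2, ← h3, ← h4]
  · rw [← h5, ← h6]

lemma coprimeHarmonic_six_checkpoint (j : ℕ) :
    coprimeHarmonic 6 (6 * j + 3) ≤ (Real.log (6 * j + 3) + 2) / 3 := by
  induction j with
  | zero =>
    have h3 : (1 : ℝ) ≤ Real.log 3 := by
      rw [Real.le_log_iff_exp_le (by norm_num)]
      linarith [Real.exp_one_lt_d9]
    simp [coprimeHarmonic_succ, coprime_six_iff]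
    simp [coprimeHarmonic]; linarith
  | succ j ih =>
    obtain ⟨-, -, -, e7, -, e9⟩ := coprimeHarmonic_six_values j
    rw [show 6 * (j + 1) + 3 = 6 * j + 9 by ring, e9, e7]
    have hj : (0 : ℝ) ≤ j := j.cast_nonneg
    obtain ⟨Y, hY⟩ : ∃ Y : ℝ, Y = 6 * j + 6 := ⟨_, rfl⟩
    have hY6 : 6 ≤ Y := by linarith
    have hx : 3 / Y < 1 := by rw [div_lt_one] <;> linarith
    have hx0 : 0 < 3 / Y := by positivity
    have := two_mul_add_le_log hx0.le hx
    rw [show (1 + 3 / Y) / (1 - 3 / Y) = (6 * (j + 1) + 3) / (6 * j + 3) by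
      rw [show 6 * ((j : ℝ) + 1) + 3 = Y + 3 by linarith, show 6 * (j : ℝ) + 3 = Y - 3 by linarith]
      field_simp,
      Real.log_div (by positivity) (by positivity)] at this
    push_cast
    rw [show (6 * (j : ℝ) + 5) = Y - 1 by linarith,
      show (6 * (j : ℝ) + 7) = Y + 1 by linarith]
    have h3 : 1 / (Y - 1) + 1 / (Y + 1) ≤ 2 * (3 / Y + (3 / Y) ^ 3 / 3) / 3 := by
      rw [div_add_div _ _ (by linarith) (by linarith), div_le_iff₀ (by nlinarith)]
      field_simp
      nlinarith
    linarith

lemma coprimeHarmonic_six_le {N : ℕ} (hN : 0 < N) :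
    coprimeHarmonic 6 N ≤ (Real.log N + 2) / 3 + 1 / N := by
  have h0 : (0 : ℝ) < 1 / N := by positivity
  have hl2 := Real.log_pos (show (1 : ℝ) < 2 by norm_num)
  by_cases hN3 : N < 3
  · interval_cases N
    · simp [coprimeHarmonic_succ, coprime_six_iff]; simp [coprimeHarmonic]; norm_num
    · simp [coprimeHarmonic_succ, coprime_six_iff]; simp [coprimeHarmonic]; linarith
  obtain ⟨j, r, hr, rfl⟩ : ∃ j r, r < 6 ∧ N = 6 * j + 3 + r :=
    ⟨(N - 3) / 6, (N - 3) % 6, Nat.mod_lt _ (by norm_num), by omega⟩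
  have hj : (0 : ℝ) ≤ j := j.cast_nonneg
  have h1 := coprimeHarmonic_six_checkpoint j
  have h2 := coprimeHarmonic_six_checkpoint (j + 1)
  obtain ⟨e4, e5, e6, e7, e8, e9⟩ := coprimeHarmonic_six_values j
  rw [show 6 * (j + 1) + 3 = 6 * j + 9 by ring, e9] at h2
  push_cast at h2
  rw [show 6 * ((j : ℝ) + 1) + 3 = 6 * j + 9 by ring] at h2
  have hlog : ∀ x y : ℝ, 0 < x → x ≤ y → Real.log x ≤ Real.log y :=
    fun x y => Real.log_le_log
  have hlog' : ∀ x y : ℝ, 0 < x → 0 < y → Real.log y - Real.log x ≤ (y - x) / x ∧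
      (y - x) / y ≤ Real.log y - Real.log x := by
    intro x y hx hy
    have h1 := Real.one_sub_inv_le_log_of_pos (div_pos hy hx)
    have h2 := Real.log_le_sub_one_of_pos (div_pos hy hx)
    rw [inv_div, Real.log_div hy.ne' hx.ne'] at h1
    rw [Real.log_div hy.ne' hx.ne'] at h2
    rw [sub_div, sub_div, div_self hx.ne', div_self hy.ne']
    exact ⟨h2, h1⟩
  interval_cases r <;> push_cast at h0 ⊢ <;> simp only [add_assoc, add_zero] at h0 ⊢ <;>
    norm_num only at h0 ⊢
  · linarith
  · rw [e4]
    linarith [hlog (6 * j + 3) (6 * j + 4) (by positivity) (by linarith)]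
  · rw [e5]
    linarith [hlog (6 * j + 3) (6 * j + 5) (by positivity) (by linarith)]
  · rw [e6]
    have := (hlog' (6 * j + 3) (6 * j + 6) (by positivity) (by positivity)).2
    have h3 : 1 / (6 * (j : ℝ) + 5) ≤
        1 / (6 * j + 6) + (6 * j + 6 - (6 * j + 3)) / (6 * j + 6) / 3 := by
      rw [div_div, div_add_div _ _ (by positivity) (by positivity),
        div_le_div_iff₀ (by positivity) (by positivity)]
      nlinarith
    linarith
  · have := (hlog' (6 * j + 7) (6 * j + 9) (by positivity) (by positivity)).1
    have h3 : (6 * (j : ℝ) + 9 - (6 * j + 7)) / (6 * j + 7) / 3 ≤ 1 / (6 * j + 7) := by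
      rw [div_div, div_le_div_iff₀ (by positivity) (by positivity)]
      nlinarith
    linarith
  · rw [e8]
    have := (hlog' (6 * j + 8) (6 * j + 9) (by positivity) (by positivity)).1
    have h3 : (6 * (j : ℝ) + 9 - (6 * j + 8)) / (6 * j + 8) / 3 ≤ 1 / (6 * j + 8) := by
      rw [div_div, div_le_div_iff₀ (by positivity) (by positivity)]
      nlinarith
    linarith

/-- An upper bound for the sum of a submultiplicative function with small values at the prime
powers. -/
theorem le_majorant {a : ℕ → ℕ} {M : ℕ}
    (hsub : ∀ m n, 1 < m → 1 < n → m.Coprime n → a (m * n) ≤ a m * a n)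
    (hone : a 1 ≤ 1)
    (hpow : ∀ q k, q.Prime → 0 < k → (a (q ^ k) : ℤ) ≤ majorant M (q ^ k)) (n : ℕ) (hn : n ≠ 0) :
    (a n : ℤ) ≤ majorant M n := by
  induction n using Nat.recOnPosPrimePosCoprime with
  | prime_pow q k hq hk => exact hpow q k hq hk
  | zero => exact absurd rfl hn
  | one => rw [(isMultiplicative_majorant M).map_one]; exact_mod_cast hone
  | coprime m n hm hn' h ihm ihn =>
    rw [(isMultiplicative_majorant M).map_mul_of_coprime h]
    have h1 := ihm (by omega)
    have h2 := ihn (by omega)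
    calc (a (m * n) : ℤ) ≤ a m * a n := by exact_mod_cast hsub m n hm hn' h
      _ ≤ _ := mul_le_mul h1 h2 (by positivity) ((by positivity : (0 : ℤ) ≤ a m).trans h1)

/-- `δ (u log u + 2 u) + 1` bounds the summatory function of a function bounded by the majorant. -/
theorem sum_le_of_le_majorant {a : ℕ → ℕ} {M : ℕ} {δ : ℝ} (hδ : 0 ≤ δ) (hδ1 : δ ≤ 1)
    (hE : ∀ N : ℕ, 0 < N → coprimeHarmonic M N ≤ δ * (Real.log N + 2) + 1 / N)
    (ha : ∀ n, n ≠ 0 → (a n : ℤ) ≤ majorant M n) {u : ℝ} (hu : 0 < u) :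
    (∑ n ∈ Ioc 0 ⌊u⌋₊, (a n : ℝ)) ≤ δ * (u * Real.log u + 2 * u) + 1 := by
  rcases Nat.eq_zero_or_pos ⌊u⌋₊ with h0 | hpos
  · rw [h0]
    have := Real.one_sub_inv_le_log_of_pos hu
    have h1 : u * (1 - u⁻¹) ≤ u * Real.log u := by gcongr
    rw [mul_sub, mul_inv_cancel₀ hu.ne'] at h1
    have h3 : -1 ≤ u * Real.log u + 2 * u := by linarith
    rw [Ioc_self, sum_empty]
    nlinarith
  · set N := ⌊u⌋₊ with hN
    have hNu : (N : ℝ) ≤ u := Nat.floor_le hu.le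
    have hN1 : (1 : ℝ) ≤ N := by exact_mod_cast hpos
    have h1 : (∑ n ∈ Ioc 0 N, (a n : ℝ)) ≤ ((∑ n ∈ Ioc 0 N, majorant M n : ℤ) : ℝ) := by
      rw [Int.cast_sum]
      refine sum_le_sum fun n hn => ?_
      have := ha n (by simp at hn; omega)
      exact_mod_cast this
    refine h1.trans ((sum_majorant_le_mul_coprimeHarmonic N).trans ?_)
    calc (N : ℝ) * coprimeHarmonic M N ≤ N * (δ * (Real.log N + 2) + 1 / N) := by
          gcongr; exact hE N hpos
      _ = δ * (N * Real.log N + 2 * N) + 1 := by field_simp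
      _ ≤ _ := by
        have := Real.log_nonneg hN1
        gcongr
end PureCubic

namespace PureCubic

open MeasureTheory
open scoped ENNReal

/-- A second moment argument: the translates of a set by a lattice overlap on average at least as
much as prescribed by the Cauchy-Schwarz inequality. -/
theorem sq_measure_le {E : Type*} [MeasurableSpace E] [AddCommGroup E] [MeasurableAdd₂ E]
    {μ : Measure E} [μ.IsAddLeftInvariant] {L : AddSubgroup E} [Countable L] {F : Set E}
    (hF : IsAddFundamentalDomain L F μ) {B : Set E} (hB : MeasurableSet B) :
    μ B ^ 2 ≤ μ F * ∑' v : L, μ (B ∩ (fun x => (v : E) + x) ⁻¹' B) := by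
  have hadd : ∀ v : L, Measurable (fun x : E => (v : E) + x) := fun v => measurable_const_add _
  let f : E → ℝ≥0∞ := B.indicator 1
  have hf : Measurable f := measurable_one.indicator hB
  let n : E → ℝ≥0∞ := fun x => ∑' v : L, f ((v : E) + x)
  have hfm : ∀ v : L, Measurable fun x => f ((v : E) + x) := fun v => hf.comp (hadd v)
  have hn : Measurable n := Measurable.tsum hfm
  have hinv : ∀ (v : L) x, n ((v : E) + x) = n x := by
    intro v x
    refine Eq.trans ?_ ((Equiv.addRight v).tsum_eq (fun w : L => f ((w : E) + x)))
    simp [n, add_assoc]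
  have h1 : ∫⁻ x in F, n x ∂μ = μ B := by
    rw [lintegral_tsum fun v => (hfm v).aemeasurable,
      ← lintegral_indicator_one hB, hF.lintegral_eq_tsum'']
    rfl
  have hnm : ∀ v : L, Measurable fun x => n ((v : E) + x) := fun v => hn.comp (hadd v)
  have h2 : ∫⁻ x in F, n x ^ 2 ∂μ = ∑' v : L, μ (B ∩ (fun x => (v : E) + x) ⁻¹' B) := by
    have e1 : ∀ x, n x ^ 2 = ∑' v : L, f ((v : E) + x) * n ((v : E) + x) := by
      intro x
      simp_rw [hinv, ENNReal.tsum_mul_right, sq]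
      rfl
    simp_rw [e1]
    rw [lintegral_tsum (f := fun (v : L) x => f ((v : E) + x) * n ((v : E) + x))
      fun v => ((hfm v).mul (hnm v)).aemeasurable]
    have := hF.lintegral_eq_tsum'' (fun x => f x * n x)
    refine Eq.trans this.symm ?_
    simp_rw [n, ← ENNReal.tsum_mul_left]
    rw [lintegral_tsum (f := fun (v : L) x => f x * f ((v : E) + x))
      fun v => (hf.mul (hfm v)).aemeasurable]
    refine tsum_congr fun v => ?_
    rw [← lintegral_indicator_one (hB.inter (hadd v hB))]
    refine lintegral_congr fun x => ?_
    by_cases hx : x ∈ B <;> by_cases hy : (v : E) + x ∈ B <;> simp [f, hx, hy]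
  have hold := ENNReal.lintegral_mul_le_Lp_mul_Lq (μ.restrict F) Real.HolderConjugate.two_two
    (f := n) (g := 1) hn.aemeasurable aemeasurable_const
  simp only [mul_one, Pi.one_apply, Pi.mul_apply,
    ENNReal.rpow_two] at hold
  rw [h1, h2] at hold
  calc μ B ^ 2 ≤ _ := pow_le_pow_left' hold 2
    _ = _ := by
      rw [mul_pow, ← ENNReal.rpow_two, ← ENNReal.rpow_two, ← ENNReal.rpow_mul, ← ENNReal.rpow_mul]
      norm_num
      rw [mul_comm]

/-- Integrals over separated translates of an interval. -/
theorem tsum_lintegral_Ico_le {ι : Type*} [Countable ι] {l : ι → ℝ} {T : ℝ}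
    (hl : Pairwise fun i j => T ≤ |l i - l j|) (g : ℝ → ℝ≥0∞) :
    ∑' i, ∫⁻ t in Set.Ico 0 T, g (t + l i) ≤ ∫⁻ t, g t := by
  have h : ∀ i, ∫⁻ t in Set.Ico 0 T, g (t + l i) = ∫⁻ t in Set.Ico (l i) (l i + T), g t := by
    intro i
    rw [← lintegral_indicator measurableSet_Ico, ← lintegral_indicator measurableSet_Ico,
      ← lintegral_add_right_eq_self ((Set.Ico (l i) (l i + T)).indicator g) (l i)]
    refine lintegral_congr fun t => ?_
    simp only [Set.indicator, Set.mem_Ico, add_comm t, le_add_iff_nonneg_right,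
      add_lt_add_iff_left]
  simp_rw [h]
  rw [← lintegral_iUnion (fun _ => measurableSet_Ico)]
  · exact setLIntegral_le_lintegral _ _
  · intro i j hij
    rw [Function.onFun, Set.disjoint_left]
    rintro x ⟨h1, h2⟩ ⟨h3, h4⟩
    have : T ≤ |l i - l j| := hl hij
    rw [le_abs] at this
    rcases this with h | h <;> linarith
end PureCubic

namespace PureCubic

open MeasureTheory
open scoped ENNReal Real

/-- An upper bound for the normalised area of the intersection of two discs. -/
noncomputable def lensBound (s : ℝ) : ℝ := 1 - 5 / 4 * s + 1 / 4 * s ^ 3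

lemma continuous_lens_integrand :
    Continuous fun u : ℝ => 4 * √(1 - u ^ 2) - π * (5 - 3 * u ^ 2) / 4 := by fun_prop

lemma integral_sqrt_zero_one : ∫ u in (0 : ℝ)..1, √(1 - u ^ 2) = π / 4 := by
  have h := integral_sqrt_one_sub_sq
  have hc : Continuous fun u : ℝ => √(1 - u ^ 2) := by fun_prop
  rw [← intervalIntegral.integral_add_adjacent_intervals (hc.intervalIntegrable (-1) 0)
    (hc.intervalIntegrable 0 1)] at h
  have h2 := intervalIntegral.integral_comp_neg (f := fun u : ℝ => √(1 - u ^ 2)) (a := 0) (b := 1)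
  simp only [even_two, Even.neg_pow, neg_zero] at h2
  linarith

lemma integral_lens_polynomial (a b : ℝ) :
    ∫ u in a..b, π * (5 - 3 * u ^ 2) / 4 = π * (5 * b - b ^ 3) / 4 - π * (5 * a - a ^ 3) / 4 := by
  have : ∀ u : ℝ, HasDerivAt (fun u => π * (5 * u - u ^ 3) / 4) (π * (5 - 3 * u ^ 2) / 4) u := by
    intro u
    have := ((((hasDerivAt_id u).const_mul 5).sub (hasDerivAt_pow 3 u)).const_mul π).div_const 4
    convert! this using 1
    simp
  exact intervalIntegral.integral_eq_sub_of_hasDerivAt (fun u _ => this u)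
    ((by fun_prop : Continuous fun u : ℝ => π * (5 - 3 * u ^ 2) / 4).intervalIntegrable _ _)

lemma lens_integral_nonneg {s : ℝ} (h0 : 0 ≤ s) (h1 : s ≤ 1) :
    0 ≤ ∫ u in (0 : ℝ)..s, (4 * √(1 - u ^ 2) - π * (5 - 3 * u ^ 2) / 4) := by
  set f := fun u : ℝ => 4 * √(1 - u ^ 2) - π * (5 - 3 * u ^ 2) / 4 with hf
  have hc : Continuous f := continuous_lens_integrand
  set Ψ := fun s : ℝ => ∫ u in (0 : ℝ)..s, f u with hΨ
  have hd : ∀ s, HasDerivAt Ψ (f s) s := fun s =>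
    hc.integral_hasStrictDerivAt 0 s |>.hasDerivAt
  have hcΨ : Continuous Ψ := continuous_iff_continuousAt.2 fun s => (hd s).continuousAt
  have hΨ0 : Ψ 0 = 0 := by simp [hΨ]
  have hΨ1 : Ψ 1 = 0 := by
    simp only [hΨ, hf]
    rw [intervalIntegral.integral_sub ((by fun_prop : Continuous fun u : ℝ =>
      4 * √(1 - u ^ 2)).intervalIntegrable _ _) ((by fun_prop : Continuous fun u : ℝ =>
      π * (5 - 3 * u ^ 2) / 4).intervalIntegrable _ _), intervalIntegral.integral_const_mul,
      integral_sqrt_zero_one, integral_lens_polynomial]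
    ring
  change 0 ≤ Ψ s
  by_contra! hneg
  have hs0 : 0 < s := h0.lt_of_ne (by rintro rfl; linarith)
  have hs1 : s < 1 := h1.lt_of_ne (by rintro rfl; linarith)
  obtain ⟨c₁, ⟨h1a, h1b⟩, hc₁⟩ := exists_hasDerivAt_eq_slope Ψ f hs0 hcΨ.continuousOn
    (fun x _ => hd x)
  obtain ⟨c₂, ⟨h2a, h2b⟩, hc₂⟩ := exists_hasDerivAt_eq_slope Ψ f hs1 hcΨ.continuousOn
    (fun x _ => hd x)
  have hf1 : f c₁ < 0 := by
    rw [hc₁]; exact div_neg_of_neg_of_pos (by linarith) (by linarith)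
  have hf2 : 0 < f c₂ := by
    rw [hc₂]; exact div_pos (by linarith) (by linarith)
  have hpi : π ^ 2 * 25 < 256 := by nlinarith [Real.pi_lt_d2, Real.pi_pos]
  have hsq : ∀ c, 0 < c → c < 1 → √(1 - c ^ 2) ^ 2 = 1 - c ^ 2 := fun c h h' =>
    Real.sq_sqrt (by nlinarith)
  have hq1 : 256 * (1 - c₁ ^ 2) < π ^ 2 * (5 - 3 * c₁ ^ 2) ^ 2 := by
    have h : 4 * √(1 - c₁ ^ 2) < π * (5 - 3 * c₁ ^ 2) / 4 := by simp only [hf] at hf1; linarith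
    have := pow_lt_pow_left₀ h (by positivity) two_ne_zero
    rw [mul_pow, hsq c₁ h1a (by linarith)] at this
    nlinarith
  have hq2 : π ^ 2 * (5 - 3 * c₂ ^ 2) ^ 2 < 256 * (1 - c₂ ^ 2) := by
    have h : π * (5 - 3 * c₂ ^ 2) / 4 < 4 * √(1 - c₂ ^ 2) := by simp only [hf] at hf2; linarith
    have := pow_lt_pow_left₀ h (by have := Real.pi_pos; have : 0 ≤ 5 - 3 * c₂ ^ 2 := by nlinarith
                                   positivity) two_ne_zero
    rw [mul_pow, hsq c₂ (by linarith) h2b] at this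
    nlinarith
  have hy : c₁ ^ 2 < c₂ ^ 2 := by nlinarith
  have hy1 : 0 < c₁ ^ 2 := by positivity
  generalize c₁ ^ 2 = y₁ at *
  generalize c₂ ^ 2 = y₂ at *
  have k1 : (y₂ - y₁) * (π ^ 2 * 25 - 256) < 0 := by nlinarith
  have k2 : y₁ * (π ^ 2 * (5 - 3 * y₂) ^ 2 - 256 * (1 - y₂)) < 0 := by nlinarith
  have k3 : 0 < y₂ * (π ^ 2 * (5 - 3 * y₁) ^ 2 - 256 * (1 - y₁)) := by nlinarith
  have k4 : 0 < π ^ 2 * (y₁ * y₂ * (y₂ - y₁)) := by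
    have := Real.pi_pos; have : 0 < y₂ - y₁ := by linarith
    have : 0 < y₂ := by linarith
    positivity
  nlinarith

lemma four_mul_integral_sqrt_le {s : ℝ} (h0 : 0 ≤ s) (h1 : s ≤ 1) :
    4 * ∫ u in s..1, √(1 - u ^ 2) ≤ π * lensBound s := by
  have hc : Continuous fun u : ℝ => √(1 - u ^ 2) := by fun_prop
  have h := lens_integral_nonneg h0 h1
  rw [intervalIntegral.integral_sub ((by fun_prop : Continuous fun u : ℝ =>
      4 * √(1 - u ^ 2)).intervalIntegrable _ _) ((by fun_prop : Continuous fun u : ℝ =>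
      π * (5 - 3 * u ^ 2) / 4).intervalIntegrable _ _), intervalIntegral.integral_const_mul,
      integral_lens_polynomial] at h
  have h2 := intervalIntegral.integral_add_adjacent_intervals (hc.intervalIntegrable (μ := volume) 0 s)
    (hc.intervalIntegrable s 1)
  rw [integral_sqrt_zero_one] at h2
  rw [lensBound]
  nlinarith

lemma lensBound_nonneg {s : ℝ} (h0 : 0 ≤ s) (h1 : s ≤ 1) : 0 ≤ lensBound s := by
  rw [lensBound]; nlinarith [mul_nonneg h0 (sub_nonneg.2 h1), mul_nonneg (mul_nonneg h0 (sub_nonneg.2 h1)) h0]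

lemma integral_sqrt_sq_sub {r s : ℝ} (hr : 0 < r) :
    ∫ u in (s * r)..r, √(r ^ 2 - u ^ 2) = r ^ 2 * ∫ u in s..1, √(1 - u ^ 2) := by
  have h := intervalIntegral.mul_integral_comp_mul_right (f := fun u : ℝ => √(r ^ 2 - u ^ 2)) (a := s)
    (b := 1) (c := r)
  rw [one_mul] at h
  have h2 : ∫ u in s..1, √(r ^ 2 - (u * r) ^ 2) = r * ∫ u in s..1, √(1 - u ^ 2) := by
    rw [← intervalIntegral.integral_const_mul]
    refine intervalIntegral.integral_congr fun u _ => ?_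
    rw [show r ^ 2 - (u * r) ^ 2 = r ^ 2 * (1 - u ^ 2) by ring, Real.sqrt_mul (by positivity),
      Real.sqrt_sq hr.le]
  rw [← h, h2]
  ring

lemma volume_real_lens_le {r s : ℝ} (hr : 0 < r) (h0 : 0 ≤ s) (h1 : s ≤ 1) :
    volume {x : ℂ | (|x.re| + s * r) ^ 2 + x.im ^ 2 ≤ r ^ 2} ≤
      ENNReal.ofReal (π * r ^ 2 * lensBound s) := by
  set S : Set (ℝ × ℝ) := {x | (|x.1| + s * r) ^ 2 + x.2 ^ 2 ≤ r ^ 2} with hS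
  have hSm : MeasurableSet S := by
    refine (isClosed_le ?_ ?_).measurableSet <;> fun_prop
  have e1 : volume {x : ℂ | (|x.re| + s * r) ^ 2 + x.im ^ 2 ≤ r ^ 2} = volume S :=
    Complex.volume_preserving_equiv_real_prod.measure_preimage hSm.nullMeasurableSet
  set φ : ℝ → ℝ := fun x => 2 * √(r ^ 2 - (|x| + s * r) ^ 2) with hφ
  have hφc : Continuous φ := by fun_prop
  rw [e1, Measure.volume_eq_prod, Measure.prod_apply hSm]
  have e2 : ∀ x, volume (Prod.mk x ⁻¹' S) ≤ ENNReal.ofReal (φ x) := by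
    intro x
    have : Prod.mk x ⁻¹' S ⊆ Set.Icc (-√(r ^ 2 - (|x| + s * r) ^ 2)) √(r ^ 2 - (|x| + s * r) ^ 2) := by
      intro y hy
      simp only [hS, Set.mem_preimage, Set.mem_ofPred_eq] at hy
      rw [Set.mem_Icc, ← abs_le]
      exact Real.abs_le_sqrt (by linarith)
    refine (measure_mono this).trans ?_
    rw [Real.volume_Icc, hφ]
    apply le_of_eq; congr 1; ring
  have hvan : ∀ x, x ∉ Set.Icc (-((1 - s) * r)) ((1 - s) * r) → ENNReal.ofReal (φ x) = 0 := by
    intro x hx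
    have hx' : (1 - s) * r < |x| := by
      rw [Set.mem_Icc, ← abs_le, not_le] at hx; exact hx
    have hsr : 0 ≤ s * r := by positivity
    have : r ^ 2 - (|x| + s * r) ^ 2 ≤ 0 := by nlinarith
    simp [hφ, Real.sqrt_eq_zero_of_nonpos this]
  have hsr : 0 ≤ (1 - s) * r := mul_nonneg (by linarith) hr.le
  calc ∫⁻ x, volume (Prod.mk x ⁻¹' S) ≤ ∫⁻ x, ENNReal.ofReal (φ x) := lintegral_mono e2
    _ = ∫⁻ x in Set.Icc (-((1 - s) * r)) ((1 - s) * r), ENNReal.ofReal (φ x) := by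
        rw [← lintegral_indicator measurableSet_Icc]
        refine lintegral_congr fun x => ?_
        by_cases hx : x ∈ Set.Icc (-((1 - s) * r)) ((1 - s) * r)
        · rw [Set.indicator_of_mem hx]
        · rw [Set.indicator_of_notMem hx, hvan x hx]
    _ = ENNReal.ofReal (∫ x in (-((1 - s) * r))..((1 - s) * r), φ x) := by
        rw [intervalIntegral.integral_of_le (by linarith), ← integral_Icc_eq_integral_Ioc,
          ofReal_integral_eq_lintegral_ofReal (hφc.integrableOn_Icc)]
        exact Filter.Eventually.of_forall fun x => by simp only [hφ, Pi.zero_apply]; positivity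
    _ ≤ _ := by
        refine ENNReal.ofReal_le_ofReal ?_
        rw [← intervalIntegral.integral_add_adjacent_intervals (hφc.intervalIntegrable _ 0)
          (hφc.intervalIntegrable 0 _)]
        have h2 := intervalIntegral.integral_comp_neg (f := φ) (a := 0) (b := (1 - s) * r)
        simp only [hφ, abs_neg, neg_zero] at h2
        have h3 : ∫ x in (0 : ℝ)..((1 - s) * r), φ x = 2 * ∫ u in (s * r)..r, √(r ^ 2 - u ^ 2) := by
          have := intervalIntegral.integral_comp_add_right (f := fun u => √(r ^ 2 - u ^ 2))
            (a := 0) (b := (1 - s) * r) (s * r)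
          rw [show (1 - s) * r + s * r = r by ring, zero_add] at this
          rw [← this, ← intervalIntegral.integral_const_mul]
          refine intervalIntegral.integral_congr fun u hu => ?_
          rw [Set.uIcc_of_le hsr] at hu
          simp only [hφ, abs_of_nonneg hu.1]
        simp only [hφ] at h3 ⊢
        rw [← h2, h3, integral_sqrt_sq_sub hr]
        have := mul_le_mul_of_nonneg_left (four_mul_integral_sqrt_le h0 h1) (sq_nonneg r)
        linarith

/-- An upper bound for the area of the intersection of two discs of the same radius. -/
theorem volume_closedBall_inter_le {r : ℝ} (hr : 0 < r) (v : ℂ) :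
    volume (Metric.closedBall (0 : ℂ) r ∩ (fun x => v + x) ⁻¹' Metric.closedBall (0 : ℂ) r) ≤
      if ‖v‖ ≤ 2 * r then ENNReal.ofReal (π * r ^ 2 * lensBound (‖v‖ / (2 * r))) else 0 := by
  split_ifs with hv
  · obtain ⟨u, hu, hvu⟩ : ∃ u : ℂ, ‖u‖ = 1 ∧ v = u * ‖v‖ := by
      refine ⟨Complex.exp (v.arg * Complex.I), Complex.norm_exp_ofReal_mul_I _, ?_⟩
      rw [mul_comm, Complex.norm_mul_exp_arg_mul_I]
    have hs0 : 0 ≤ ‖v‖ / (2 * r) := by positivity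
    have hs1 : ‖v‖ / (2 * r) ≤ 1 := by rw [div_le_one (by positivity)]; exact hv
    refine le_trans ?_ (volume_real_lens_le hr hs0 hs1)
    set R := rotation ⟨u, by simpa [Submonoid.unitSphere] using hu⟩ with hR
    have hR' : ∀ x, R x = u * x := fun x => by rw [hR]; rfl
    have hmp : MeasurePreserving (fun x : ℂ => R x - v / 2) volume volume :=
      (measurePreserving_sub_right volume (v / 2)).comp R.measurePreserving
    have hm : MeasurableSet
        (Metric.closedBall (0 : ℂ) r ∩ (fun x => v + x) ⁻¹' Metric.closedBall (0 : ℂ) r) :=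
      Metric.isClosed_closedBall.measurableSet.inter
        (measurable_const_add v Metric.isClosed_closedBall.measurableSet)
    rw [← hmp.measure_preimage hm.nullMeasurableSet]
    refine measure_mono fun x hx => ?_
    simp only [Set.mem_preimage, Set.mem_inter_iff, mem_closedBall_zero_iff, hR'] at hx
    obtain ⟨hx1, hx2⟩ := hx
    have e1 : u * x - v / 2 = u * (x - (‖v‖ / 2 : ℝ)) := by
      conv_lhs => rw [hvu]
      push_cast; ring
    have e2 : v + (u * x - v / 2) = u * (x + (‖v‖ / 2 : ℝ)) := by
      rw [show v + (u * x - v / 2) = u * x + v / 2 by ring]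
      conv_lhs => rw [hvu]
      push_cast; ring
    rw [e1, norm_mul, hu, one_mul, Complex.norm_def, Real.sqrt_le_left hr.le,
      Complex.normSq_apply] at hx1
    rw [e2, norm_mul, hu, one_mul, Complex.norm_def, Real.sqrt_le_left hr.le,
      Complex.normSq_apply] at hx2
    simp at hx1 hx2
    rw [Set.mem_ofPred_eq, show ‖v‖ / (2 * r) * r = ‖v‖ / 2 by field_simp]
    rcases abs_cases x.re with ⟨h, -⟩ | ⟨h, -⟩ <;> rw [h] <;> nlinarith
  · have : Metric.closedBall (0 : ℂ) r ∩ (fun x => v + x) ⁻¹' Metric.closedBall (0 : ℂ) r = ∅ := by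
      ext x
      simp only [Set.mem_inter_iff, Set.mem_preimage, mem_closedBall_zero_iff, Set.mem_empty_iff_false,
        iff_false, not_and]
      intro h1 h2
      have := norm_sub_le (v + x) x
      rw [add_sub_cancel_right] at this
      linarith
    rw [this, measure_empty]
end PureCubic

namespace PureCubic

open MeasureTheory Finset
open scoped ENNReal Real

lemma integral_lensBound (s : ℝ) : ∫ σ in s..1, (5 / 4 - 3 / 4 * σ ^ 2) = lensBound s := by
  have : ∀ u : ℝ, HasDerivAt (fun u => 5 / 4 * u - 1 / 4 * u ^ 3) (5 / 4 - 3 / 4 * u ^ 2) u := by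
    intro u
    have := ((hasDerivAt_id u).const_mul (5 / 4)).sub ((hasDerivAt_pow 3 u).const_mul (1 / 4))
    convert! this using 1
    simp; ring
  rw [intervalIntegral.integral_eq_sub_of_hasDerivAt (fun u _ => this u)
    ((by fun_prop : Continuous fun u : ℝ => 5 / 4 - 3 / 4 * u ^ 2).intervalIntegrable _ _), lensBound]
  ring

lemma integral_weight_mul_log (δ u : ℝ) (hu : 0 < u) :
    ∫ σ in (0 : ℝ)..1, (5 / 4 - 3 / 4 * σ ^ 2) *
      (δ * (σ ^ 2 * u * Real.log (σ ^ 2 * u) + 2 * (σ ^ 2 * u)) + 1) =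
    δ * (4 / 15 * (u * Real.log u) + 71 / 225 * u) + 1 := by
  set f := fun σ : ℝ => δ * u * ((Real.log u + 2) * (5 / 12 * σ ^ 3 - 3 / 20 * σ ^ 5) +
    2 * ((5 / 12 * σ ^ 2 - 3 / 20 * σ ^ 4) * (σ * Real.log σ) - (5 / 36 * σ ^ 3 - 3 / 100 * σ ^ 5))) +
    (5 / 4 * σ - 1 / 4 * σ ^ 3) with hf
  have hml := Real.continuous_mul_log
  have hfc : Continuous f := by
    have : Continuous fun σ : ℝ => (5 / 12 * σ ^ 2 - 3 / 20 * σ ^ 4) * (σ * Real.log σ) :=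
      (by fun_prop : Continuous fun σ : ℝ => (5 / 12 * σ ^ 2 - 3 / 20 * σ ^ 4)).mul hml
    fun_prop
  have hgc : Continuous fun σ : ℝ => (5 / 4 - 3 / 4 * σ ^ 2) *
      (δ * (σ ^ 2 * u * Real.log (σ ^ 2 * u) + 2 * (σ ^ 2 * u)) + 1) := by
    have : Continuous fun σ : ℝ => σ ^ 2 * u * Real.log (σ ^ 2 * u) :=
      hml.comp (by fun_prop : Continuous fun σ : ℝ => σ ^ 2 * u)
    fun_prop
  rw [intervalIntegral.integral_eq_sub_of_hasDerivAt_of_le (f := f) zero_le_one hfc.continuousOn _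
    (hgc.intervalIntegrable _ _)]
  · simp [hf]; ring
  · intro σ hσ
    have hσ0 : σ ≠ 0 := hσ.1.ne'
    have hp : ∀ (n : ℕ), HasDerivAt (fun x : ℝ => x ^ n) (n * σ ^ (n - 1)) σ :=
      fun n => hasDerivAt_pow n σ
    have hlog := (hasDerivAt_id σ).mul (Real.hasDerivAt_log hσ0)
    have h1 := (((hp 3).const_mul (5 / 12)).sub ((hp 5).const_mul (3 / 20))).const_mul (Real.log u + 2)
    have h2 := ((((hp 2).const_mul (5 / 12)).sub ((hp 4).const_mul (3 / 20))).mul hlog).sub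
      (((hp 3).const_mul (5 / 36)).sub ((hp 5).const_mul (3 / 100)))
    have h3 := ((hasDerivAt_id σ).const_mul (5 / 4)).sub ((hp 3).const_mul (1 / 4))
    have := ((h1.add (h2.const_mul 2)).const_mul (δ * u)).add h3
    convert! this using 1
    rw [Real.log_mul (by positivity) hu.ne', Real.log_pow]
    simp
    field_simp
    ring

/-- Partial summation against the weight `lensBound`. -/
lemma sum_mul_lensBound_le {a : ℕ → ℕ} {δ : ℝ}
    (hS : ∀ u : ℝ, 0 < u →
      (∑ n ∈ Ioc 0 ⌊u⌋₊, (a n : ℝ)) ≤ δ * (u * Real.log u + 2 * u) + 1) {u : ℝ} (hu : 0 < u) :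
    ∑ n ∈ Ioc 0 ⌊u⌋₊, (a n : ℝ) * lensBound √(n / u) ≤
      δ * (4 / 15 * (u * Real.log u) + 71 / 225 * u) + 1 := by
  set φ := fun σ : ℝ => 5 / 4 - 3 / 4 * σ ^ 2 with hφ
  have hφc : Continuous φ := by fun_prop
  have hφi : IntegrableOn φ (Set.Ioc 0 1) := (hφc.integrableOn_Icc).mono_set Set.Ioc_subset_Icc_self
  have h1 : ∀ n ∈ Ioc 0 ⌊u⌋₊, lensBound √(n / u) =
      ∫ σ in Set.Ioc (0 : ℝ) 1, (Set.Ici √(n / u)).indicator φ σ := by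
    intro n hn
    rw [mem_Ioc, Nat.le_floor_iff hu.le] at hn
    have hn0 : (0 : ℝ) < n := by exact_mod_cast hn.1
    have hs1 : √(n / u) ≤ 1 := by
      rw [Real.sqrt_le_left zero_le_one, one_pow, div_le_one hu]; exact hn.2
    have hs0 : 0 < √(n / u) := Real.sqrt_pos.2 (by positivity)
    rw [setIntegral_indicator measurableSet_Ici, ← integral_lensBound,
      intervalIntegral.integral_of_le hs1, ← integral_Icc_eq_integral_Ioc]
    congr 2
    ext x
    simp only [Set.mem_Icc, Set.mem_inter_iff, Set.mem_Ioc, Set.mem_Ici]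
    constructor
    · rintro ⟨h, h'⟩; exact ⟨⟨hs0.trans_le h, h'⟩, h⟩
    · rintro ⟨⟨h, h'⟩, h''⟩; exact ⟨h'', h'⟩
  rw [← integral_weight_mul_log δ u hu, intervalIntegral.integral_of_le zero_le_one]
  have hintegral : ∀ n : ℕ, IntegrableOn (fun σ => (a n : ℝ) * (Set.Ici √(n / u)).indicator φ σ)
      (Set.Ioc 0 1) := fun n => (hφi.indicator measurableSet_Ici).const_mul _
  calc ∑ n ∈ Ioc 0 ⌊u⌋₊, (a n : ℝ) * lensBound √(n / u)
      = ∫ σ in Set.Ioc (0 : ℝ) 1, ∑ n ∈ Ioc 0 ⌊u⌋₊,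
          (a n : ℝ) * (Set.Ici √(n / u)).indicator φ σ := by
        rw [integral_finsetSum _ fun n _ => hintegral n]
        refine sum_congr rfl fun n hn => ?_
        rw [h1 n hn, integral_const_mul]
    _ ≤ _ := by
        refine setIntegral_mono_on (integrable_finsetSum _ fun n _ => hintegral n) ?_ measurableSet_Ioc ?_
        · have hgc : Continuous fun σ : ℝ => (5 / 4 - 3 / 4 * σ ^ 2) *
              (δ * (σ ^ 2 * u * Real.log (σ ^ 2 * u) + 2 * (σ ^ 2 * u)) + 1) := by
            have : Continuous fun σ : ℝ => σ ^ 2 * u * Real.log (σ ^ 2 * u) :=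
              Real.continuous_mul_log.comp (by fun_prop : Continuous fun σ : ℝ => σ ^ 2 * u)
            fun_prop
          exact hgc.integrableOn_Icc.mono_set Set.Ioc_subset_Icc_self
        · intro σ hσ
          have hφ0 : 0 ≤ φ σ := by simp only [hφ]; nlinarith [hσ.1, hσ.2]
          have hσu : 0 < σ ^ 2 * u := by have := hσ.1; positivity
          refine le_trans ?_ (mul_le_mul_of_nonneg_left (hS (σ ^ 2 * u) hσu) hφ0)
          rw [mul_sum]
          have hsub : Ioc 0 ⌊σ ^ 2 * u⌋₊ ⊆ Ioc 0 ⌊u⌋₊ := by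
            refine Ioc_subset_Ioc_right (Nat.floor_le_floor ?_)
            have : σ ^ 2 ≤ 1 := pow_le_one₀ hσ.1.le hσ.2
            nlinarith
          rw [← sum_subset_zero_on_sdiff hsub (f := fun n => φ σ * (a n : ℝ))
            (g := fun n => (a n : ℝ) * (Set.Ici √(n / u)).indicator φ σ)]
          · intro n hn
            rw [mem_sdiff, mem_Ioc, mem_Ioc, Nat.le_floor_iff hσu.le] at hn
            rw [Set.indicator_of_notMem, mul_zero]
            rw [Set.mem_Ici, Real.sqrt_le_left hσ.1.le, div_le_iff₀ hu]
            tauto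
          · intro n hn
            rw [mem_Ioc, Nat.le_floor_iff hσu.le] at hn
            rw [Set.indicator_of_mem, mul_comm]
            rw [Set.mem_Ici, Real.sqrt_le_left hσ.1.le, div_le_iff₀ hu]
            exact hn.2

lemma integral_one_sub_exp_mul_le {δ X : ℝ} (hδ : 0 ≤ δ) (hX : 2 ≤ X) :
    ∫ τ in (-Real.log X)..0, (1 - Real.exp τ) *
      (δ * (4 / 15 * (X * Real.exp τ * (Real.log X + τ)) + 71 / 225 * (X * Real.exp τ)) + 1) ≤
    δ * X * (2 / 15 * Real.log X - 19 / 450) + Real.log X := by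
  set L := Real.log X with hL
  set f := fun τ : ℝ => δ * X * (4 / 15 * L * (Real.exp τ - Real.exp τ ^ 2 / 2) +
    4 / 15 * ((τ - 1) * Real.exp τ - (τ / 2 - 1 / 4) * Real.exp τ ^ 2) +
    71 / 225 * (Real.exp τ - Real.exp τ ^ 2 / 2)) + τ - Real.exp τ with hf
  have hd : ∀ τ, HasDerivAt f ((1 - Real.exp τ) *
      (δ * (4 / 15 * (X * Real.exp τ * (L + τ)) + 71 / 225 * (X * Real.exp τ)) + 1)) τ := by
    intro τ
    have he := Real.hasDerivAt_exp τ
    have he2 := he.pow 2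
    have h1 := he.sub (he2.div_const 2)
    have h2 := (((hasDerivAt_id τ).sub_const 1).mul he).sub
      ((((hasDerivAt_id τ).div_const 2).sub_const (1 / 4)).mul he2)
    have := ((((h1.const_mul (4 / 15 * L)).add (h2.const_mul (4 / 15))).add
      (h1.const_mul (71 / 225))).const_mul (δ * X)).add (hasDerivAt_id τ) |>.sub he
    convert! this using 1
    simp
    ring
  rw [intervalIntegral.integral_eq_sub_of_hasDerivAt (fun τ _ => hd τ)
    ((by fun_prop : Continuous fun τ : ℝ => (1 - Real.exp τ) * (δ * (4 / 15 * (X * Real.exp τ *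
      (L + τ)) + 71 / 225 * (X * Real.exp τ)) + 1)).intervalIntegrable _ _)]
  have hexp : Real.exp (-L) = X⁻¹ := by rw [Real.exp_neg, hL, Real.exp_log (by linarith)]
  have hX0 : X ≠ 0 := by linarith
  have e1 : f (-L) = δ * (11 / 225 - 41 / 450 * X⁻¹) - L - X⁻¹ := by
    simp only [hf, hexp]; field_simp; ring
  have e0 : f 0 = δ * X * (2 / 15 * L - 19 / 450) - 1 := by
    simp only [hf, Real.exp_zero]; ring
  have hXi : X⁻¹ ≤ 1 / 2 := by rw [inv_le_comm₀ (by linarith) (by norm_num)]; linarith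
  rw [e1, e0]
  nlinarith

/-- The contribution of an ideal of norm `n` at the point `τ`. -/
noncomputable def kernel (X : ℝ) (n : ℕ) (τ : ℝ) : ℝ≥0∞ :=
  if τ ≤ 0 ∧ (n : ℝ) ≤ X * Real.exp τ then
    ENNReal.ofReal ((1 - Real.exp τ) * lensBound √(n / (X * Real.exp τ))) else 0

lemma measurable_kernel (X : ℝ) (n : ℕ) : Measurable (kernel X n) := by
  have h : Measurable fun τ : ℝ => X * Real.exp τ := by fun_prop
  have hf : Measurable fun τ : ℝ =>
      ENNReal.ofReal ((1 - Real.exp τ) * lensBound √(n / (X * Real.exp τ))) := by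
    unfold lensBound; fun_prop
  exact Measurable.ite ((measurableSet_le measurable_id measurable_const).inter
    (measurableSet_le measurable_const h)) hf measurable_const

theorem tsum_mul_lintegral_kernel_le {a : ℕ → ℕ} (ha0 : a 0 = 0) {δ X : ℝ} (hδ : 0 ≤ δ) (hX : 2 ≤ X)
    (hS : ∀ u : ℝ, 0 < u →
      (∑ n ∈ Ioc 0 ⌊u⌋₊, (a n : ℝ)) ≤ δ * (u * Real.log u + 2 * u) + 1) :
    ∑' n, (a n : ℝ≥0∞) * ∫⁻ τ, kernel X n τ ≤
      ENNReal.ofReal (δ * X * (2 / 15 * Real.log X - 19 / 450) + Real.log X) := by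
  have hX0 : 0 < X := by linarith
  have hL : 0 ≤ Real.log X := Real.log_nonneg (by linarith)
  set ψ := fun τ : ℝ => (1 - Real.exp τ) *
      (δ * (4 / 15 * (X * Real.exp τ * (Real.log X + τ)) + 71 / 225 * (X * Real.exp τ)) + 1) with hψ
  have hψc : Continuous ψ := by fun_prop
  have hψ0 : ∀ τ, -Real.log X ≤ τ → τ ≤ 0 → 0 ≤ ψ τ := by
    intro τ h1 h2
    have : Real.exp τ ≤ 1 := Real.exp_le_one_iff.2 h2
    have h3 : 0 ≤ Real.log X + τ := by linarith
    have h4 : 0 ≤ 1 - Real.exp τ := by linarith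
    simp only [hψ]; positivity
  have key : ∀ τ, ∑' n, (a n : ℝ≥0∞) * kernel X n τ ≤
      (Set.Icc (-Real.log X) 0).indicator (fun τ => ENNReal.ofReal (ψ τ)) τ := by
    intro τ
    set u := X * Real.exp τ with hu
    have hu0 : 0 < u := by positivity
    rw [tsum_eq_sum (s := Ioc 0 ⌊u⌋₊)]
    · by_cases hτ : τ ∈ Set.Icc (-Real.log X) 0
      · rw [Set.indicator_of_mem hτ]
        have h4 : 0 ≤ 1 - Real.exp τ := by linarith [Real.exp_le_one_iff.2 hτ.2]
        have e : ∀ n ∈ Ioc 0 ⌊u⌋₊, (a n : ℝ≥0∞) * kernel X n τ =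
            ENNReal.ofReal ((1 - Real.exp τ) * ((a n : ℝ) * lensBound √(n / u))) := by
          intro n hn
          rw [mem_Ioc, Nat.le_floor_iff hu0.le] at hn
          rw [kernel, if_pos ⟨hτ.2, hn.2⟩, ← ENNReal.ofReal_natCast, ← ENNReal.ofReal_mul (by simp)]
          congr 1; ring
        rw [sum_congr rfl e, ← ENNReal.ofReal_sum_of_nonneg, ← mul_sum]
        · refine ENNReal.ofReal_le_ofReal ?_
          have := mul_le_mul_of_nonneg_left (sum_mul_lensBound_le hS hu0) h4
          rwa [hu, Real.log_mul hX0.ne' (Real.exp_ne_zero _), Real.log_exp] at this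
        · intro n hn
          rw [mem_Ioc, Nat.le_floor_iff hu0.le] at hn
          have := lensBound_nonneg (s := √(n / u)) (by positivity)
            (by rw [Real.sqrt_le_left zero_le_one, one_pow, div_le_one hu0]; exact hn.2)
          positivity
      · rw [Set.indicator_of_notMem hτ]
        refine le_of_eq (sum_eq_zero fun n hn => ?_)
        rw [kernel, if_neg, mul_zero]
        rintro ⟨h1, h2⟩
        refine hτ ⟨?_, h1⟩
        have hn1 : (1 : ℝ) ≤ n := by simp at hn; exact_mod_cast hn.1
        have := Real.log_nonneg (hn1.trans h2)
        rw [Real.log_mul hX0.ne' (Real.exp_ne_zero _), Real.log_exp] at this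
        linarith
    · intro n hn
      rcases Nat.eq_zero_or_pos n with rfl | hn0
      · simp [ha0]
      rw [kernel, if_neg, mul_zero]
      rintro ⟨h1, h2⟩
      exact hn (mem_Ioc.2 ⟨hn0, Nat.le_floor h2⟩)
  calc ∑' n, (a n : ℝ≥0∞) * ∫⁻ τ, kernel X n τ = ∫⁻ τ, ∑' n, (a n : ℝ≥0∞) * kernel X n τ := by
        rw [lintegral_tsum fun n => ((measurable_kernel X n).const_mul _).aemeasurable]
        refine tsum_congr fun n => ?_
        rw [lintegral_const_mul _ (measurable_kernel X n)]
    _ ≤ ∫⁻ τ in Set.Icc (-Real.log X) 0, ENNReal.ofReal (ψ τ) := by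
        rw [← lintegral_indicator measurableSet_Icc]
        exact lintegral_mono key
    _ = ENNReal.ofReal (∫ τ in (-Real.log X)..0, ψ τ) := by
        rw [intervalIntegral.integral_of_le (by linarith), ← integral_Icc_eq_integral_Ioc,
          ofReal_integral_eq_lintegral_ofReal hψc.integrableOn_Icc]
        refine (ae_restrict_iff' measurableSet_Icc).2 (Filter.Eventually.of_forall fun τ hτ => ?_)
        exact hψ0 τ hτ.1 hτ.2
    _ ≤ _ := ENNReal.ofReal_le_ofReal (integral_one_sub_exp_mul_le hδ hX)
end PureCubic

namespace PureCubic

open MeasureTheory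
open scoped ENNReal Real

/-- The product of an interval and a disc. -/
def box (A R : ℝ) : Set (ℝ × ℂ) := Set.Icc (-A) A ×ˢ Metric.closedBall 0 R

lemma measurableSet_box (A R : ℝ) : MeasurableSet (box A R) :=
  measurableSet_Icc.prod Metric.isClosed_closedBall.measurableSet

lemma volume_box {A R : ℝ} (hR : 0 ≤ R) :
    volume (box A R) = ENNReal.ofReal (2 * A) * ENNReal.ofReal (π * R ^ 2) := by
  rw [box, Measure.volume_eq_prod, Measure.prod_prod, Real.volume_Icc, Complex.volume_closedBall]
  congr 1
  · congr 1; ring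
  · rw [mul_comm, ENNReal.ofReal_mul Real.pi_pos.le]
    rw [ENNReal.ofReal_pow (by linarith), ← ENNReal.ofReal_coe_nnreal, NNReal.coe_real_pi]

lemma volume_Icc_inter_le (A v : ℝ) :
    volume (Set.Icc (-A) A ∩ (fun x => v + x) ⁻¹' Set.Icc (-A) A) ≤ ENNReal.ofReal (2 * A - |v|) := by
  rw [Set.preimage_const_add_Icc, Set.Icc_inter_Icc, Real.volume_Icc]
  refine ENNReal.ofReal_le_ofReal ?_
  rcases le_total 0 v with h | h
  · rw [abs_of_nonneg h]
    have := le_max_left (-A) (-A - v)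
    have := min_le_right A (A - v)
    linarith
  · rw [abs_of_nonpos h]
    have := le_max_right (-A) (-A - v)
    have := min_le_left A (A - v)
    linarith

lemma volume_box_inter_le {A R X τ : ℝ} {n : ℕ} {v : ℝ × ℂ} (hA : 0 < A) (hR : 0 < R) (hX : 0 < X)
    (hτ : Real.exp τ = |v.1| / (2 * A)) (hn : n * (4 * R ^ 2) = X * Real.exp τ * ‖v.2‖ ^ 2) :
    volume (box A R ∩ (fun x => v + x) ⁻¹' box A R) ≤ volume (box A R) * kernel X n τ := by
  have he := Real.exp_pos τ
  have hs : √(n / (X * Real.exp τ)) = ‖v.2‖ / (2 * R) := by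
    rw [Real.sqrt_eq_iff_mul_self_eq (by positivity) (by positivity)]
    field_simp
    nlinarith
  have hv1 : |v.1| = 2 * A * Real.exp τ := by rw [hτ]; field_simp
  have hset : box A R ∩ (fun x => v + x) ⁻¹' box A R =
      (Set.Icc (-A) A ∩ (fun x => v.1 + x) ⁻¹' Set.Icc (-A) A) ×ˢ
      (Metric.closedBall 0 R ∩ (fun x => v.2 + x) ⁻¹' Metric.closedBall 0 R) := by
    ext x
    simp only [box, Set.mem_inter_iff, Set.mem_prod, Set.mem_preimage, Prod.fst_add, Prod.snd_add]
    tauto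
  rw [hset, Measure.volume_eq_prod, Measure.prod_prod]
  have h1 := volume_Icc_inter_le A v.1
  have h2 := volume_closedBall_inter_le hR v.2
  refine (mul_le_mul' h1 h2).trans ?_
  rw [← Measure.volume_eq_prod, volume_box hR.le, kernel, hv1]
  by_cases ht : τ ≤ 0
  · have h4 : 0 ≤ 1 - Real.exp τ := by linarith [Real.exp_le_one_iff.2 ht]
    have hiff : (n : ℝ) ≤ X * Real.exp τ ↔ ‖v.2‖ ≤ 2 * R := by
      rw [← div_le_one (by positivity : 0 < X * Real.exp τ), ← div_le_one (by positivity : 0 < 2 * R),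
        ← hs, Real.sqrt_le_left zero_le_one, one_pow]
    by_cases hv : ‖v.2‖ ≤ 2 * R
    · rw [if_pos hv, if_pos ⟨ht, hiff.2 hv⟩, hs, ← ENNReal.ofReal_mul (by nlinarith),
        ← ENNReal.ofReal_mul (by positivity), ← ENNReal.ofReal_mul (by positivity)]
      refine ENNReal.ofReal_le_ofReal (le_of_eq ?_)
      ring
    · rw [if_neg hv]; simp
  · rw [ENNReal.ofReal_of_nonpos]
    · simp
    · have := Real.one_lt_exp_iff.2 (not_le.1 ht)
      nlinarith
end PureCubic

namespace PureCubic

open MeasureTheory NumberField NumberField.InfinitePlace NumberField.mixedEmbedding Module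
open scoped ENNReal Real nonZeroDivisors Classical

lemma measurePreserving_eval_of_subsingleton {ι : Type*} [Fintype ι] [Subsingleton ι] (E : Type*)
    [MeasureSpace E] (i : ι) : MeasurePreserving (fun f : ι → E => f i) volume volume := by
  let _ : Unique ι := uniqueOfSubsingleton i
  exact measurePreserving_piUnique (m := fun _ : ι => inferInstance) fun _ => (volume : Measure E)

variable (K : Type*) [Field K] [NumberField K]

lemma volume_fundamentalDomain_idealLattice (w₂ : {w : InfinitePlace K // IsComplex w})
    [Subsingleton {w : InfinitePlace K // IsComplex w}]
    (I : (Ideal (𝓞 K))⁰) :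
    volume (ZSpan.fundamentalDomain (fractionalIdealLatticeBasis K (FractionalIdeal.mk0 K I))) =
      ENNReal.ofReal (Ideal.absNorm (I : Ideal (𝓞 K)) / 2 * √|discr K|) := by
  classical
  rw [volume_fundamentalDomain_fractionalIdealLatticeBasis, volume_fundamentalDomain_latticeBasis,
    nrComplexPlaces, Fintype.card_eq_one_iff.2 ⟨w₂, fun w => Subsingleton.elim w w₂⟩, pow_one,
    FractionalIdeal.coe_mk0, FractionalIdeal.coeIdeal_absNorm, Rat.cast_natCast,
    ← ENNReal.ofReal_coe_nnreal, Real.coe_sqrt, coe_nnnorm, Int.norm_eq_abs, div_eq_mul_inv, mul_assoc,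
    ENNReal.ofReal_mul (by positivity), ENNReal.ofReal_mul (by positivity),
    ENNReal.ofReal_inv_of_pos two_pos, ENNReal.ofReal_ofNat]

variable (w₁ : {w : InfinitePlace K // IsReal w}) (w₂ : {w : InfinitePlace K // IsComplex w})
  [Subsingleton {w : InfinitePlace K // IsReal w}] [Subsingleton {w : InfinitePlace K // IsComplex w}]

/-- The mixed space of a complex cubic field as `ℝ × ℂ`. -/
def toProd (x : mixedSpace K) : ℝ × ℂ := (x.1 w₁, x.2 w₂)

lemma measurePreserving_toProd : MeasurePreserving (toProd K w₁ w₂) volume volume := by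
  exact (measurePreserving_eval_of_subsingleton ℝ w₁).prod (measurePreserving_eval_of_subsingleton ℂ w₂)

/-- The real embedding of a complex cubic field. -/
noncomputable def realEmb : K →+* ℝ :=
  (Pi.evalRingHom _ w₁).comp ((RingHom.fst _ _).comp (mixedEmbedding K))

/-- The normalized complex embedding of a complex cubic field. -/
noncomputable def complexEmb : K →+* ℂ :=
  (Pi.evalRingHom _ w₂).comp ((RingHom.snd _ _).comp (mixedEmbedding K))

lemma abs_realEmb_mul_norm_complexEmb (x : K) :
    |realEmb K w₁ x| * ‖complexEmb K w₂ x‖ ^ 2 = |Algebra.norm ℚ x| := by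
  have hne : w₁.1 ≠ w₂.1 := fun h => not_isReal_iff_isComplex.2 w₂.2 (h ▸ w₁.2)
  have huniv : (Finset.univ : Finset (InfinitePlace K)) = {w₁.1, w₂.1} := by
    ext w
    simp only [Finset.mem_univ, Finset.mem_insert, Finset.mem_singleton, true_iff]
    rcases isReal_or_isComplex w with h | h
    · exact Or.inl (congrArg Subtype.val (Subsingleton.elim (⟨w, h⟩ : {w // IsReal w}) w₁))
    · exact Or.inr (congrArg Subtype.val (Subsingleton.elim (⟨w, h⟩ : {w // IsComplex w}) w₂))
  have h := prod_eq_abs_norm x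
  rw [huniv, Finset.prod_pair hne, mult_isReal w₁, mult_isComplex w₂, pow_one,
    ← norm_embedding_of_isReal w₁.2, ← norm_embedding_eq] at h
  rw [← h, realEmb, complexEmb]
  rfl

lemma absNorm_eq_realEmb (x : 𝓞 K) :
    (Ideal.absNorm (Ideal.span {x}) : ℝ) = |realEmb K w₁ x| * ‖complexEmb K w₂ x‖ ^ 2 := by
  rw [abs_realEmb_mul_norm_complexEmb, Ideal.absNorm_span_singleton, Nat.cast_natAbs, Int.cast_abs,
    ← Algebra.coe_norm_int]
  push_cast
  rfl

/-- The lower bound for weighted counts of elements of an ideal given by comparing the volume of a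
box with the covolume of the ideal. -/
theorem le_one_add_tsum_kernel (w₂ : {w : InfinitePlace K // IsComplex w}) (I : (Ideal (𝓞 K))⁰) {X : ℝ} (hX : 0 < X) (t : ℝ) :
    ENNReal.ofReal (π * X / (2 * √|discr K|)) ≤
      1 + ∑' x : {x : 𝓞 K // x ∈ (I : Ideal (𝓞 K)) ∧ x ≠ 0},
        kernel X (Ideal.absNorm (Ideal.span {(x : 𝓞 K)}) / Ideal.absNorm (I : Ideal (𝓞 K)))
          (t + (Real.log |realEmb K w₁ (x : 𝓞 K)| -
            Real.log (X * Ideal.absNorm (I : Ideal (𝓞 K)) / 4))) := by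
  classical
  set N := Ideal.absNorm (I : Ideal (𝓞 K)) with hN
  have hN0 : 0 < (N : ℝ) := by exact_mod_cast Ideal.absNorm_pos_of_nonZeroDivisors I
  set b := fractionalIdealLatticeBasis K (FractionalIdeal.mk0 K I) with hb
  set L := (Submodule.span ℤ (Set.range b)).toAddSubgroup with hL
  set A := X * N / 8 * Real.exp (-t) with hA
  set R := Real.exp (t / 2) with hR
  have hA0 : 0 < A := by positivity
  have hR0 : 0 < R := by positivity
  have hRt : R ^ 2 = Real.exp t := by rw [hR, ← Real.exp_nat_mul]; congr 1; push_cast; ring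
  have hd : (0 : ℝ) < |(discr K : ℝ)| := abs_pos.2 (by exact_mod_cast discr_ne_zero K)
  set B := toProd K w₁ w₂ ⁻¹' box A R with hB
  have hmp := measurePreserving_toProd K w₁ w₂
  have hBm : MeasurableSet B := hmp.measurable (measurableSet_box A R)
  set V := ENNReal.ofReal (π * X * N / 4) with hV
  set D := ENNReal.ofReal (N / 2 * √|discr K|) with hD
  have hVB : volume (box A R) = V := by
    rw [volume_box hR0.le, ← ENNReal.ofReal_mul (by positivity), hV, hRt, hA]
    congr 1
    have : Real.exp (-t) * Real.exp t = 1 := by rw [← Real.exp_add]; simp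
    linear_combination π * X * N / 4 * this
  have hV0 : V ≠ 0 := by rw [hV, Ne, ENNReal.ofReal_eq_zero, not_le]; positivity
  have hVt : V ≠ ⊤ := ENNReal.ofReal_ne_top
  have hD0 : D ≠ 0 := by rw [hD, Ne, ENNReal.ofReal_eq_zero, not_le]; positivity
  have hDt : D ≠ ⊤ := ENNReal.ofReal_ne_top
  have : Countable L := by change Countable (Submodule.span ℤ (Set.range b)); infer_instance
  have hmain := sq_measure_le (ZSpan.isAddFundamentalDomain' b volume) (L := L) hBm
  rw [hb, volume_fundamentalDomain_idealLattice K w₂, hmp.measure_preimage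
    (measurableSet_box A R).nullMeasurableSet, hVB] at hmain
  set g : L → ℝ≥0∞ := fun v => volume (B ∩ (fun x => (v : mixedSpace K) + x) ⁻¹' B) with hg
  set S := {x : 𝓞 K // x ∈ (I : Ideal (𝓞 K)) ∧ x ≠ 0}
  set k : S → ℝ≥0∞ := fun x => kernel X (Ideal.absNorm (Ideal.span {(x : 𝓞 K)}) / N)
    (t + (Real.log |realEmb K w₁ (x : 𝓞 K)| - Real.log (X * N / 4))) with hk
  change _ ≤ D * ∑' v : L, g v at hmain
  change _ ≤ 1 + ∑' x, k x
  have hmem : ∀ x : mixedSpace K, x ∈ L ↔ ∃ y : 𝓞 K, y ∈ (I : Ideal (𝓞 K)) ∧ mixedEmbedding K y = x := by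
    intro x
    rw [hL, Submodule.mem_toAddSubgroup, mem_span_fractionalIdealLatticeBasis]
    simp [FractionalIdeal.coe_mk0]
  have hg0 : g 0 ≤ V := by
    rw [← hVB, ← hmp.measure_preimage (measurableSet_box A R).nullMeasurableSet]
    exact measure_mono Set.inter_subset_left
  let j : S → L := fun x => ⟨mixedEmbedding K (x : 𝓞 K), (hmem _).2 ⟨x, x.2.1, rfl⟩⟩
  have hj : Function.Injective j := by
    intro x y h
    have := congrArg (Subtype.val) h
    exact Subtype.ext (RingOfIntegers.coe_injective (mixedEmbedding_injective K this))
  have hgk : ∀ x : S, g (j x) ≤ V * k x := by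
    intro x
    have e : B ∩ (fun y => ((j x : L) : mixedSpace K) + y) ⁻¹' B = toProd K w₁ w₂ ⁻¹'
        (box A R ∩ (fun y => (realEmb K w₁ (x : 𝓞 K), complexEmb K w₂ (x : 𝓞 K)) + y) ⁻¹' box A R) := rfl
    have hx0 : realEmb K w₁ (x : 𝓞 K) ≠ 0 := by simpa using x.2.2
    simp only [hg, e]
    rw [hmp.measure_preimage ((measurableSet_box A R).inter
      ((measurable_const_add _) (measurableSet_box A R))).nullMeasurableSet, ← hVB]
    have hexp : Real.exp (t + (Real.log |realEmb K w₁ (x : 𝓞 K)| - Real.log (X * N / 4))) =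
        |realEmb K w₁ (x : 𝓞 K)| / (2 * A) := by
      rw [Real.exp_add, Real.exp_sub, Real.exp_log (by positivity), Real.exp_log (by positivity), hA,
        Real.exp_neg]
      field_simp
      ring
    refine volume_box_inter_le hA0 hR0 hX hexp ?_
    have hdvd : N ∣ Ideal.absNorm (Ideal.span {(x : 𝓞 K)}) :=
      Ideal.absNorm_dvd_absNorm_of_le ((Ideal.span_singleton_le_iff_mem _).2 x.2.1)
    rw [Nat.cast_div hdvd hN0.ne', absNorm_eq_realEmb K w₁ w₂, hexp, hA, hRt, Real.exp_neg]
    field_simp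
    ring
  have hsum : ∑' v, g v ≤ V * (1 + ∑' x, k x) := by
    rw [ENNReal.tsum_eq_add_tsum_ite 0, mul_add, mul_one]
    refine add_le_add hg0 ?_
    rw [← hj.tsum_eq, ← ENNReal.tsum_mul_left]
    · refine ENNReal.tsum_le_tsum fun x => ?_
      split_ifs
      · simp
      · exact hgk x
    · rintro ⟨v, hv⟩ hv'
      obtain ⟨y, hy, rfl⟩ := (hmem v).1 hv
      refine ⟨⟨y, hy, ?_⟩, rfl⟩
      rintro rfl
      simp at hv'
  have h1 : V ≤ D * (1 + ∑' x, k x) := by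
    have := hmain.trans (mul_le_mul_right hsum D)
    rw [pow_two, mul_left_comm] at this
    exact (ENNReal.mul_le_mul_iff_right hV0 hVt).1 this
  refine (ENNReal.mul_le_mul_iff_right hD0 hDt).1 (le_trans (le_of_eq ?_) h1)
  rw [hD, hV, ← ENNReal.ofReal_mul (by positivity)]
  congr 1
  field_simp
  ring
end PureCubic

namespace PureCubic

open MeasureTheory NumberField NumberField.InfinitePlace NumberField.mixedEmbedding Module
open scoped ENNReal Real nonZeroDivisors Classical

lemma le_abs_log_sub_log (K : Type*) [Field K] (w₁ : {w : InfinitePlace K // IsReal w}) {T : ℝ}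
    (hT : ∀ u : (𝓞 K)ˣ, u ≠ 1 → 0 < realEmb K w₁ (u : 𝓞 K) → T ≤ |Real.log (realEmb K w₁ (u : 𝓞 K))|)
    {x y : 𝓞 K} (hxy : Ideal.span {x} = Ideal.span {y}) (hx : x ≠ 0) (hne : x ≠ y)
    (hs : 0 < realEmb K w₁ x ↔ 0 < realEmb K w₁ y) :
    T ≤ |Real.log |realEmb K w₁ x| - Real.log (|realEmb K w₁ y|)| := by
  obtain ⟨u, hu⟩ := Ideal.span_singleton_eq_span_singleton.1 hxy
  have hx0 : realEmb K w₁ x ≠ 0 := by simpa using hx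
  have hu0 : realEmb K w₁ (u : 𝓞 K) ≠ 0 := by simp
  have hmul : realEmb K w₁ y = realEmb K w₁ x * realEmb K w₁ (u : 𝓞 K) := by rw [← hu]; simp
  have hpos : 0 < realEmb K w₁ (u : 𝓞 K) := by
    rw [hmul] at hs
    rcases hx0.lt_or_gt with h | h
    · by_contra hneg
      have := mul_pos_of_neg_of_neg h (lt_of_le_of_ne (not_lt.1 hneg) hu0)
      linarith [hs.2 this]
    · exact (mul_pos_iff_of_pos_left h).1 (hs.1 h)
  have := hT u (by rintro rfl; simp at hu; exact hne hu) hpos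
  rwa [hmul, abs_mul, Real.log_mul (abs_ne_zero.2 hx0) (abs_ne_zero.2 hu0), Real.log_abs (realEmb K w₁ u),
    sub_add_cancel_left, abs_neg]

variable (K : Type*) [Field K] [NumberField K]

lemma exists_mul_eq_span {I : (Ideal (𝓞 K))⁰} {x : 𝓞 K} (hx : x ∈ (I : Ideal (𝓞 K))) (h0 : x ≠ 0) :
    ∃ J : (Ideal (𝓞 K))⁰, Ideal.span {x} = (I : Ideal (𝓞 K)) * J := by
  obtain ⟨J, hJ⟩ := Ideal.dvd_span_singleton.2 hx
  refine ⟨⟨J, mem_nonZeroDivisors_of_ne_zero ?_⟩, hJ⟩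
  rintro rfl
  simp [h0] at hJ

variable (w₁ : {w : InfinitePlace K // IsReal w}) [Subsingleton {w : InfinitePlace K // IsReal w}]
  [Subsingleton {w : InfinitePlace K // IsComplex w}]

lemma mul_le_add_tsum_lintegral_kernel (w₂ : {w : InfinitePlace K // IsComplex w})
    (C : ClassGroup (𝓞 K)) {X T : ℝ} (hX : 0 < X)
    (hT : ∀ u : (𝓞 K)ˣ, u ≠ 1 → 0 < realEmb K w₁ (u : 𝓞 K) → T ≤ |Real.log (realEmb K w₁ (u : 𝓞 K))|) :
    ENNReal.ofReal (π * X / (2 * √|discr K|)) * ENNReal.ofReal T ≤ ENNReal.ofReal T +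
      2 * ∑' J : (Ideal (𝓞 K))⁰, if ClassGroup.mk0 J = C then
        ∫⁻ τ, kernel X (Ideal.absNorm (J : Ideal (𝓞 K))) τ else 0 := by
  obtain ⟨I, hI⟩ := ClassGroup.mk0_surjective C⁻¹
  set N := Ideal.absNorm (I : Ideal (𝓞 K)) with hN
  have hN0 : 0 < N := Ideal.absNorm_pos_of_nonZeroDivisors I
  set S := {x : 𝓞 K // x ∈ (I : Ideal (𝓞 K)) ∧ x ≠ 0} with hS
  have hcount : Countable (𝓞 K) := by
    exact (RingOfIntegers.basis K).equivFun.toEquiv.injective.countable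
  set n : S → ℕ := fun x => Ideal.absNorm (Ideal.span {(x : 𝓞 K)}) / N with hn
  set l : S → ℝ := fun x => Real.log |realEmb K w₁ (x : 𝓞 K)| - Real.log (X * N / 4) with hl
  have hmeas : ∀ x : S, Measurable fun t => kernel X (n x) (t + l x) := fun x =>
    (measurable_kernel X (n x)).comp (measurable_add_const _)
  have h1 : ENNReal.ofReal (π * X / (2 * √|discr K|)) * ENNReal.ofReal T ≤
      ENNReal.ofReal T + ∑' x : S, ∫⁻ t in Set.Ico 0 T, kernel X (n x) (t + l x) := by
    calc _ = ∫⁻ t in Set.Ico 0 T, ENNReal.ofReal (π * X / (2 * √|discr K|)) := by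
          rw [setLIntegral_const, Real.volume_Ico, sub_zero]
      _ ≤ ∫⁻ t in Set.Ico 0 T, (1 + ∑' x : S, kernel X (n x) (t + l x)) :=
          lintegral_mono fun t => le_one_add_tsum_kernel K w₁ w₂ I hX t
      _ = _ := by
          rw [lintegral_add_left measurable_const, setLIntegral_const, Real.volume_Ico, sub_zero,
            one_mul, lintegral_tsum fun x => (hmeas x).aemeasurable]
  refine h1.trans (add_le_add le_rfl ?_)
  choose J hJ using fun x : S => exists_mul_eq_span K x.2.1 x.2.2
  have hnJ : ∀ x, n x = Ideal.absNorm (J x : Ideal (𝓞 K)) := by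
    intro x
    simp only [hn]
    rw [hJ, map_mul, ← hN, Nat.mul_div_cancel_left _ hN0]
  let φ : S → (Ideal (𝓞 K))⁰ × Bool := fun x => (J x, decide (0 < realEmb K w₁ (x : 𝓞 K)))
  rw [← ENNReal.tsum_fiberwise _ φ, two_mul]
  have hfib : ∀ y : (Ideal (𝓞 K))⁰ × Bool,
      ∑' x : φ ⁻¹' {y}, ∫⁻ t in Set.Ico 0 T, kernel X (n x) (t + l x) ≤
      if ClassGroup.mk0 y.1 = C then
        ∫⁻ τ, kernel X (Ideal.absNorm (y.1 : Ideal (𝓞 K))) τ else 0 := by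
    rintro ⟨Q, s⟩
    have hQ : ∀ x : φ ⁻¹' {(Q, s)}, J x = Q ∧ decide (0 < realEmb K w₁ ((x : S) : 𝓞 K)) = s := by
      intro x
      have h : φ x = (Q, s) := x.2
      exact ⟨congrArg Prod.fst h, congrArg Prod.snd h⟩
    split_ifs with h
    · have e : ∀ x : φ ⁻¹' {(Q, s)}, n x = Ideal.absNorm (Q : Ideal (𝓞 K)) := fun x => by
        rw [hnJ, (hQ x).1]
      simp_rw [e]
      refine tsum_lintegral_Ico_le (l := fun x : φ ⁻¹' {(Q, s)} => l x) ?_ _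
      intro x y hxy
      simp only [hl, sub_sub_sub_cancel_right]
      refine le_abs_log_sub_log K w₁ hT ?_ (x : S).2.2 ?_ ?_
      · rw [hJ, hJ, (hQ x).1, (hQ y).1]
      · exact fun h => hxy (Subtype.ext (Subtype.ext h))
      · exact decide_eq_decide.1 ((hQ x).2.trans (hQ y).2.symm)
    · rw [nonpos_iff_eq_zero, ENNReal.tsum_eq_zero]
      intro x
      refine absurd ?_ h
      have := hJ x
      rw [(hQ x).1] at this
      have h2 : ClassGroup.mk0 (I * Q) = 1 := by
        rw [ClassGroup.mk0_eq_one_iff]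
        rw [Submonoid.coe_mul, ← this]
        exact ⟨⟨_, rfl⟩⟩
      rw [map_mul, hI, inv_mul_eq_one] at h2
      exact h2.symm
  refine (ENNReal.tsum_le_tsum hfib).trans (le_of_eq ?_)
  rw [ENNReal.tsum_prod (f := fun (Q : (Ideal (𝓞 K))⁰) (_ : Bool) => if ClassGroup.mk0 Q = C then
    ∫⁻ τ, kernel X (Ideal.absNorm (Q : Ideal (𝓞 K))) τ else 0), ← two_mul, ← ENNReal.tsum_mul_left]
  refine tsum_congr fun Q => ?_
  rw [tsum_fintype, Fintype.sum_bool, two_mul]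

/-- The main inequality bounding the class number of a complex cubic field in terms of a lower bound
for its fundamental unit. -/
theorem classNumber_mul_le (w₂ : {w : InfinitePlace K // IsComplex w}) {X T : ℝ} (hX : 0 < X)
    (hT : ∀ u : (𝓞 K)ˣ, u ≠ 1 → 0 < realEmb K w₁ (u : 𝓞 K) → T ≤ |Real.log (realEmb K w₁ (u : 𝓞 K))|) :
    classNumber K * (ENNReal.ofReal (π * X / (2 * √|discr K|)) * ENNReal.ofReal T) ≤
      classNumber K * ENNReal.ofReal T +
      2 * ∑' n : ℕ, (Nat.card {J : (Ideal (𝓞 K))⁰ // Ideal.absNorm (J : Ideal (𝓞 K)) = n} : ℝ≥0∞) *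
        ∫⁻ τ, kernel X n τ := by
  have h := Finset.sum_le_sum fun (C : ClassGroup (𝓞 K)) (_ : C ∈ Finset.univ) =>
    mul_le_add_tsum_lintegral_kernel K w₁ w₂ C hX hT
  rw [Finset.sum_const, Finset.sum_add_distrib, Finset.sum_const, ← Finset.mul_sum, nsmul_eq_mul,
    nsmul_eq_mul, Finset.card_univ, ← Summable.tsum_finsetSum fun _ _ => ENNReal.summable] at h
  have h2 : ∑' n : ℕ, (Nat.card {J : (Ideal (𝓞 K))⁰ // Ideal.absNorm (J : Ideal (𝓞 K)) = n} : ℝ≥0∞) *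
        ∫⁻ τ, kernel X n τ = ∑' J : (Ideal (𝓞 K))⁰, ∑ C : ClassGroup (𝓞 K),
          if ClassGroup.mk0 J = C then
          ∫⁻ τ, kernel X (Ideal.absNorm (J : Ideal (𝓞 K))) τ else 0 := by
    rw [← ENNReal.tsum_fiberwise _ fun J : (Ideal (𝓞 K))⁰ => Ideal.absNorm (J : Ideal (𝓞 K))]
    refine tsum_congr fun n => ?_
    simp only [Finset.sum_ite_eq, Finset.mem_univ, if_true]
    have e : ∀ J : (fun J : (Ideal (𝓞 K))⁰ => Ideal.absNorm (J : Ideal (𝓞 K))) ⁻¹' {n},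
        ∫⁻ τ, kernel X (Ideal.absNorm ((J : (Ideal (𝓞 K))⁰) : Ideal (𝓞 K))) τ = ∫⁻ τ, kernel X n τ := by
      intro J
      rw [show Ideal.absNorm ((J : (Ideal (𝓞 K))⁰) : Ideal (𝓞 K)) = n from J.2]
    simp_rw [e]
    have hfin : Finite {J : (Ideal (𝓞 K))⁰ // Ideal.absNorm (J : Ideal (𝓞 K)) = n} :=
      Set.Finite.of_injOn (f := fun J : (Ideal (𝓞 K))⁰ => (J : Ideal (𝓞 K)))
        (fun J hJ => hJ) Subtype.val_injective.injOn (Ideal.finite_setOfPred_absNorm_eq n)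
    have hfin' : Finite ((fun J : (Ideal (𝓞 K))⁰ => Ideal.absNorm (J : Ideal (𝓞 K))) ⁻¹' {n}) := hfin
    rw [ENNReal.tsum_const, ENat.card_eq_coe_natCard]
    rfl
  rw [h2]
  exact h
end PureCubic

namespace PureCubic

open NumberField NumberField.InfinitePlace
open scoped ENNReal Real nonZeroDivisors

variable (K : Type*) [Field K] [NumberField K]

/-- The number of ideals of norm `n` (and `0` for `n = 0`). -/
noncomputable def idealCount (n : ℕ) : ℕ :=
  Nat.card {J : (Ideal (𝓞 K))⁰ // Ideal.absNorm (J : Ideal (𝓞 K)) = n}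

lemma idealCount_zero : idealCount K 0 = 0 := by
  have : IsEmpty {J : (Ideal (𝓞 K))⁰ // Ideal.absNorm (J : Ideal (𝓞 K)) = 0} :=
    ⟨fun J => (Ideal.absNorm_pos_of_nonZeroDivisors J.1).ne' J.2⟩
  rw [idealCount, Nat.card_of_isEmpty]

theorem classNumber_mul_le_of_sum_idealCount_le (w₁ : {w : InfinitePlace K // IsReal w})
    (w₂ : {w : InfinitePlace K // IsComplex w})
    [Subsingleton {w : InfinitePlace K // IsReal w}] [Subsingleton {w : InfinitePlace K // IsComplex w}]
    {X T δ : ℝ} (hX : 2 ≤ X) (hT0 : 0 ≤ T) (hδ : 0 ≤ δ)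
    (hT : ∀ u : (𝓞 K)ˣ, u ≠ 1 → 0 < realEmb K w₁ (u : 𝓞 K) → T ≤ |Real.log (realEmb K w₁ (u : 𝓞 K))|)
    (hS : ∀ u : ℝ, 0 < u → (∑ n ∈ Finset.Ioc 0 ⌊u⌋₊, (idealCount K n : ℝ)) ≤
      δ * (u * Real.log u + 2 * u) + 1) :
    classNumber K * T * (π * X / (2 * √|discr K|) - 1) ≤
      2 * (δ * X * (2 / 15 * Real.log X - 19 / 450) + Real.log X) := by
  have h1 := classNumber_mul_le K w₁ w₂ (by linarith : 0 < X) hT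
  have h2 := tsum_mul_lintegral_kernel_le (idealCount_zero K) hδ hX hS
  have hlog : Real.log 2 ≤ Real.log X := Real.log_le_log two_pos hX
  have hlog2 := Real.log_two_gt_d9
  set B := δ * X * (2 / 15 * Real.log X - 19 / 450) + Real.log X with hB
  have hB0 : 0 ≤ B := by
    have : 0 ≤ 2 / 15 * Real.log X - 19 / 450 := by linarith
    have : 0 ≤ δ * X * (2 / 15 * Real.log X - 19 / 450) := by positivity
    linarith
  have h3 := h1.trans (add_le_add le_rfl (mul_le_mul_right h2 2))
  have hX0 : 0 ≤ π * X / (2 * √|discr K|) := by positivity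
  rw [← ENNReal.ofReal_natCast, ← ENNReal.ofReal_ofNat 2, ← ENNReal.ofReal_mul (by positivity),
    ← ENNReal.ofReal_mul (by positivity), ← ENNReal.ofReal_mul (by positivity),
    ← ENNReal.ofReal_mul (by positivity), ← ENNReal.ofReal_add (by positivity) (by positivity),
    ENNReal.ofReal_le_ofReal_iff (by positivity)] at h3
  linarith
end PureCubic

namespace PureCubic

open NumberField
open scoped nonZeroDivisors

variable {K : Type*} [Field K] [NumberField K]

lemma idealCount_eq_ncard {n : ℕ} (hn : n ≠ 0) :
    idealCount K n = {J : Ideal (𝓞 K) | Ideal.absNorm J = n}.ncard := by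
  rw [idealCount, ← Nat.card_coe_set_eq]
  refine Nat.card_congr ⟨fun J => ⟨J.1, J.2⟩, fun J => ⟨⟨J.1, mem_nonZeroDivisors_of_ne_zero ?_⟩, J.2⟩,
    fun _ => rfl, fun _ => rfl⟩
  intro h
  have := J.2
  rw [h] at this
  simp at this
  exact hn this.symm

lemma idealCount_one_le : idealCount K 1 ≤ 1 := by
  rw [idealCount_eq_ncard one_ne_zero, Set.ncard_le_one (Ideal.finite_setOfPred_absNorm_eq 1)]
  intro a ha b hb
  rw [Ideal.absNorm_eq_one_iff.1 ha, Ideal.absNorm_eq_one_iff.1 hb]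

lemma idealCount_mul_le {m n : ℕ} (hm : 1 < m) (hn : 1 < n) (h : m.Coprime n) :
    idealCount K (m * n) ≤ idealCount K m * idealCount K n := by
  rw [idealCount_eq_ncard (by positivity), idealCount_eq_ncard (by positivity),
    idealCount_eq_ncard (by positivity), ← Set.ncard_prod]
  have key : ∀ {m n : ℕ} {J : Ideal (𝓞 K)}, 1 < m → 1 < n → m.Coprime n →
      Ideal.absNorm J = m * n →
      J = (J ⊔ Ideal.span {(m : 𝓞 K)}) * (J ⊔ Ideal.span {(n : 𝓞 K)}) ∧
        Ideal.absNorm (J ⊔ Ideal.span {(m : 𝓞 K)}) = m := by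
    intro m n J hm hn h hJ
    have hcop : IsCoprime (m : 𝓞 K) (n : 𝓞 K) := by
      simpa using (Nat.isCoprime_iff_coprime.2 h).map (Int.castRingHom (𝓞 K))
    have htop : Ideal.span {(m : 𝓞 K)} ⊔ Ideal.span {(n : 𝓞 K)} = ⊤ := by
      rw [← Ideal.span_union, Ideal.eq_top_iff_one]
      obtain ⟨a, b, hab⟩ := hcop
      rw [← hab]
      exact Ideal.add_mem _ (Ideal.mul_mem_left _ _ (Ideal.subset_span (by simp)))
        (Ideal.mul_mem_left _ _ (Ideal.subset_span (by simp)))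
    have hle : Ideal.span {(m : 𝓞 K)} * Ideal.span {(n : 𝓞 K)} ≤ J := by
      rw [Ideal.span_singleton_mul_span_singleton, Ideal.span_singleton_le_iff_mem, ← Nat.cast_mul,
        ← hJ]
      exact Ideal.absNorm_mem J
    have hprod : J = (J ⊔ Ideal.span {(m : 𝓞 K)}) * (J ⊔ Ideal.span {(n : 𝓞 K)}) := by
      apply le_antisymm
      · calc J = J * (Ideal.span {(m : 𝓞 K)} ⊔ Ideal.span {(n : 𝓞 K)}) := by
              rw [htop, Ideal.mul_top]
          _ = Ideal.span {(m : 𝓞 K)} * J ⊔ J * Ideal.span {(n : 𝓞 K)} := by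
              rw [Ideal.mul_sup, mul_comm J]
          _ ≤ _ := sup_le (Ideal.mul_mono le_sup_right le_sup_left)
              (Ideal.mul_mono le_sup_left le_sup_right)
      · rw [Ideal.sup_mul, Ideal.mul_sup J]
        refine sup_le (sup_le Ideal.mul_le_left Ideal.mul_le_left) ?_
        rw [Ideal.mul_sup]
        exact sup_le Ideal.mul_le_right hle
    refine ⟨hprod, ?_⟩
    have h1 : Ideal.absNorm (J ⊔ Ideal.span {(m : 𝓞 K)}) ∣ m ^ Module.finrank ℤ (𝓞 K) := by
      rw [← Ideal.absNorm_span_natCast]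
      exact Ideal.absNorm_dvd_absNorm_of_le le_sup_right
    have h2 : Ideal.absNorm (J ⊔ Ideal.span {(n : 𝓞 K)}) ∣ n ^ Module.finrank ℤ (𝓞 K) := by
      rw [← Ideal.absNorm_span_natCast]
      exact Ideal.absNorm_dvd_absNorm_of_le le_sup_right
    have h3 := congrArg Ideal.absNorm hprod
    rw [map_mul, hJ] at h3
    refine Nat.dvd_antisymm ?_ ?_
    · exact (Nat.Coprime.coprime_dvd_left h1 (h.pow_left _)).dvd_of_dvd_mul_right ⟨_, h3⟩
    · exact (Nat.Coprime.coprime_dvd_right h2 (h.pow_right _)).dvd_of_dvd_mul_right ⟨n, h3.symm⟩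
  refine Set.ncard_le_ncard_of_injOn
    (fun J => (J ⊔ Ideal.span {(m : 𝓞 K)}, J ⊔ Ideal.span {(n : 𝓞 K)})) ?_ ?_
    ((Ideal.finite_setOfPred_absNorm_eq m).prod (Ideal.finite_setOfPred_absNorm_eq n))
  · intro J hJ
    exact ⟨(key hm hn h hJ).2, (key hn hm h.symm ((mul_comm n m).symm ▸ hJ)).2⟩
  · intro J hJ I hI hIJ
    rw [(key hm hn h hJ).1, (key hm hn h hI).1, (Prod.mk.inj hIJ).1, (Prod.mk.inj hIJ).2]

/-- The ideals of norm `q ^ k` all of whose prime factors belong to `s`. -/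
def idealsOfNormPow (q : ℕ) (s : Set (Ideal (𝓞 K))) (k : ℕ) : Set (Ideal (𝓞 K)) :=
  {J | Ideal.absNorm J = q ^ k ∧ ∀ P : Ideal (𝓞 K), P.IsPrime → J ≤ P → P ∈ s}

lemma finite_idealsOfNormPow (q : ℕ) (s : Set (Ideal (𝓞 K))) (k : ℕ) :
    (idealsOfNormPow q s k).Finite :=
  (Ideal.finite_setOfPred_absNorm_eq (q ^ k)).subset fun _ h => h.1

lemma ncard_idealsOfNormPow_empty {q : ℕ} (hq : 1 < q) (k : ℕ) :
    (idealsOfNormPow (K := K) q ∅ k).ncard ≤ if k = 0 then 1 else 0 := by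
  have hsub : idealsOfNormPow (K := K) q ∅ k ⊆ {⊤} := by
    intro J hJ
    by_contra hne
    obtain ⟨M, hM, hJM⟩ := Ideal.exists_le_maximal J hne
    exact hJ.2 M hM.isPrime hJM
  split_ifs with hk
  · exact (Set.ncard_le_ncard hsub).trans (by simp)
  · rw [Nat.le_zero, Set.ncard_eq_zero (finite_idealsOfNormPow _ _ _), Set.eq_empty_iff_forall_notMem]
    intro J hJ
    have h1 := hJ.1
    rw [hsub hJ, Ideal.absNorm_top] at h1
    exact (Nat.one_lt_pow hk hq).ne h1

lemma ncard_idealsOfNormPow_insert_le {q : ℕ} (hq : 1 < q) {P : Ideal (𝓞 K)} {f : ℕ}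
    (hf : Ideal.absNorm P = q ^ f) (s : Set (Ideal (𝓞 K))) (k : ℕ) :
    (idealsOfNormPow q (insert P s) k).ncard ≤ (idealsOfNormPow q s k).ncard +
      if f ≤ k then (idealsOfNormPow q (insert P s) (k - f)).ncard else 0 := by
  have hqf : 0 < q ^ f := by positivity
  have hsub : idealsOfNormPow q (insert P s) k ⊆ idealsOfNormPow q s k ∪
      {J | f ≤ k ∧ J ∈ (fun I => P * I) '' idealsOfNormPow q (insert P s) (k - f)} := by
    intro J hJ
    by_cases hP : P ∣ J
    · right
      obtain ⟨I, rfl⟩ := hP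
      have h1 := hJ.1
      rw [map_mul, hf] at h1
      have hfk : f ≤ k := by
        by_contra! h
        have : q ^ f ≤ q ^ k := Nat.le_of_dvd (by positivity) ⟨_, h1.symm⟩
        exact absurd this (not_le.2 (Nat.pow_lt_pow_right hq h))
      refine ⟨hfk, I, ⟨?_, fun Q hQ hI => hJ.2 Q hQ (Ideal.mul_le_right.trans hI)⟩, rfl⟩
      have : q ^ f * Ideal.absNorm I = q ^ f * q ^ (k - f) := by
        rw [h1, ← pow_add, Nat.add_sub_cancel' hfk]
      exact Nat.eq_of_mul_eq_mul_left hqf this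
    · left
      refine ⟨hJ.1, fun Q hQ hJQ => (hJ.2 Q hQ hJQ).resolve_left ?_⟩
      rintro rfl
      exact hP (Ideal.dvd_iff_le.2 hJQ)
  have hfin : {J | f ≤ k ∧ J ∈ (fun I => P * I) '' idealsOfNormPow q (insert P s) (k - f)}.Finite :=
    ((finite_idealsOfNormPow _ _ _).image _).subset fun _ h => h.2
  refine (Set.ncard_le_ncard hsub ((finite_idealsOfNormPow _ _ _).union hfin)).trans
    ((Set.ncard_union_le _ _).trans (Nat.add_le_add_left ?_ _))
  split_ifs with h
  · refine le_trans (Set.ncard_le_ncard (fun _ h => h.2) ((finite_idealsOfNormPow _ _ _).image _))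
      (Set.ncard_image_le (finite_idealsOfNormPow _ _ _))
  · simp [h]

lemma ncard_idealsOfNormPow_le_of_recurrence {q : ℕ} (hq : 1 < q) {P : Ideal (𝓞 K)} {f : ℕ}
    (hf : Ideal.absNorm P = q ^ f) (hf0 : 0 < f) {s : Set (Ideal (𝓞 K))} {g G : ℕ → ℕ}
    (hg : ∀ k, (idealsOfNormPow q s k).ncard ≤ g k)
    (hG : ∀ k, g k + (if f ≤ k then G (k - f) else 0) ≤ G k) (k : ℕ) :
    (idealsOfNormPow q (insert P s) k).ncard ≤ G k := by
  induction k using Nat.strong_induction_on with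
  | _ k ih =>
    refine (ncard_idealsOfNormPow_insert_le hq hf s k).trans (le_trans (add_le_add (hg k) ?_) (hG k))
    split_ifs with h
    · exact ih _ (by omega)
    · exact le_rfl

lemma ncard_idealsOfNormPow_le_choose {q : ℕ} (hq : 1 < q) (c : ℕ) : ∀ s : Finset (Ideal (𝓞 K)),
    (∀ P ∈ s, ∃ f, 0 < f ∧ Ideal.absNorm P = q ^ f) → s.card ≤ c + 1 → ∀ k,
    (idealsOfNormPow q (s : Set (Ideal (𝓞 K))) k).ncard ≤ (k + c).choose c := by
  classical
  have hempty : ∀ c k, (idealsOfNormPow (K := K) q ∅ k).ncard ≤ (k + c).choose c := fun c k =>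
    (ncard_idealsOfNormPow_empty hq k).trans (by
      have := Nat.choose_pos (Nat.le_add_left c k)
      split_ifs <;> omega)
  induction c with
  | zero =>
    intro s hs hc k
    rcases s.eq_empty_or_nonempty with rfl | ⟨P, hP⟩
    · simpa using hempty 0 k
    · obtain ⟨f, hf0, hf⟩ := hs P hP
      have : s = {P} := Finset.card_le_one_iff_subset_singleton.1 hc |>.elim fun Q hQ => by
        have := Finset.mem_singleton.1 (hQ hP)
        subst this
        exact Finset.Subset.antisymm hQ (by simpa using hP)
      rw [this, Finset.coe_singleton, ← LawfulSingleton.insert_empty_eq]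
      simpa using ncard_idealsOfNormPow_le_of_recurrence hq hf hf0
        (ncard_idealsOfNormPow_empty hq) (G := fun _ => 1) (fun k => by split_ifs <;> omega) k
  | succ c ih =>
    intro s hs hc k
    rcases s.eq_empty_or_nonempty with rfl | ⟨P, hP⟩
    · simpa using hempty (c + 1) k
    · obtain ⟨f, hf0, hf⟩ := hs P hP
      have hcard : (s.erase P).card ≤ c + 1 := by rw [Finset.card_erase_of_mem hP]; omega
      rw [← Finset.insert_erase hP, Finset.coe_insert]
      refine ncard_idealsOfNormPow_le_of_recurrence hq hf hf0
        (ih (s.erase P) (fun Q hQ => hs Q (Finset.mem_of_mem_erase hQ)) hcard)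
        (G := fun k => (k + (c + 1)).choose (c + 1)) (fun k => ?_) k
      have hpascal : (k + (c + 1)).choose (c + 1) = (k + c).choose c + (k + c).choose (c + 1) :=
        Nat.choose_succ_succ (k + c) c
      rw [hpascal]
      refine Nat.add_le_add_left ?_ _
      split_ifs with h
      · exact Nat.choose_le_choose _ (by omega)
      · exact Nat.zero_le _
end PureCubic

namespace PureCubic

open NumberField
open scoped nonZeroDivisors

variable {K : Type*} [Field K] [NumberField K]

lemma exists_absNorm_eq_pow {q : ℕ} (hq : q.Prime) {P : Ideal (𝓞 K)} (hP : P.IsPrime)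
    (hqP : (q : 𝓞 K) ∈ P) : ∃ f, 0 < f ∧ Ideal.absNorm P = q ^ f := by
  have h1 : Ideal.absNorm P ∣ q ^ Module.finrank ℤ (𝓞 K) := by
    rw [← Ideal.absNorm_span_natCast]
    exact Ideal.absNorm_dvd_absNorm_of_le ((Ideal.span_singleton_le_iff_mem _).2 hqP)
  obtain ⟨f, -, hf⟩ := (Nat.dvd_prime_pow hq).1 h1
  refine ⟨f, Nat.pos_of_ne_zero ?_, hf⟩
  rintro rfl
  exact hP.ne_top (Ideal.absNorm_eq_one_iff.1 hf)

lemma ne_bot_of_natCast_mem {q : ℕ} (hq : q ≠ 0) {P : Ideal (𝓞 K)} (hqP : (q : 𝓞 K) ∈ P) :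
    P ≠ ⊥ := by
  rintro rfl
  exact hq (by exact_mod_cast (Ideal.mem_bot.1 hqP))

lemma prod_dvd_span_natCast {q : ℕ} (hq : q ≠ 0) (s : Finset (Ideal (𝓞 K)))
    (hs : ∀ P ∈ s, P.IsPrime ∧ (q : 𝓞 K) ∈ P) : ∏ P ∈ s, P ∣ Ideal.span {(q : 𝓞 K)} :=
  Finset.prod_primes_dvd _
    (fun P hP => Ideal.prime_of_isPrime (ne_bot_of_natCast_mem hq (hs P hP).2) (hs P hP).1)
    fun P hP => Ideal.dvd_span_singleton.2 (hs P hP).2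

lemma prod_absNorm_dvd {q : ℕ} (hq : q ≠ 0) (hd : Module.finrank ℚ K = 3)
    (s : Finset (Ideal (𝓞 K))) (hs : ∀ P ∈ s, P.IsPrime ∧ (q : 𝓞 K) ∈ P) :
    ∏ P ∈ s, Ideal.absNorm P ∣ q ^ 3 := by
  have h := map_dvd Ideal.absNorm (prod_dvd_span_natCast hq s hs)
  rwa [map_prod, Ideal.absNorm_span_natCast, RingOfIntegers.rank, hd] at h

lemma prod_absNorm_le {q : ℕ} (hq : q ≠ 0) (hd : Module.finrank ℚ K = 3)
    (s : Finset (Ideal (𝓞 K))) (hs : ∀ P ∈ s, P.IsPrime ∧ (q : 𝓞 K) ∈ P) :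
    ∏ P ∈ s, Ideal.absNorm P ≤ q ^ 3 :=
  Nat.le_of_dvd (by positivity) (prod_absNorm_dvd hq hd s hs)

lemma card_mul_le_three {q : ℕ} (hq : q.Prime) (hd : Module.finrank ℚ K = 3) {f : ℕ}
    (s : Finset (Ideal (𝓞 K))) (hs : ∀ P ∈ s, P.IsPrime ∧ (q : 𝓞 K) ∈ P)
    (hf : ∀ P ∈ s, q ^ f ≤ Ideal.absNorm P) : f * s.card ≤ 3 := by
  have h := (Finset.prod_le_prod' hf).trans (prod_absNorm_le hq.ne_zero hd s hs)
  rw [Finset.prod_const, ← pow_mul] at h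
  exact (Nat.pow_le_pow_iff_right hq.one_lt).1 h

lemma finite_primes_over {q : ℕ} (hq : q ≠ 0) :
    {P : Ideal (𝓞 K) | P.IsPrime ∧ (q : 𝓞 K) ∈ P}.Finite := by
  refine (Ideal.finite_setOfPred_absNorm_le (q ^ Module.finrank ℤ (𝓞 K))).subset fun P hP => ?_
  refine Nat.le_of_dvd (by positivity) ?_
  rw [← Ideal.absNorm_span_natCast]
  exact Ideal.absNorm_dvd_absNorm_of_le ((Ideal.span_singleton_le_iff_mem _).2 hP.2)

lemma idealCount_prime_pow_le {q : ℕ} (hq : q.Prime) (k : ℕ) {s : Set (Ideal (𝓞 K))}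
    (hs : ∀ P : Ideal (𝓞 K), P.IsPrime → (q : 𝓞 K) ∈ P → P ∈ s) :
    idealCount K (q ^ k) ≤ (idealsOfNormPow q s k).ncard := by
  rw [idealCount_eq_ncard (pow_ne_zero k hq.ne_zero)]
  refine Set.ncard_le_ncard (fun J hJ => ⟨hJ, fun P hP hJP => hs P hP ?_⟩)
    (finite_idealsOfNormPow q s k)
  refine hP.mem_of_pow_mem k (hJP ?_)
  have h := Ideal.absNorm_mem J
  rw [show Ideal.absNorm J = q ^ k from hJ] at h
  exact_mod_cast h

lemma idealCount_prime_pow_le_choose {q : ℕ} (hq : q.Prime) (k c : ℕ)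
    (hc : ∀ s : Finset (Ideal (𝓞 K)), (∀ P ∈ s, P.IsPrime ∧ (q : 𝓞 K) ∈ P) → s.card ≤ c + 1) :
    idealCount K (q ^ k) ≤ (k + c).choose c := by
  have hfin := finite_primes_over (K := K) hq.ne_zero
  have hmem : ∀ P ∈ hfin.toFinset, P.IsPrime ∧ (q : 𝓞 K) ∈ P := fun P hP => by simpa using hP
  refine (idealCount_prime_pow_le hq k (s := (hfin.toFinset : Set (Ideal (𝓞 K)))) ?_).trans
    (ncard_idealsOfNormPow_le_choose hq.one_lt c hfin.toFinset (fun P hP => ?_)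
      (hc _ hmem) k)
  · intro P hP hqP
    simpa using ⟨hP, hqP⟩
  · exact exists_absNorm_eq_pow hq (hmem P hP).1 (hmem P hP).2

/-- At most one prime lies over `q`. -/
lemma idealCount_prime_pow_le_one {q : ℕ} (hq : q.Prime) (k : ℕ)
    (h : ∀ P Q : Ideal (𝓞 K), P.IsPrime → Q.IsPrime → (q : 𝓞 K) ∈ P → (q : 𝓞 K) ∈ Q → P = Q) :
    idealCount K (q ^ k) ≤ 1 := by
  refine (idealCount_prime_pow_le_choose hq k 0 fun s hs => ?_).trans (by simp)
  exact Finset.card_le_one.2 fun P hP Q hQ => h P Q (hs P hP).1 (hs Q hQ).1 (hs P hP).2 (hs Q hQ).2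

lemma idealCount_prime_pow_le_succ {q : ℕ} (hq : q.Prime) (k : ℕ)
    (h : ∀ s : Finset (Ideal (𝓞 K)), (∀ P ∈ s, P.IsPrime ∧ (q : 𝓞 K) ∈ P) → s.card ≤ 2) :
    idealCount K (q ^ k) ≤ k + 1 :=
  (idealCount_prime_pow_le_choose hq k 1 h).trans (by simp)

lemma idealCount_prime_pow_le_choose_two {q : ℕ} (hq : q.Prime) (hd : Module.finrank ℚ K = 3)
    (k : ℕ) : idealCount K (q ^ k) ≤ (k + 1) * (k + 2) / 2 := by
  refine (idealCount_prime_pow_le_choose hq k 2 fun s hs => ?_).trans ?_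
  · have := card_mul_le_three hq hd (f := 1) s hs fun P hP => by
      obtain ⟨f, hf0, hf⟩ := exists_absNorm_eq_pow hq (hs P hP).1 (hs P hP).2
      exact hf ▸ Nat.pow_le_pow_right hq.pos hf0
    omega
  · rw [Nat.choose_two_right, mul_comm]
    rfl

/-- At most one prime over `q` has norm `q`. -/
lemma idealCount_prime_pow_le_half {q : ℕ} (hq : q.Prime) (hd : Module.finrank ℚ K = 3) (k : ℕ)
    (h : ∀ P Q : Ideal (𝓞 K), Ideal.absNorm P = q → Ideal.absNorm Q = q → P = Q) :
    idealCount K (q ^ k) ≤ k / 2 + 1 := by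
  classical
  have hfin := finite_primes_over (K := K) hq.ne_zero
  have hmem : ∀ P ∈ hfin.toFinset, P.IsPrime ∧ (q : 𝓞 K) ∈ P := fun P hP => by simpa using hP
  set A := hfin.toFinset.filter fun P => Ideal.absNorm P = q
  set B := hfin.toFinset.filter fun P => ¬ Ideal.absNorm P = q
  have hAmem : ∀ P ∈ A, P.IsPrime ∧ (q : 𝓞 K) ∈ P := fun P hP => hmem P (Finset.mem_filter.1 hP).1
  have hBmem : ∀ P ∈ B, P.IsPrime ∧ (q : 𝓞 K) ∈ P := fun P hP => hmem P (Finset.mem_filter.1 hP).1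
  have hAcard : A.card ≤ 1 := Finset.card_le_one.2 fun P hP Q hQ =>
    h P Q (Finset.mem_filter.1 hP).2 (Finset.mem_filter.1 hQ).2
  have hA : ∀ k, (idealsOfNormPow q (A : Set (Ideal (𝓞 K))) k).ncard ≤ 1 := fun k =>
    (ncard_idealsOfNormPow_le_choose hq.one_lt 0 A
      (fun P hP => exists_absNorm_eq_pow hq (hAmem P hP).1 (hAmem P hP).2) hAcard k).trans (by simp)
  have hBf : ∀ P ∈ B, ∃ f, 2 ≤ f ∧ Ideal.absNorm P = q ^ f := fun P hP => by
    obtain ⟨f, hf0, hf⟩ := exists_absNorm_eq_pow hq (hBmem P hP).1 (hBmem P hP).2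
    refine ⟨f, ?_, hf⟩
    have : f ≠ 1 := by
      rintro rfl
      exact (Finset.mem_filter.1 hP).2 (by simpa using hf)
    omega
  have hBcard : B.card ≤ 1 := by
    have := card_mul_le_three hq hd (f := 2) B hBmem fun P hP => by
      obtain ⟨f, hf0, hf⟩ := hBf P hP
      exact hf ▸ Nat.pow_le_pow_right hq.pos hf0
    omega
  have hAB : ∀ P : Ideal (𝓞 K), P.IsPrime → (q : 𝓞 K) ∈ P → P ∈ A ∨ P ∈ B := by
    intro P hP hqP
    by_cases hn : Ideal.absNorm P = q
    · exact Or.inl (Finset.mem_filter.2 ⟨by simpa using ⟨hP, hqP⟩, hn⟩)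
    · exact Or.inr (Finset.mem_filter.2 ⟨by simpa using ⟨hP, hqP⟩, hn⟩)
  rcases B.eq_empty_or_nonempty with hB | ⟨Q, hQ⟩
  · refine (idealCount_prime_pow_le hq k (s := (A : Set (Ideal (𝓞 K)))) fun P hP hqP => ?_).trans
      ((hA k).trans (by omega))
    simpa [hB] using hAB P hP hqP
  · obtain ⟨f, hf2, hf⟩ := hBf Q hQ
    refine (idealCount_prime_pow_le hq k
      (s := insert Q (A : Set (Ideal (𝓞 K)))) fun P hP hqP => ?_).trans
      (ncard_idealsOfNormPow_le_of_recurrence hq.one_lt hf (by omega) hA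
        (G := fun k => k / 2 + 1) (fun k => by split_ifs <;> omega) k)
    rcases hAB P hP hqP with h1 | h1
    · exact Or.inr h1
    · exact Or.inl (Finset.card_le_one.1 hBcard _ h1 _ hQ)
end PureCubic

namespace PureCubic

open NumberField Module Polynomial

/-- `θ` is a cube root of the squarefree number `m > 1`, and it generates `K`. -/
structure IsPureCubic {K : Type*} [Field K] [NumberField K] (θ : K) (m : ℕ) : Prop where
  pow_three : θ ^ 3 = (m : K)
  adjoin_eq_top : Algebra.adjoin ℚ {θ} = ⊤
  squarefree : Squarefree m
  one_lt : 1 < m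

namespace IsPureCubic

variable {K : Type*} [Field K] [NumberField K] {θ : K} {m : ℕ}

lemma not_cube (h : IsPureCubic θ m) (b : ℚ) : b ^ 3 ≠ m := by
  intro hb
  obtain ⟨q, hq, hqm⟩ := Nat.exists_prime_and_dvd h.one_lt.ne'
  have := Fact.mk hq
  have h1 : padicValNat q m = 1 := by
    have := (Nat.squarefree_iff_factorization_le_one (by linarith [h.one_lt])).1 h.squarefree q
    have h2 : 0 < padicValNat q m := one_le_padicValNat_of_dvd (by linarith [h.one_lt]) hqm
    rw [Nat.factorization_def _ hq] at this
    omega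
  have hb0 : b ≠ 0 := by
    rintro rfl
    exact (Nat.cast_pos.2 (zero_lt_one.trans h.one_lt)).ne (by simpa using hb)
  have h3 := congrArg (padicValRat q) hb
  rw [padicValRat.pow, padicValRat.of_nat, h1] at h3
  omega

lemma minpoly_eq (h : IsPureCubic θ m) : minpoly ℚ θ = X ^ 3 - C (m : ℚ) := by
  refine (minpoly.eq_of_irreducible_of_monic
    (X_pow_sub_C_irreducible_of_prime Nat.prime_three h.not_cube) ?_
    (monic_X_pow_sub_C _ three_ne_zero)).symm
  simp [h.pow_three]

lemma finrank_eq (h : IsPureCubic θ m) : finrank ℚ K = 3 := by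
  rw [(PowerBasis.ofAdjoinEqTop (Algebra.IsIntegral.isIntegral θ) h.adjoin_eq_top).finrank,
    PowerBasis.ofAdjoinEqTop_dim, h.minpoly_eq, natDegree_X_pow_sub_C]

/-- The basis `1, θ, θ ^ 2`. -/
noncomputable def basis (h : IsPureCubic θ m) : Basis (Fin 3) ℚ K :=
  (PowerBasis.ofAdjoinEqTop (Algebra.IsIntegral.isIntegral θ) h.adjoin_eq_top).basis.reindex
    (finCongr (by rw [PowerBasis.ofAdjoinEqTop_dim, h.minpoly_eq, natDegree_X_pow_sub_C]))

lemma basis_apply (h : IsPureCubic θ m) (i : Fin 3) : h.basis i = θ ^ (i : ℕ) := by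
  rw [basis, Basis.reindex_apply, PowerBasis.basis_eq_pow, PowerBasis.ofAdjoinEqTop_gen]
  rfl

lemma basis_equivFun_symm (h : IsPureCubic θ m) (v : Fin 3 → ℚ) :
    h.basis.equivFun.symm v = v 0 + v 1 * θ + v 2 * θ ^ 2 := by
  rw [Basis.equivFun_symm_apply, Fin.sum_univ_three]
  simp [basis_apply, Algebra.smul_def]

lemma exists_eq (h : IsPureCubic θ m) (x : K) :
    ∃ a b c : ℚ, x = a + b * θ + c * θ ^ 2 :=
  ⟨_, _, _, by rw [← h.basis_equivFun_symm, LinearEquiv.symm_apply_apply]⟩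

lemma leftMulMatrix_eq (h : IsPureCubic θ m) (a b c : ℚ) :
    Algebra.leftMulMatrix h.basis (a + b * θ + c * θ ^ 2 : K) =
      !![a, m * c, m * b; b, a, m * c; c, b, a] := by
  have key : ∀ j, h.basis.equivFun ((a + b * θ + c * θ ^ 2 : K) * h.basis j) =
      !![a, m * c, m * b; b, a, m * c; c, b, a].col j := by
    intro j
    rw [← LinearEquiv.eq_symm_apply, h.basis_equivFun_symm, h.basis_apply]
    have h3 := h.pow_three
    fin_cases j
    · simp
    · simp
      linear_combination (c : K) * h3
    · simp
      linear_combination (b + c * θ : K) * h3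
  ext i j
  rw [Algebra.leftMulMatrix_eq_repr_mul, ← Basis.equivFun_apply, key]
  rfl

lemma trace_eq (h : IsPureCubic θ m) (a b c : ℚ) :
    Algebra.trace ℚ K (a + b * θ + c * θ ^ 2) = 3 * a := by
  rw [Algebra.trace_eq_matrix_trace h.basis, h.leftMulMatrix_eq, Matrix.trace_fin_three]
  simp
  ring

lemma norm_eq (h : IsPureCubic θ m) (a b c : ℚ) :
    Algebra.norm ℚ (a + b * θ + c * θ ^ 2) =
      a ^ 3 + m * b ^ 3 + m ^ 2 * c ^ 3 - 3 * m * a * b * c := by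
  rw [Algebra.norm_eq_matrix_det h.basis, h.leftMulMatrix_eq, Matrix.det_fin_three]
  simp
  ring

lemma isIntegral (h : IsPureCubic θ m) : IsIntegral ℤ θ :=
  ⟨X ^ 3 - C (m : ℤ), monic_X_pow_sub_C _ three_ne_zero, by simp [h.pow_three]⟩

end IsPureCubic

end PureCubic

namespace PureCubic

open NumberField Module NumberField.InfinitePlace NumberField.ComplexEmbedding
open scoped ComplexConjugate

namespace IsPureCubic

variable {K : Type*} [Field K] [NumberField K] {θ : K} {m : ℕ}

lemma ringHom_ext (h : IsPureCubic θ m) {L : Type*} [Field L] [CharZero L] {φ ψ : K →+* L}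
    (he : φ θ = ψ θ) : φ = ψ := by
  ext x
  obtain ⟨a, b, c, rfl⟩ := h.exists_eq x
  simp [he]

lemma map_pow_three (h : IsPureCubic θ m) {L : Type*} [Field L] (φ : K →+* L) :
    φ θ ^ 3 = m := by
  rw [← map_pow, h.pow_three, map_natCast]

lemma isReal_iff (h : IsPureCubic θ m) (φ : K →+* ℂ) :
    ComplexEmbedding.IsReal φ ↔ conj (φ θ) = φ θ := by
  rw [ComplexEmbedding.isReal_iff]
  refine ⟨fun hc => ?_, fun hc => h.ringHom_ext (by simpa using hc)⟩
  rw [← ComplexEmbedding.conjugate_coe_eq, hc]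

lemma subsingleton_isReal (h : IsPureCubic θ m) :
    Subsingleton {w : InfinitePlace K // IsReal w} := by
  refine ⟨fun w₁ w₂ => Subtype.ext ?_⟩
  rw [← mk_embedding w₁.1, ← mk_embedding w₂.1]
  refine congrArg _ (h.ringHom_ext ?_)
  have h1 := (h.isReal_iff _).1 (InfinitePlace.isReal_iff.1 w₁.2)
  have h2 := (h.isReal_iff _).1 (InfinitePlace.isReal_iff.1 w₂.2)
  obtain ⟨x, hx⟩ := Complex.conj_eq_iff_real.1 h1
  obtain ⟨y, hy⟩ := Complex.conj_eq_iff_real.1 h2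
  rw [hx, hy]
  have h3 : x ^ 3 = y ^ 3 := by
    have := (h.map_pow_three w₁.1.embedding).trans (h.map_pow_three w₂.1.embedding).symm
    rw [hx, hy] at this
    exact_mod_cast this
  rw [(Odd.strictMono_pow (by decide : Odd 3)).injective h3]

lemma eq_or_eq_of_pow_three_eq {z w : ℂ} (hzw : z ^ 3 = w ^ 3) (hz : conj z ≠ z)
    (hw : conj w ≠ w) (hc : conj (z ^ 3) = z ^ 3) : z = w ∨ conj z = w := by
  by_contra! hne
  have h1 : w ^ 2 + w * z + z ^ 2 = 0 :=
    (mul_eq_zero.1 (by linear_combination hzw : (z - w) * (w ^ 2 + w * z + z ^ 2) = 0)).resolve_left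
      (sub_ne_zero.2 hne.1)
  rw [map_pow] at hc
  have h2 : w ^ 2 + w * conj z + conj z ^ 2 = 0 :=
    (mul_eq_zero.1 (by linear_combination hzw + hc :
      (conj z - w) * (w ^ 2 + w * conj z + conj z ^ 2) = 0)).resolve_left (sub_ne_zero.2 hne.2)
  have h3 : w + z + conj z = 0 :=
    (mul_eq_zero.1 (by linear_combination h1 - h2 :
      (z - conj z) * (w + z + conj z) = 0)).resolve_left (sub_ne_zero.2 (Ne.symm hz))
  apply hw
  have h4 := congrArg conj h3
  simp only [map_add, Complex.conj_conj, map_zero] at h4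
  linear_combination h4 - h3

lemma subsingleton_isComplex (h : IsPureCubic θ m) :
    Subsingleton {w : InfinitePlace K // IsComplex w} := by
  refine ⟨fun w₁ w₂ => Subtype.ext ?_⟩
  have h1 : conj (w₁.1.embedding θ) ≠ w₁.1.embedding θ := fun hc =>
    InfinitePlace.isComplex_iff.1 w₁.2 ((h.isReal_iff _).2 hc)
  have h2 : conj (w₂.1.embedding θ) ≠ w₂.1.embedding θ := fun hc =>
    InfinitePlace.isComplex_iff.1 w₂.2 ((h.isReal_iff _).2 hc)
  rw [← mk_embedding w₁.1, ← mk_embedding w₂.1, mk_eq_iff]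
  refine (eq_or_eq_of_pow_three_eq ?_ h1 h2 ?_).imp (fun he => h.ringHom_ext he)
    fun he => h.ringHom_ext (by simpa using he)
  · rw [h.map_pow_three, h.map_pow_three]
  · rw [h.map_pow_three]
    simp

lemma exists_places (h : IsPureCubic θ m) :
    Nonempty {w : InfinitePlace K // IsReal w} ∧ Nonempty {w : InfinitePlace K // IsComplex w} := by
  classical
  have := h.subsingleton_isReal
  have := h.subsingleton_isComplex
  have h3 := card_add_two_mul_card_eq_rank K
  rw [h.finrank_eq] at h3
  have h1 : nrRealPlaces K ≤ 1 := Fintype.card_le_one_iff_subsingleton.2 ‹_›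
  have h2 : nrComplexPlaces K ≤ 1 := Fintype.card_le_one_iff_subsingleton.2 ‹_›
  exact ⟨Fintype.card_pos_iff.1 (show 0 < nrRealPlaces K by omega),
    Fintype.card_pos_iff.1 (show 0 < nrComplexPlaces K by omega)⟩

lemma nrComplexPlaces_eq (h : IsPureCubic θ m) : nrComplexPlaces K = 1 := by
  classical
  have := h.subsingleton_isComplex
  have := Fintype.card_le_one_iff_subsingleton.2 h.subsingleton_isComplex
  have := Fintype.card_pos_iff.2 h.exists_places.2
  exact le_antisymm ‹_› ‹_›

end IsPureCubic

end PureCubic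

namespace PureCubic

open NumberField Module NumberField.InfinitePlace NumberField.ComplexEmbedding
open scoped ComplexConjugate

namespace IsPureCubic

variable {K : Type*} [Field K] [NumberField K] {θ : K} {m : ℕ}

lemma realEmb_pos (h : IsPureCubic θ m) (w₁ : {w : InfinitePlace K // IsReal w}) :
    0 < realEmb K w₁ θ := by
  have h1 := h.map_pow_three (realEmb K w₁)
  have h2 : (0 : ℝ) < m := Nat.cast_pos.2 (zero_lt_one.trans h.one_lt)
  exact (Odd.pow_pos_iff (by decide : Odd 3)).1 (h1 ▸ h2)

lemma complexEmb_quadratic (h : IsPureCubic θ m) (w₁ : {w : InfinitePlace K // IsReal w})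
    (w₂ : {w : InfinitePlace K // IsComplex w}) :
    complexEmb K w₂ θ ^ 2 + realEmb K w₁ θ * complexEmb K w₂ θ + (realEmb K w₁ θ : ℂ) ^ 2 = 0 := by
  have h1 : (realEmb K w₁ θ : ℂ) ^ 3 = m := by exact_mod_cast h.map_pow_three (realEmb K w₁)
  have h2 := h.map_pow_three (complexEmb K w₂)
  refine (mul_eq_zero.1 (by linear_combination h2 - h1 :
    (complexEmb K w₂ θ - realEmb K w₁ θ) * (complexEmb K w₂ θ ^ 2 +
      realEmb K w₁ θ * complexEmb K w₂ θ + (realEmb K w₁ θ : ℂ) ^ 2) = 0)).resolve_left ?_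
  intro he
  refine InfinitePlace.isComplex_iff.1 w₂.2 ((h.isReal_iff _).2 ?_)
  have h3 : w₂.1.embedding θ = realEmb K w₁ θ := sub_eq_zero.1 he
  rw [h3, Complex.conj_ofReal]

lemma norm_complexEmb (h : IsPureCubic θ m) (w₁ : {w : InfinitePlace K // IsReal w})
    (w₂ : {w : InfinitePlace K // IsComplex w}) : ‖complexEmb K w₂ θ‖ = realEmb K w₁ θ := by
  have h1 := h.map_pow_three (realEmb K w₁)
  have h2 := congrArg norm (h.map_pow_three (complexEmb K w₂))
  rw [norm_pow, Complex.norm_natCast, ← h1] at h2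
  exact (Odd.strictMono_pow (by decide : Odd 3)).injective h2

/-- The coefficient of `θ ^ 2` in terms of the conjugates. -/
lemma abs_coeff_sub_le (h : IsPureCubic θ m) (w₁ : {w : InfinitePlace K // IsReal w})
    (w₂ : {w : InfinitePlace K // IsComplex w}) (a b c : ℚ) :
    |3 * c * realEmb K w₁ θ ^ 2 - realEmb K w₁ (a + b * θ + c * θ ^ 2)| ≤
      2 * ‖complexEmb K w₂ (a + b * θ + c * θ ^ 2)‖ := by
  have hpos := h.realEmb_pos w₁
  have hq := h.complexEmb_quadratic w₁ w₂
  have hn := h.norm_complexEmb w₁ w₂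
  set α := realEmb K w₁ θ
  set β := complexEmb K w₂ θ
  have hx : realEmb K w₁ (a + b * θ + c * θ ^ 2) = a + b * α + c * α ^ 2 := by simp [α]
  have hx' : complexEmb K w₂ (a + b * θ + c * θ ^ 2) = a + b * β + c * β ^ 2 := by simp [β]
  rw [hx]
  set y := complexEmb K w₂ (a + b * θ + c * θ ^ 2)
  have hqc := congrArg conj hq
  simp only [map_add, map_mul, map_pow, map_zero, Complex.conj_ofReal] at hqc
  have hyc : conj y = a + b * conj β + c * conj β ^ 2 := by
    rw [hx']
    simp
  have hsum : β + conj β = -α := by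
    by_cases hβ : β = conj β
    · exfalso
      obtain ⟨r, hr⟩ := Complex.conj_eq_iff_real.1 hβ.symm
      rw [hr] at hq
      have : r ^ 2 + α * r + α ^ 2 = 0 := by exact_mod_cast hq
      nlinarith [sq_nonneg (r + α / 2)]
    · have := (mul_eq_zero.1 (by linear_combination hq - hqc :
        (β - conj β) * (β + conj β + α) = 0)).resolve_left (sub_ne_zero.2 hβ)
      linear_combination this
  have key : ((α * (3 * c * α ^ 2 - (a + b * α + c * α ^ 2)) : ℝ) : ℂ) = β * y + conj (β * y) := by
    rw [map_mul, hyc, hx']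
    push_cast
    linear_combination (-(a : ℂ) + b * α) * hsum - (b + c * (β - α)) * hq -
      (b + c * (conj β - α)) * hqc
  have h1 : α * |3 * c * α ^ 2 - (a + b * α + c * α ^ 2)| ≤ α * (2 * ‖y‖) := by
    calc α * |3 * c * α ^ 2 - (a + b * α + c * α ^ 2)| = 
        ‖((α * (3 * c * α ^ 2 - (a + b * α + c * α ^ 2)) : ℝ) : ℂ)‖ := by
          rw [Complex.norm_real, Real.norm_eq_abs, abs_mul, abs_of_pos hpos]
      _ ≤ ‖β * y‖ + ‖conj (β * y)‖ := by
          rw [key]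
          exact norm_add_le _ _
      _ = α * (2 * ‖y‖) := by
          rw [Complex.norm_conj, norm_mul, hn]
          ring
  exact le_of_mul_le_mul_left h1 hpos

end IsPureCubic

end PureCubic

namespace PureCubic

open NumberField Module

lemma exists_int_trace_eq {K : Type*} [Field K] [NumberField K] {x : K} (hx : IsIntegral ℤ x) :
    ∃ n : ℤ, Algebra.trace ℚ K x = n := by
  obtain ⟨n, hn⟩ := IsIntegrallyClosed.isIntegral_iff.1 (Algebra.isIntegral_trace (L := ℚ) hx)
  exact ⟨n, by simpa using hn.symm⟩

lemma exists_int_norm_eq {K : Type*} [Field K] [NumberField K] {x : K} (hx : IsIntegral ℤ x) :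
    ∃ n : ℤ, Algebra.norm ℚ x = n := by
  obtain ⟨n, hn⟩ := IsIntegrallyClosed.isIntegral_iff.1 (Algebra.isIntegral_norm ℚ hx)
  exact ⟨n, by simpa using hn.symm⟩

namespace IsPureCubic

variable {K : Type*} [Field K] [NumberField K] {θ : K} {m : ℕ}

lemma exists_three_mul_coeff_eq (h : IsPureCubic θ m) {a b c : ℚ}
    (hz : IsIntegral ℤ (a + b * θ + c * θ ^ 2 : K)) :
    ∃ A B C : ℤ, 3 * a = A ∧ 3 * b = B ∧ 3 * c = C := by
  have hm0 : (m : ℚ) ≠ 0 := by exact_mod_cast (zero_lt_one.trans h.one_lt).ne'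
  have hsq : Squarefree (m : ℤ) := Int.squarefree_natCast.2 h.squarefree
  have h3 := h.pow_three
  obtain ⟨A, hA⟩ := exists_int_trace_eq hz
  obtain ⟨C, hC⟩ := exists_int_trace_eq (hz.mul h.isIntegral)
  obtain ⟨B, hB⟩ := exists_int_trace_eq (hz.mul (h.isIntegral.pow 2))
  obtain ⟨N, hN⟩ := exists_int_norm_eq hz
  have hC' : (a + b * θ + c * θ ^ 2) * θ = ((m * c : ℚ) : K) + (a : ℚ) * θ + (b : ℚ) * θ ^ 2 := by
    push_cast
    linear_combination c * h3
  have hB' : (a + b * θ + c * θ ^ 2) * θ ^ 2 =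
      ((m * b : ℚ) : K) + ((m * c : ℚ) : K) * θ + (a : ℚ) * θ ^ 2 := by
    push_cast
    linear_combination (b + c * θ) * h3
  rw [h.trace_eq] at hA
  rw [hC', h.trace_eq] at hC
  rw [hB', h.trace_eq] at hB
  rw [h.norm_eq] at hN
  have hkey : (27 * N * m ^ 2 : ℤ) = m ^ 2 * A ^ 3 + B ^ 3 + m * C ^ 3 - 3 * m * A * B * C := by
    have : (27 * N * m ^ 2 : ℚ) = m ^ 2 * A ^ 3 + B ^ 3 + m * C ^ 3 - 3 * m * A * B * C := by
      rw [← hN, ← hA, ← hB, ← hC]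
      ring
    exact_mod_cast this
  obtain ⟨B₁, rfl⟩ : (m : ℤ) ∣ B := by
    refine (hsq.dvd_pow_iff_dvd three_ne_zero).1
      ⟨27 * N * m - m * A ^ 3 - C ^ 3 + 3 * A * B * C, ?_⟩
    linear_combination -hkey
  have hm0' : (m : ℤ) ≠ 0 := by exact_mod_cast hm0
  obtain ⟨C₁, rfl⟩ : (m : ℤ) ∣ C := by
    refine (hsq.dvd_pow_iff_dvd three_ne_zero).1
      ⟨27 * N - A ^ 3 - m * B₁ ^ 3 + 3 * A * B₁ * C, ?_⟩
    refine mul_left_cancel₀ hm0' ?_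
    linear_combination -hkey
  refine ⟨A, B₁, C₁, hA, mul_left_cancel₀ hm0 ?_, mul_left_cancel₀ hm0 ?_⟩
  · push_cast at hB
    linear_combination hB
  · push_cast at hC
    linear_combination hC

lemma exists_coeff_eq (h : IsPureCubic θ m) (h3m : ¬ 3 ∣ m) (h9 : ¬ (9 : ℤ) ∣ m ^ 2 - 1) {a b c : ℚ}
    (hz : IsIntegral ℤ (a + b * θ + c * θ ^ 2 : K)) :
    ∃ A B C : ℤ, a = A ∧ b = B ∧ c = C := by
  have h3 := h.pow_three
  have hp3 : Prime (3 : ℤ) := Int.prime_three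
  obtain ⟨A, B, C, hA, hB, hC⟩ := h.exists_three_mul_coeff_eq hz
  obtain ⟨N, hN⟩ := exists_int_norm_eq hz
  obtain ⟨S, hS⟩ := exists_int_trace_eq (hz.pow 2)
  have hS' : (a + b * θ + c * θ ^ 2 : K) ^ 2 = ((a ^ 2 + 2 * m * b * c : ℚ) : K) +
      ((2 * a * b + m * c ^ 2 : ℚ) : K) * θ + ((b ^ 2 + 2 * a * c : ℚ) : K) * θ ^ 2 := by
    push_cast
    linear_combination (2 * b * c + c ^ 2 * θ) * h3
  rw [hS', h.trace_eq] at hS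
  rw [h.norm_eq] at hN
  have hSz : 3 * S = A ^ 2 + 2 * m * B * C := by
    have : (3 * S : ℚ) = A ^ 2 + 2 * m * B * C := by
      rw [← hS, ← hA, ← hB, ← hC]
      ring
    exact_mod_cast this
  have hNz : 27 * N = A ^ 3 + m * B ^ 3 + m ^ 2 * C ^ 3 - 3 * m * A * B * C := by
    have : (27 * N : ℚ) = A ^ 3 + m * B ^ 3 + m ^ 2 * C ^ 3 - 3 * m * A * B * C := by
      rw [← hN, ← hA, ← hB, ← hC]
      ring
    exact_mod_cast this
  have hm2 : (3 : ℤ) ∣ m ^ 2 - 1 := by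
    have h1 : (m : ℤ) % 3 = 1 ∨ (m : ℤ) % 3 = 2 := by omega
    rw [Int.dvd_iff_emod_eq_zero]
    rcases h1 with h1 | h1 <;> simp [Int.sub_emod, pow_two, Int.mul_emod, h1]
  have hcube : ∀ x : ℤ, (3 : ℤ) ∣ x ^ 3 - x := fun x => by
    have h1 : x % 3 = 0 ∨ x % 3 = 1 ∨ x % 3 = 2 := by omega
    rw [Int.dvd_iff_emod_eq_zero]
    rcases h1 with h1 | h1 | h1 <;> simp [Int.sub_emod, pow_succ, Int.mul_emod, h1]
  obtain ⟨e, he⟩ := hm2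
  obtain ⟨u, hu⟩ := hcube A
  obtain ⟨v, hv⟩ := hcube B
  obtain ⟨w, hw⟩ := hcube C
  have hsum : (3 : ℤ) ∣ A + m * B + C :=
    ⟨9 * N - u - m * v - m ^ 2 * w - e * C + m * A * B * C, by
      linear_combination -hNz - hu - m * hv - m ^ 2 * hw - C * he⟩
  obtain ⟨f, hf⟩ := hsum
  have hBC : (3 : ℤ) ∣ B - m * C := by
    refine hp3.dvd_of_dvd_pow (n := 2)
      ⟨S - 2 * m * B * C - 3 * f ^ 2 + 2 * f * (m * B + C) - e * B ^ 2 + e * C ^ 2, ?_⟩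
    have : A = 3 * f - m * B - C := by linear_combination hf
    rw [this] at hSz
    linear_combination -hSz + (C ^ 2 - B ^ 2) * he
  obtain ⟨t, ht⟩ := hBC
  have hAC : (3 : ℤ) ∣ A - C := ⟨f - m * t - e * C - C, by linear_combination hf - m * ht - C * he⟩
  obtain ⟨s, hs⟩ := hAC
  have hC3 : (3 : ℤ) ∣ C := by
    by_contra hC3
    have hz' : IsIntegral ℤ (((C / 3 : ℚ) : K) + ((m * C / 3 : ℚ) : K) * θ +
        ((C / 3 : ℚ) : K) * θ ^ 2) := by
      have hst : IsIntegral ℤ ((s : K) + t * θ) :=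
        IsIntegral.add (isIntegral_algebraMap (R := ℤ) (x := s))
          ((isIntegral_algebraMap (R := ℤ) (x := t)).mul h.isIntegral)
      convert! hz.sub hst using 1
      have ha : a = C / 3 + s := by
        have : (A : ℚ) - C = 3 * s := by exact_mod_cast hs
        linarith
      have hb : b = m * C / 3 + t := by
        have : (B : ℚ) - m * C = 3 * t := by exact_mod_cast ht
        linarith
      have hc : c = C / 3 := by linarith
      rw [ha, hb, hc]
      push_cast
      ring
    obtain ⟨N', hN'⟩ := exists_int_norm_eq hz'
    rw [h.norm_eq] at hN'
    have hN'z : 27 * N' = C ^ 3 * ((m : ℤ) ^ 2 - 1) ^ 2 := by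
      have : (27 * N' : ℚ) = C ^ 3 * ((m : ℚ) ^ 2 - 1) ^ 2 := by
        rw [← hN']
        ring
      exact_mod_cast this
    have h3e : (3 : ℤ) ∣ C ^ 3 * e ^ 2 := ⟨N', by
      rw [he] at hN'z
      linarith⟩
    rcases hp3.dvd_or_dvd h3e with h' | h'
    · exact hC3 (hp3.dvd_of_dvd_pow h')
    · obtain ⟨g, rfl⟩ := hp3.dvd_of_dvd_pow h'
      exact h9 ⟨g, by rw [he]; ring⟩
  obtain ⟨C', rfl⟩ := hC3
  refine ⟨C' + s, m * C' + t, C', ?_, ?_, ?_⟩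
  · have : (A : ℚ) - (3 * C' : ℤ) = 3 * s := by exact_mod_cast hs
    push_cast at this ⊢
    linarith
  · have : (B : ℚ) - m * (3 * C' : ℤ) = 3 * t := by exact_mod_cast ht
    push_cast at this ⊢
    linarith
  · push_cast at hC
    linarith

end IsPureCubic

end PureCubic

namespace PureCubic

open NumberField Module Polynomial

lemma abs_discr_le {K : Type*} [Field K] [NumberField K] {n : ℕ} (hd : finrank ℚ K = n)
    (v : Fin n → K) (hv : ∀ i, IsIntegral ℤ (v i)) (h0 : Algebra.discr ℚ v ≠ 0) :
    |(discr K : ℚ)| ≤ |Algebra.discr ℚ v| := by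
  have hcard : Fintype.card (Module.Free.ChooseBasisIndex ℤ (𝓞 K)) = n := by
    rw [← finrank_eq_card_chooseBasisIndex, RingOfIntegers.rank, hd]
  let b := (RingOfIntegers.basis K).reindex (Fintype.equivFinOfCardEq hcard)
  let x : Fin n → 𝓞 K := fun i => ⟨v i, hv i⟩
  have h1 : Algebra.discr ℤ x = (b.toMatrix x).det ^ 2 * discr K := by
    rw [← discr_eq_discr K b, ← Algebra.discr_of_matrix_vecMul, b.toMatrix_map_vecMul]
  have h2 : ((Algebra.discr ℤ x : ℤ) : ℚ) = Algebra.discr ℚ v := by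
    rw [Algebra.discr_def, Algebra.discr_def, Int.cast_det]
    congr 1
    ext i j
    rw [Matrix.map_apply, Algebra.traceMatrix_apply, Algebra.traceMatrix_apply,
      Algebra.traceForm_apply, Algebra.traceForm_apply]
    exact Algebra.coe_trace_int (x i * x j)
  rw [← h2, h1]
  push_cast
  rw [abs_mul]
  have hdet : (b.toMatrix x).det ≠ 0 := by
    intro h
    rw [← h2, h1, h] at h0
    simp at h0
  have h3 : (1 : ℚ) ≤ |((b.toMatrix x).det : ℚ) ^ 2| := by
    rw [abs_of_nonneg (sq_nonneg _)]
    have : 0 < (b.toMatrix x).det ^ 2 := by positivity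
    exact_mod_cast this
  rw [← Int.cast_det]
  exact le_mul_of_one_le_left (abs_nonneg _) h3

namespace IsPureCubic

variable {K : Type*} [Field K] [NumberField K] {θ : K} {m : ℕ}

lemma discr_vec (h : IsPureCubic θ m) (a b c : ℚ) :
    Algebra.discr ℚ ![1, θ, (a + b * θ + c * θ ^ 2 : K)] = -27 * m ^ 2 * c ^ 2 := by
  have h3 := h.pow_three
  have key : Algebra.traceMatrix ℚ ![1, θ, (a + b * θ + c * θ ^ 2 : K)] =
      !![3, 0, 3 * a; 0, 0, 3 * (m * c); 3 * a, 3 * (m * c), 3 * (a ^ 2 + 2 * m * b * c)] := by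
    have e00 : (1 : K) = ((1 : ℚ) : K) + ((0 : ℚ) : K) * θ + ((0 : ℚ) : K) * θ ^ 2 := by simp
    have e01 : θ = ((0 : ℚ) : K) + ((1 : ℚ) : K) * θ + ((0 : ℚ) : K) * θ ^ 2 := by simp
    have e11 : θ ^ 2 = ((0 : ℚ) : K) + ((0 : ℚ) : K) * θ + ((1 : ℚ) : K) * θ ^ 2 := by simp
    have e12 : θ * (a + b * θ + c * θ ^ 2) =
        ((m * c : ℚ) : K) + (a : ℚ) * θ + (b : ℚ) * θ ^ 2 := by
      push_cast
      linear_combination c * h3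
    have e22 : (a + b * θ + c * θ ^ 2 : K) ^ 2 = ((a ^ 2 + 2 * m * b * c : ℚ) : K) +
        ((2 * a * b + m * c ^ 2 : ℚ) : K) * θ + ((b ^ 2 + 2 * a * c : ℚ) : K) * θ ^ 2 := by
      push_cast
      linear_combination (2 * b * c + c ^ 2 * θ) * h3
    have t00 : Algebra.trace ℚ K 1 = 3 := by rw [e00, h.trace_eq]; ring
    have t01 : Algebra.trace ℚ K θ = 0 := by rw [e01, h.trace_eq]; ring
    have t11 : Algebra.trace ℚ K (θ ^ 2) = 0 := by rw [e11, h.trace_eq]; ring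
    have t02 := h.trace_eq a b c
    have t12 : Algebra.trace ℚ K (θ * (a + b * θ + c * θ ^ 2)) = 3 * (m * c) := by
      rw [e12, h.trace_eq]
    have t22 : Algebra.trace ℚ K ((a + b * θ + c * θ ^ 2) ^ 2) = 3 * (a ^ 2 + 2 * m * b * c) := by
      rw [e22, h.trace_eq]
    set x : K := a + b * θ + c * θ ^ 2
    ext i j
    rw [Algebra.traceMatrix_apply, Algebra.traceForm_apply]
    fin_cases i <;> fin_cases j <;>
      simp [t00, t01, t02, t12, ← pow_two, t11, t22, mul_comm x θ]
  rw [Algebra.discr_def, key, Matrix.det_fin_three]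
  simp
  ring

lemma abs_discr_le_of_isIntegral (h : IsPureCubic θ m) {a b c : ℚ} (hc : c ≠ 0)
    (hz : IsIntegral ℤ (a + b * θ + c * θ ^ 2 : K)) : |(discr K : ℚ)| ≤ 27 * m ^ 2 * c ^ 2 := by
  have hm0 : (m : ℚ) ≠ 0 := by exact_mod_cast (zero_lt_one.trans h.one_lt).ne'
  have hne : (-27 * m ^ 2 * c ^ 2 : ℚ) ≠ 0 := by
    have : (m ^ 2 * c ^ 2 : ℚ) ≠ 0 := by positivity
    intro h'
    exact this (by linarith)
  have h1 := abs_discr_le h.finrank_eq ![1, θ, (a + b * θ + c * θ ^ 2 : K)] (fun i => by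
    fin_cases i
    · exact isIntegral_one
    · exact h.isIntegral
    · exact hz) (by rwa [h.discr_vec])
  refine h1.trans (le_of_eq ?_)
  rw [h.discr_vec, show (-27 * m ^ 2 * c ^ 2 : ℚ) = -(27 * m ^ 2 * c ^ 2) by ring, abs_neg,
    abs_of_nonneg (by positivity)]

lemma abs_discr_le_mul_sq (h : IsPureCubic θ m) : |(discr K : ℝ)| ≤ 27 * m ^ 2 := by
  have h1 := h.abs_discr_le_of_isIntegral (a := 0) (b := 0) (c := 1) one_ne_zero
    (by simpa using h.isIntegral.pow 2)
  have h2 : (|discr K| : ℚ) ≤ 27 * m ^ 2 := by simpa using h1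
  exact_mod_cast h2

lemma isIntegral_third (h : IsPureCubic θ m) {σ : ℤ} (hσ : σ ^ 2 = 1) (hm : (9 : ℤ) ∣ m - σ) :
    IsIntegral ℤ (((1 / 3 : ℚ) : K) + ((σ / 3 : ℚ) : K) * θ + ((1 / 3 : ℚ) : K) * θ ^ 2) := by
  obtain ⟨k, hk⟩ := hm
  refine ⟨X ^ 3 - (X ^ 2 + C (3 * k * σ) * X + C (3 * k ^ 2)), ?_, ?_⟩
  · refine monic_X_pow_sub ?_
    compute_degree
    exact WithBot.coe_lt_coe.2 (by norm_num : 2 < 3)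
  · have h3 : θ ^ 3 = σ + 9 * k := by
      rw [h.pow_three]
      have : (m : ℤ) = σ + 9 * k := by linarith
      exact_mod_cast congrArg (Int.cast : ℤ → K) this
    have hσ' : (σ : K) ^ 2 = 1 := by exact_mod_cast congrArg (Int.cast : ℤ → K) hσ
    simp only [eval₂_sub, eval₂_add, eval₂_mul, eval₂_pow, eval₂_X, eval₂_C]
    simp only [eq_intCast]
    push_cast
    grind

lemma abs_discr_le_three_mul_sq (h : IsPureCubic θ m) {σ : ℤ} (hσ : σ ^ 2 = 1)
    (hm : (9 : ℤ) ∣ m - σ) : |(discr K : ℝ)| ≤ 3 * m ^ 2 := by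
  have h1 := h.abs_discr_le_of_isIntegral (by norm_num) (h.isIntegral_third hσ hm)
  have h2 : (|discr K| : ℚ) ≤ 3 * m ^ 2 := by
    linarith
  exact_mod_cast h2

end IsPureCubic

end PureCubic

namespace PureCubic

open NumberField Module NumberField.InfinitePlace

namespace IsPureCubic

variable {K : Type*} [Field K] [NumberField K] {θ : K} {m : ℕ}

/-- Arithmetic constraints on a unit whose real conjugate `s ^ 2` exceeds `1`. -/
lemma exists_unit_coeff (h : IsPureCubic θ m) (w₁ : {w : InfinitePlace K // IsReal w})
    (w₂ : {w : InfinitePlace K // IsComplex w}) (u : (𝓞 K)ˣ)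
    (hu : 1 < realEmb K w₁ (u : 𝓞 K)) :
    ∃ a b c : ℚ, ∃ s : ℝ, ((u : 𝓞 K) : K) = a + b * θ + c * θ ^ 2 ∧
      1 < s ∧ s ^ 2 = realEmb K w₁ (u : 𝓞 K) ∧
      |3 * c * realEmb K w₁ θ ^ 2 - s ^ 2| ≤ 2 / s ∧
      |3 * (b ^ 2 - a * c) * realEmb K w₁ θ ^ 2| ≤ 1 + 2 * s ∧
      (∃ C : ℤ, 3 * (b ^ 2 - a * c) = C) ∧
      (a ^ 3 + m * b ^ 3 + m ^ 2 * c ^ 3 - 3 * m * a * b * c = 1 ∨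
        a ^ 3 + m * b ^ 3 + m ^ 2 * c ^ 3 - 3 * m * a * b * c = -1) := by
  have := h.subsingleton_isReal
  have := h.subsingleton_isComplex
  obtain ⟨a, b, c, hx⟩ := h.exists_eq ((u : 𝓞 K) : K)
  have hnorm : |Algebra.norm ℚ ((u : 𝓞 K) : K)| = 1 := by
    simp
  have hprod := abs_realEmb_mul_norm_complexEmb K w₁ w₂ ((u : 𝓞 K) : K)
  rw [hnorm, Rat.cast_one, abs_of_pos (by linarith)] at hprod
  set ε := realEmb K w₁ (u : 𝓞 K)
  set r := ‖complexEmb K w₂ (u : 𝓞 K)‖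
  have hr : 0 < r := by
    refine (norm_nonneg _).lt_of_ne fun h0 => ?_
    rw [show r = 0 from h0.symm] at hprod
    norm_num at hprod
  have hs2 : (r⁻¹) ^ 2 = ε := by
    field_simp
    linarith
  have hs1 : 1 < r⁻¹ := by
    by_contra! hle
    have : (r⁻¹) ^ 2 ≤ 1 := pow_le_one₀ (by positivity) hle
    linarith
  set y : K := ((a ^ 2 - m * b * c : ℚ) : K) + ((m * c ^ 2 - a * b : ℚ) : K) * θ +
    ((b ^ 2 - a * c : ℚ) : K) * θ ^ 2 with hy
  set N : ℚ := a ^ 3 + m * b ^ 3 + m ^ 2 * c ^ 3 - 3 * m * a * b * c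
  have hN : N = 1 ∨ N = -1 := by
    rw [hx, h.norm_eq] at hnorm
    exact eq_or_eq_neg_of_abs_eq hnorm
  have hxy : ((u : 𝓞 K) : K) * y = (N : K) := by
    rw [hx, hy]
    push_cast [N]
    linear_combination (b * (b ^ 2 - a * c) + c * (m * c ^ 2 - a * b) +
      c * (b ^ 2 - a * c) * θ) * h.pow_three
  have hy' : y = N * (((u⁻¹ : (𝓞 K)ˣ) : 𝓞 K) : K) := by
    have h1 : ((u : 𝓞 K) : K) * (((u⁻¹ : (𝓞 K)ˣ) : 𝓞 K) : K) = 1 := by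
      rw [← map_mul, Units.mul_inv, map_one]
    linear_combination (((u⁻¹ : (𝓞 K)ˣ) : 𝓞 K) : K) * hxy - y * h1
  have hyint : IsIntegral ℤ y := by
    have hv := RingOfIntegers.isIntegral_coe ((u⁻¹ : (𝓞 K)ˣ) : 𝓞 K)
    rcases hN with h1 | h1
    · rw [hy', h1, Rat.cast_one, one_mul]
      exact hv
    · rw [hy', h1, Rat.cast_neg, Rat.cast_one, neg_one_mul]
      exact hv.neg
  have hNabs : |(N : ℝ)| = 1 := by
    rcases hN with h1 | h1 <;> simp [h1]
  have hyR : |realEmb K w₁ y| ≤ 1 := by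
    have h1 := congrArg (fun z => |realEmb K w₁ z|) hxy
    simp only [map_mul, map_ratCast, abs_mul, hNabs] at h1
    change |ε| * _ = 1 at h1
    rw [abs_of_pos (by linarith)] at h1
    nlinarith [abs_nonneg (realEmb K w₁ y)]
  have hyC : ‖complexEmb K w₂ y‖ = r⁻¹ := by
    have h1 := congrArg (fun z => ‖complexEmb K w₂ z‖) hxy
    simp only [map_mul, map_ratCast, norm_mul] at h1
    change r * _ = _ at h1
    rw [show ‖((N : ℚ) : ℂ)‖ = |(N : ℝ)| by rw [← Complex.norm_ratCast], hNabs] at h1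
    exact eq_inv_of_mul_eq_one_right h1
  have hcx := h.abs_coeff_sub_le w₁ w₂ a b c
  have hcy := h.abs_coeff_sub_le w₁ w₂ (a ^ 2 - m * b * c) (m * c ^ 2 - a * b) (b ^ 2 - a * c)
  rw [← hx] at hcx
  rw [← hy, hyC] at hcy
  refine ⟨a, b, c, r⁻¹, hx, hs1, hs2, ?_, ?_, ?_, hN⟩
  · rw [hs2, div_inv_eq_mul]
    exact hcx
  · push_cast at hcy
    have := abs_sub_abs_le_abs_sub (3 * ((b : ℝ) ^ 2 - a * c) * realEmb K w₁ θ ^ 2)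
      (realEmb K w₁ y)
    linarith
  · obtain ⟨_, _, C, -, -, hC⟩ := h.exists_three_mul_coeff_eq hyint
    exact ⟨C, hC⟩

omit [NumberField K] in
lemma log_le_abs_log_realEmb (w₁ : {w : InfinitePlace K // IsReal w}) {B : ℝ} (hB : 0 < B)
    (hle : ∀ u : (𝓞 K)ˣ, 1 < realEmb K w₁ (u : 𝓞 K) → B ≤ realEmb K w₁ (u : 𝓞 K))
    (u : (𝓞 K)ˣ) (hu1 : u ≠ 1) (hu0 : 0 < realEmb K w₁ (u : 𝓞 K)) :
    Real.log B ≤ |Real.log (realEmb K w₁ (u : 𝓞 K))| := by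
  have hinv : realEmb K w₁ ((u⁻¹ : (𝓞 K)ˣ) : 𝓞 K) = (realEmb K w₁ (u : 𝓞 K))⁻¹ := by
    apply eq_inv_of_mul_eq_one_right
    rw [← map_mul, ← map_mul, Units.mul_inv, map_one, map_one]
  rcases lt_trichotomy (realEmb K w₁ (u : 𝓞 K)) 1 with h1 | h1 | h1
  · have h2 := hle u⁻¹ (by rw [hinv]; exact (one_lt_inv₀ hu0).2 h1)
    rw [hinv] at h2
    rw [← abs_neg, ← Real.log_inv]
    exact (Real.log_le_log hB h2).trans (le_abs_self _)
  · exfalso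
    refine hu1 (Units.ext (RingOfIntegers.ext ((realEmb K w₁).injective ?_)))
    rw [h1]
    simp
  · exact (Real.log_le_log hB (hle u h1)).trans (le_abs_self _)
end IsPureCubic

end PureCubic

namespace PureCubic

open NumberField Module NumberField.InfinitePlace

namespace IsPureCubic

variable {K : Type*} [Field K] [NumberField K] {θ : K} {m : ℕ}

lemma realEmb_pow_three (h : IsPureCubic θ m) (w₁ : {w : InfinitePlace K // IsReal w}) :
    realEmb K w₁ θ ^ 3 = m := h.map_pow_three _

lemma le_realEmb (h : IsPureCubic θ m) (w₁ : {w : InfinitePlace K // IsReal w}) {x : ℝ}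
    (hx : x ^ 3 ≤ m) : x ≤ realEmb K w₁ θ := by
  rw [← h.realEmb_pow_three w₁] at hx
  exact le_of_pow_le_pow_left₀ (by norm_num) (h.realEmb_pos w₁).le hx

/-- Lower bound for the fundamental unit when the maximal order is `ℤ[θ]`. -/
lemma eleven_mul_sq_le_realEmb_unit (h : IsPureCubic θ m)
    (w₁ : {w : InfinitePlace K // IsReal w}) (w₂ : {w : InfinitePlace K // IsComplex w})
    (hm : 14 ≤ m) (h3 : ¬ 3 ∣ m) (h9 : ¬ (9 : ℤ) ∣ (m : ℤ) ^ 2 - 1)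
    (hcube : ∀ b : ℤ, (b ^ 3 - m) ^ 2 ≠ 1) (u : (𝓞 K)ˣ) (hu : 1 < realEmb K w₁ (u : 𝓞 K)) :
    11 * realEmb K w₁ θ ^ 2 ≤ realEmb K w₁ (u : 𝓞 K) := by
  obtain ⟨a, b, c, s, hx, hs1, hs2, hc, hd, -, hN⟩ := h.exists_unit_coeff w₁ w₂ u hu
  have hintegral : IsIntegral ℤ ((a : K) + b * θ + c * θ ^ 2) :=
    hx ▸ RingOfIntegers.isIntegral_coe _
  obtain ⟨A, B, C, rfl, rfl, rfl⟩ := h.exists_coeff_eq h3 h9 hintegral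
  have hα : 2.41 ≤ realEmb K w₁ θ := by
    refine h.le_realEmb w₁ ?_
    have : (14 : ℝ) ≤ m := by exact_mod_cast hm
    norm_num
    linarith
  set α := realEmb K w₁ θ
  rw [← hs2]
  by_contra! hlt
  have hα2 : 5.808 ≤ α ^ 2 := by nlinarith
  push_cast at hc hd
  have h2s : 2 / s < 2 := by
    rw [div_lt_iff₀ (by linarith)]
    linarith
  rw [abs_le] at hc
  have hD : B ^ 2 = A * C := by
    by_contra hne
    have h1 : (1 : ℝ) ≤ |(B : ℝ) ^ 2 - A * C| := by
      have : (1 : ℤ) ≤ |B ^ 2 - A * C| := Int.one_le_abs (sub_ne_zero.2 hne)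
      exact_mod_cast this
    rw [abs_mul, abs_mul, abs_of_nonneg (sq_nonneg α), abs_of_pos (by norm_num : (0 : ℝ) < 3)] at hd
    have h2 : 3 * α ^ 2 ≤ 1 + 2 * s := by nlinarith
    have h3' : (3 * α ^ 2 - 1) ^ 2 ≤ (2 * s) ^ 2 := pow_le_pow_left₀ (by nlinarith) (by linarith) 2
    nlinarith
  have hC0 : 0 ≤ C := by
    by_contra! hneg
    have h1 : (C : ℝ) ≤ -1 := by
      have : C ≤ -1 := by lia
      exact_mod_cast this
    nlinarith
  have hC3 : C ≤ 3 := by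
    by_contra! hneg
    have h1 : (4 : ℝ) ≤ C := by
      have : 4 ≤ C := by lia
      exact_mod_cast this
    nlinarith
  have hNZ : A ^ 3 + m * B ^ 3 + m ^ 2 * C ^ 3 - 3 * m * A * B * C = 1 ∨
      A ^ 3 + m * B ^ 3 + m ^ 2 * C ^ 3 - 3 * m * A * B * C = -1 := by
    exact_mod_cast hN
  have hkey : C ^ 3 * (A ^ 3 + m * B ^ 3 + m ^ 2 * C ^ 3 - 3 * m * A * B * C) =
      (B ^ 3 - m * C ^ 3) ^ 2 := by
    linear_combination (-(B ^ 4 + B ^ 2 * A * C + A ^ 2 * C ^ 2) + 3 * m * C ^ 3 * B) * hD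
  obtain rfl | hCpos := hC0.eq_or_lt
  · have hB : B = 0 := by simpa using hD
    subst hB
    have hA : (A - 1) * (A + 1) = 0 := by
      have h6 : (A ^ 2) ^ 3 = 1 := by
        rcases hNZ with h1 | h1 <;> simp at h1 <;> nlinarith
      have : A ^ 2 = 1 := by
        have := (pow_eq_one_iff_of_nonneg (sq_nonneg A) (by norm_num : (3 : ℕ) ≠ 0)).1 h6
        exact this
      linarith
    rw [hx] at hu
    simp at hu
    rcases mul_eq_zero.1 hA with h1 | h1
    · rw [show A = 1 by lia] at hu
      norm_num at hu
    · rw [show A = -1 by lia] at hu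
      norm_num at hu
  · have hsq : C ^ 3 = (B ^ 3 - m * C ^ 3) ^ 2 := by
      rcases hNZ with h1 | h1
      · rw [← hkey, h1, mul_one]
      · rw [h1] at hkey
        have : 0 < C ^ 3 := by positivity
        nlinarith [sq_nonneg (B ^ 3 - m * C ^ 3)]
    have hC : C = 1 ∨ C = 2 ∨ C = 3 := by lia
    rcases hC with rfl | rfl | rfl
    · exact hcube B (by linarith)
    · have h1 : |B ^ 3 - m * 2 ^ 3| < 3 := abs_lt_of_sq_lt_sq (by rw [← hsq]; norm_num) (by norm_num)
      rw [abs_lt] at h1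
      generalize B ^ 3 - m * 2 ^ 3 = t at *
      obtain ⟨h1, h2⟩ := h1
      interval_cases t <;> norm_num at hsq
    · have h1 : |B ^ 3 - m * 3 ^ 3| < 6 := abs_lt_of_sq_lt_sq (by rw [← hsq]; norm_num) (by norm_num)
      rw [abs_lt] at h1
      generalize B ^ 3 - m * 3 ^ 3 = t at *
      obtain ⟨h1, h2⟩ := h1
      interval_cases t <;> norm_num at hsq

/-- Lower bound for the fundamental unit of a pure cubic field. -/
lemma mul_sq_le_realEmb_unit (h : IsPureCubic θ m)
    (w₁ : {w : InfinitePlace K // IsReal w}) (w₂ : {w : InfinitePlace K // IsComplex w})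
    (hm : 26 ≤ m) (u : (𝓞 K)ˣ) (hu : 1 < realEmb K w₁ (u : 𝓞 K)) :
    0.85 * realEmb K w₁ θ ^ 2 ≤ realEmb K w₁ (u : 𝓞 K) := by
  obtain ⟨a, b, c, s, hx, hs1, hs2, hc, hd, ⟨D, hD⟩, hN⟩ := h.exists_unit_coeff w₁ w₂ u hu
  have hintegral : IsIntegral ℤ ((a : K) + b * θ + c * θ ^ 2) :=
    hx ▸ RingOfIntegers.isIntegral_coe _
  obtain ⟨A, B, C, hA, hB, hC⟩ := h.exists_three_mul_coeff_eq hintegral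
  have hα : 2.96 ≤ realEmb K w₁ θ := by
    refine h.le_realEmb w₁ ?_
    have : (26 : ℝ) ≤ m := by exact_mod_cast hm
    norm_num
    linarith
  set α := realEmb K w₁ θ
  rw [← hs2]
  by_contra! hlt
  have hα2 : 8.7 ≤ α ^ 2 := by nlinarith
  have hCR : 3 * (c : ℝ) = C := by exact_mod_cast congrArg (Rat.cast : ℚ → ℝ) hC
  rw [hCR, abs_le] at hc
  have hs0 : 0 < s := by linarith
  have h2s : 2 / s * s = 2 := by field_simp
  have h2s2 : 2 / s < 2 := by
    rw [div_lt_iff₀ (by linarith)]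
    linarith
  rcases lt_trichotomy C 0 with hneg | rfl | hpos
  · have h1 : (C : ℝ) ≤ -1 := by
      have : C ≤ -1 := by lia
      exact_mod_cast this
    nlinarith
  · have hc0 : c = 0 := by
      simpa using hC
    subst hc0
    have hs : s < 1.27 := by
      have : s ^ 2 ≤ 2 / s := by
        simp at hc
        linarith
      have h3 : s ^ 3 ≤ 2 := by
        calc s ^ 3 = s ^ 2 * s := by ring
          _ ≤ 2 / s * s := by gcongr
          _ = 2 := h2s
      by_contra! hge
      have := pow_le_pow_left₀ (by norm_num) hge 3
      norm_num at this
      linarith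
    simp only [mul_zero, sub_zero, Rat.cast_zero] at hd hD hN
    have h1 : |3 * (b : ℝ) ^ 2 * α ^ 2| < 3.6 := by linarith
    have hDR : 3 * (b : ℝ) ^ 2 = D := by exact_mod_cast congrArg (Rat.cast : ℚ → ℝ) hD
    rw [hDR, abs_mul, abs_of_nonneg (sq_nonneg α)] at h1
    have hD0 : D = 0 := by
      by_contra hne
      have : (1 : ℝ) ≤ |(D : ℝ)| := by exact_mod_cast Int.one_le_abs hne
      nlinarith
    have hb0 : b = 0 := by
      rw [hD0] at hD
      simpa using hD
    subst hb0
    rw [hx] at hu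
    simp at hu hN
    have ha1 : 1 < a := by exact_mod_cast hu
    have := one_lt_pow₀ ha1 (by norm_num : 3 ≠ 0)
    rcases hN with h1 | h1 <;> linarith
  · have h1 : (1 : ℝ) ≤ C := by exact_mod_cast hpos
    have h2 : α ^ 2 ≤ s ^ 2 + 2 / s := by nlinarith
    have h3 : 2.5 ≤ s := by
      by_contra! hlt'
      nlinarith
    have h4 : 2 / s ≤ 0.8 := by
      rw [div_le_iff₀ hs0]
      linarith
    nlinarith
end IsPureCubic

end PureCubic

namespace PureCubic

open NumberField

section
variable {K : Type*} [Field K] [NumberField K]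

lemma eq_of_mem_of_not_sq_dvd {q : ℕ} (hq : q.Prime) {P Q : Ideal (𝓞 K)} (hP : P.IsPrime)
    (hQ : Q.IsPrime) (hqP : (q : 𝓞 K) ∈ P) (hqQ : (q : 𝓞 K) ∈ Q) {x : 𝓞 K} (hxP : x ∈ P)
    (hxQ : x ∈ Q) (hx : ¬ q ^ 2 ∣ Ideal.absNorm (Ideal.span {x})) : P = Q := by
  classical
  by_contra hne
  have h1 : ∏ I ∈ ({P, Q} : Finset (Ideal (𝓞 K))), I ∣ Ideal.span {x} := by
    refine Finset.prod_primes_dvd _ (fun I hI => ?_) fun I hI => ?_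
    · rcases Finset.mem_insert.1 hI with rfl | hI
      · exact Ideal.prime_of_isPrime (ne_bot_of_natCast_mem hq.ne_zero hqP) hP
      · rw [Finset.mem_singleton.1 hI]
        exact Ideal.prime_of_isPrime (ne_bot_of_natCast_mem hq.ne_zero hqQ) hQ
    · rcases Finset.mem_insert.1 hI with rfl | hI
      · exact Ideal.dvd_span_singleton.2 hxP
      · rw [Finset.mem_singleton.1 hI]
        exact Ideal.dvd_span_singleton.2 hxQ
  rw [Finset.prod_pair hne] at h1
  refine hx (dvd_trans ?_ (map_dvd Ideal.absNorm h1))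
  obtain ⟨f, hf0, hf⟩ := exists_absNorm_eq_pow hq hP hqP
  obtain ⟨g, hg0, hg⟩ := exists_absNorm_eq_pow hq hQ hqQ
  rw [map_mul, hf, hg, sq]
  exact mul_dvd_mul (dvd_pow_self _ hf0.ne') (dvd_pow_self _ hg0.ne')

lemma natCast_mem_of_absNorm_eq {q : ℕ} {P : Ideal (𝓞 K)} (hP : Ideal.absNorm P = q) :
    (q : 𝓞 K) ∈ P := hP ▸ Ideal.absNorm_mem P

lemma isPrime_of_absNorm_eq {q : ℕ} (hq : q.Prime) {P : Ideal (𝓞 K)}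
    (hP : Ideal.absNorm P = q) : P.IsPrime :=
  Ideal.isPrime_of_irreducible_absNorm (by rw [hP]; exact hq)

omit [NumberField K] in
lemma dvd_of_intCast_mem {q : ℕ} (hq : q.Prime) {P : Ideal (𝓞 K)} (hP : P.IsPrime)
    (hqP : (q : 𝓞 K) ∈ P) {n : ℤ} (hn : (n : 𝓞 K) ∈ P) : (q : ℤ) ∣ n := by
  by_contra hnd
  obtain ⟨a, b, hab⟩ := ((Nat.prime_iff_prime_int.1 hq).coprime_iff_not_dvd.2 hnd)
  apply hP.ne_top
  rw [Ideal.eq_top_iff_one]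
  have h1 : ((a * q + b * n : ℤ) : 𝓞 K) = 1 := by rw [hab, Int.cast_one]
  rw [← h1]
  push_cast
  exact P.add_mem (P.mul_mem_left _ hqP) (P.mul_mem_left _ hn)

/-- A prime of prime norm has residue field `ℤ/q`. -/
lemma exists_int_sub_mem {q : ℕ} (hq : q.Prime) {P : Ideal (𝓞 K)}
    (hP : Ideal.absNorm P = q) (x : 𝓞 K) : ∃ r : ℤ, x - r ∈ P := by
  have hcard : Nat.card (𝓞 K ⧸ P) = q := by
    rw [← hP, Ideal.absNorm_apply, Submodule.cardQuot_apply]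
  have : Finite (𝓞 K ⧸ P) := Nat.finite_of_card_ne_zero (by rw [hcard]; exact hq.ne_zero)
  have := Fintype.ofFinite (𝓞 K ⧸ P)
  let e := ZMod.ringEquivOfPrime (𝓞 K ⧸ P) hq (by rw [← Nat.card_eq_fintype_card, hcard])
  obtain ⟨r, hr⟩ := ZMod.intCast_surjective (e.symm (Ideal.Quotient.mk P x))
  refine ⟨r, Ideal.Quotient.eq.1 ?_⟩
  rw [map_intCast, ← map_intCast e, hr, RingEquiv.apply_symm_apply]

end

lemma pow_three_injective {q : ℕ} (hq : q.Prime) (h2 : q % 3 = 2) {a b : ℤ}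
    (h : (q : ℤ) ∣ a ^ 3 - b ^ 3) : (q : ℤ) ∣ a - b := by
  have := Fact.mk hq
  have key : ∀ x : ZMod q, (x ^ 3) ^ ((2 * q - 1) / 3) = x := fun x => by
    rw [← pow_mul, show 3 * ((2 * q - 1) / 3) = q + (q - 1) by omega, pow_add, ZMod.pow_card,
      ← pow_succ', show q - 1 + 1 = q by have := hq.pos; omega, ZMod.pow_card]
  have h1 : ((a ^ 3 - b ^ 3 : ℤ) : ZMod q) = 0 := (ZMod.intCast_zmod_eq_zero_iff_dvd _ _).2 h
  rw [← ZMod.intCast_zmod_eq_zero_iff_dvd]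
  push_cast at h1 ⊢
  rw [sub_eq_zero, ← key a, ← key b, sub_eq_zero.1 h1]

namespace IsPureCubic
variable {K : Type*} [Field K] [NumberField K] {θ : K} {m : ℕ}

/-- The generator as an algebraic integer. -/
noncomputable def gen (h : IsPureCubic θ m) : 𝓞 K := ⟨θ, h.isIntegral⟩

lemma coe_gen (h : IsPureCubic θ m) : (h.gen : K) = θ := rfl

lemma gen_pow_three (h : IsPureCubic θ m) : h.gen ^ 3 = m :=
  RingOfIntegers.ext (by simpa [coe_gen] using h.pow_three)

lemma absNorm_span_eq (h : IsPureCubic θ m) (a b c : ℤ) :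
    Ideal.absNorm (Ideal.span {(a + b * h.gen + c * h.gen ^ 2 : 𝓞 K)}) =
      (a ^ 3 + m * b ^ 3 + m ^ 2 * c ^ 3 - 3 * m * a * b * c : ℤ).natAbs := by
  rw [Ideal.absNorm_span_singleton]
  congr 1
  have h1 := h.norm_eq a b c
  have h2 := Algebra.coe_norm_int (a + b * h.gen + c * h.gen ^ 2 : 𝓞 K)
  have h3 : ((a + b * h.gen + c * h.gen ^ 2 : 𝓞 K) : K) =
      ((a : ℚ) : K) + ((b : ℚ) : K) * θ + ((c : ℚ) : K) * θ ^ 2 := by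
    simp [coe_gen]
  rw [h3, h1] at h2
  exact_mod_cast h2

lemma absNorm_span_gen_sub (h : IsPureCubic θ m) (r : ℤ) :
    Ideal.absNorm (Ideal.span {h.gen - r}) = (m - r ^ 3 : ℤ).natAbs := by
  convert! h.absNorm_span_eq (-r) 1 0 using 2
  · congr 2
    push_cast
    ring
  · ring

lemma gen_mem (h : IsPureCubic θ m) {q : ℕ} (hqm : q ∣ m) {P : Ideal (𝓞 K)} (hP : P.IsPrime)
    (hqP : (q : 𝓞 K) ∈ P) : h.gen ∈ P := by
  refine hP.mem_of_pow_mem 3 ?_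
  rw [h.gen_pow_three]
  obtain ⟨k, rfl⟩ := hqm
  rw [Nat.cast_mul]
  exact P.mul_mem_right _ hqP

/-- A prime dividing `m` is totally ramified. -/
lemma idealCount_le_one_of_dvd (h : IsPureCubic θ m) {q : ℕ} (hq : q.Prime) (hqm : q ∣ m)
    (k : ℕ) : idealCount K (q ^ k) ≤ 1 := by
  refine idealCount_prime_pow_le_one hq k fun P Q hP hQ hqP hqQ =>
    eq_of_mem_of_not_sq_dvd hq hP hQ hqP hqQ (h.gen_mem hqm hP hqP) (h.gen_mem hqm hQ hqQ) ?_
  have hn := h.absNorm_span_gen_sub 0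
  rw [Int.cast_zero, sub_zero] at hn
  rw [hn, sq]
  norm_num
  exact fun hd => hq.not_isUnit (h.squarefree q hd)

lemma idealCount_le_half (h : IsPureCubic θ m) {q : ℕ} (hq : q.Prime) (h2 : q % 3 = 2)
    (k : ℕ) : idealCount K (q ^ k) ≤ k / 2 + 1 := by
  refine idealCount_prime_pow_le_half hq h.finrank_eq k fun P Q hP hQ => ?_
  have hqP := natCast_mem_of_absNorm_eq hP
  have hqQ := natCast_mem_of_absNorm_eq hQ
  have hroot : ∀ I : Ideal (𝓞 K), Ideal.absNorm I = q →
      ∃ r : ℤ, h.gen - r ∈ I ∧ (q : ℤ) ∣ m - r ^ 3 := fun I hI => by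
    obtain ⟨r, hr⟩ := exists_int_sub_mem hq hI h.gen
    refine ⟨r, hr, dvd_of_intCast_mem hq (isPrime_of_absNorm_eq hq hI)
      (natCast_mem_of_absNorm_eq hI) ?_⟩
    have h1 : ((m - r ^ 3 : ℤ) : 𝓞 K) = (h.gen ^ 2 + h.gen * r + r ^ 2) * (h.gen - r) := by
      push_cast
      linear_combination -h.gen_pow_three
    rw [h1]
    exact I.mul_mem_left _ hr
  obtain ⟨r₁, hr₁, hm₁⟩ := hroot P hP
  obtain ⟨r₂, hr₂, hm₂⟩ := hroot Q hQ
  have h12 : (q : ℤ) ∣ r₁ - r₂ := pow_three_injective hq h2 (by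
    convert! dvd_sub hm₂ hm₁ using 1
    ring)
  have hqZ : Prime (q : ℤ) := Nat.prime_iff_prime_int.1 hq
  have hlift : ∃ r : ℤ, (q : ℤ) ∣ r - r₁ ∧ ¬ (q : ℤ) ^ 2 ∣ m - r ^ 3 := by
    by_contra! hall
    have h1 := hall r₁ (by simp)
    have h3 := hall (r₁ + q) (by simp)
    have h4 : (q : ℤ) ^ 2 ∣ q * (3 * r₁ ^ 2) := by
      have h5 := dvd_sub (dvd_sub h1 h3) (Dvd.intro (3 * r₁ + q : ℤ) rfl : (q : ℤ) ^ 2 ∣ _)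
      convert! h5 using 1
      ring
    rw [sq, mul_dvd_mul_iff_left hqZ.ne_zero] at h4
    have h5 : (q : ℤ) ∣ r₁ := by
      rcases hqZ.dvd_or_dvd h4 with h6 | h6
      · have h6' : q ∣ 3 := by exact_mod_cast h6
        rw [(Nat.prime_dvd_prime_iff_eq hq Nat.prime_three).1 h6'] at h2
        omega
      · exact hqZ.dvd_of_dvd_pow h6
    have h6 : (q : ℤ) ^ 2 ∣ m := by
      have h7 : (q : ℤ) ^ 2 ∣ r₁ ^ 3 := (pow_dvd_pow_of_dvd h5 2).trans (pow_dvd_pow _ (by norm_num))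
      simpa using dvd_add h1 h7
    rw [sq] at h6
    exact hq.not_isUnit (h.squarefree q (by exact_mod_cast h6))
  obtain ⟨r, hr, hr2⟩ := hlift
  have hmem : ∀ (I : Ideal (𝓞 K)) (r' : ℤ), (q : 𝓞 K) ∈ I → h.gen - r' ∈ I → (q : ℤ) ∣ r - r' →
      h.gen - r ∈ I := fun I r' hI hgI ⟨k, hk⟩ => by
    have h1 : h.gen - r = (h.gen - r') - q * k := by
      have : ((r - r' : ℤ) : 𝓞 K) = (q * k : ℤ) := by rw [hk]
      push_cast at this
      linear_combination -this
    rw [h1]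
    exact I.sub_mem hgI (I.mul_mem_right _ hI)
  refine eq_of_mem_of_not_sq_dvd hq (isPrime_of_absNorm_eq hq hP) (isPrime_of_absNorm_eq hq hQ)
    hqP hqQ (hmem P r₁ hqP hr₁ hr) (hmem Q r₂ hqQ hr₂ ?_) ?_
  · convert! dvd_add hr h12 using 1
    ring
  · rw [h.absNorm_span_gen_sub, ← Int.natCast_dvd]
    exact_mod_cast hr2

lemma gen_sub_mem (h : IsPureCubic θ m) {P : Ideal (𝓞 K)} (hP : P.IsPrime)
    (h3P : ((3 : ℕ) : 𝓞 K) ∈ P) : h.gen - (m : ℤ) ∈ P := by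
  refine hP.mem_of_pow_mem 3 ?_
  have hd : (3 : ℤ) ∣ m - m ^ 3 := by
    have h1 : (m : ℤ) % 3 = 0 ∨ (m : ℤ) % 3 = 1 ∨ (m : ℤ) % 3 = 2 := by lia
    rcases h1 with h1 | h1 | h1 <;>
      exact Int.dvd_of_emod_eq_zero (by simp [Int.sub_emod, pow_succ, Int.mul_emod, h1])
  obtain ⟨k, hk⟩ := hd
  have hk' : ((m - m ^ 3 : ℤ) : 𝓞 K) = (3 * k : ℤ) := by rw [hk]
  push_cast at hk'
  have h1 : (h.gen - (m : ℤ)) ^ 3 =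
      ((3 : ℕ) : 𝓞 K) * (k - m * h.gen ^ 2 + m ^ 2 * h.gen) := by
    push_cast
    linear_combination h.gen_pow_three + hk'
  rw [h1]
  exact P.mul_mem_right _ h3P

lemma idealCount_three_le_one (h : IsPureCubic θ m) (h3 : ¬ 3 ∣ m)
    (h9 : ¬ (9 : ℤ) ∣ (m : ℤ) ^ 2 - 1) (k : ℕ) : idealCount K (3 ^ k) ≤ 1 := by
  refine idealCount_prime_pow_le_one Nat.prime_three k fun P Q hP hQ h3P h3Q =>
    eq_of_mem_of_not_sq_dvd Nat.prime_three hP hQ h3P h3Q (h.gen_sub_mem hP h3P)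
      (h.gen_sub_mem hQ h3Q) ?_
  rw [h.absNorm_span_gen_sub, ← Int.natCast_dvd]
  intro hd
  refine h9 ?_
  have h1 : (9 : ℤ) ∣ m * (m ^ 2 - 1) := by
    convert! hd.neg_right using 1
    ring
  refine IsCoprime.dvd_of_dvd_mul_left ?_ h1
  rw [show (9 : ℤ) = 3 ^ 2 by norm_num]
  refine IsCoprime.pow_left (Int.prime_three.coprime_iff_not_dvd.2 fun hd' => h3 ?_)
  exact_mod_cast hd'

lemma idealCount_three_le_succ (h : IsPureCubic θ m) (h3 : ¬ 3 ∣ m) (k : ℕ) :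
    idealCount K (3 ^ k) ≤ k + 1 := by
  refine idealCount_prime_pow_le_succ Nat.prime_three k fun s hs => ?_
  by_contra! hcard
  have hle : 3 ^ s.card ≤ ∏ P ∈ s, Ideal.absNorm P := by
    rw [← Finset.prod_const]
    refine Finset.prod_le_prod' fun P hP => ?_
    obtain ⟨f, hf0, hf⟩ := exists_absNorm_eq_pow Nat.prime_three (hs P hP).1 (hs P hP).2
    rw [hf]
    exact Nat.le_self_pow hf0.ne' 3
  have hle' := prod_absNorm_le three_ne_zero h.finrank_eq s hs
  have hprod : ∏ P ∈ s, Ideal.absNorm P = 3 ^ 3 :=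
    le_antisymm hle' ((Nat.pow_le_pow_right (by norm_num) hcard).trans hle)
  obtain ⟨J, hJ⟩ := prod_dvd_span_natCast three_ne_zero s hs
  have hJ1 : J = 1 := by
    have h1 := congrArg Ideal.absNorm hJ
    rw [map_mul, map_prod, hprod, Ideal.absNorm_span_natCast, RingOfIntegers.rank,
      h.finrank_eq] at h1
    rw [Ideal.one_eq_top, ← Ideal.absNorm_eq_one_iff]
    lia
  rw [hJ1, mul_one] at hJ
  have hdvd : ∏ P ∈ s, P ∣ Ideal.span {h.gen - (m : ℤ)} :=
    Finset.prod_primes_dvd _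
      (fun P hP => Ideal.prime_of_isPrime (ne_bot_of_natCast_mem three_ne_zero (hs P hP).2)
        (hs P hP).1)
      fun P hP => Ideal.dvd_span_singleton.2 (h.gen_sub_mem (hs P hP).1 (hs P hP).2)
  rw [← hJ, Ideal.dvd_span_singleton, Ideal.mem_span_singleton] at hdvd
  obtain ⟨y, hy⟩ := hdvd
  have hyK : θ - m = 3 * algebraMap (𝓞 K) K y := by
    have := congrArg (algebraMap (𝓞 K) K) hy
    rw [map_mul, map_natCast, map_sub, map_intCast] at this
    exact_mod_cast this
  obtain ⟨n, hn⟩ := exists_int_trace_eq (RingOfIntegers.isIntegral_coe (y ^ 2))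
  have hy2 : algebraMap (𝓞 K) K (y ^ 2) = ((m ^ 2 / 9 : ℚ) : K) + ((-(2 * m / 9) : ℚ) : K) * θ +
      ((1 / 9 : ℚ) : K) * θ ^ 2 := by
    rw [map_pow]
    push_cast
    linear_combination -(1 / 9 : K) * (θ - m + 3 * algebraMap (𝓞 K) K y) * hyK
  rw [hy2, h.trace_eq] at hn
  have hn' : (m : ℤ) ^ 2 = 3 * n := by
    have : (m : ℚ) ^ 2 = 3 * n := by linarith
    exact_mod_cast this
  refine h3 (Nat.prime_three.dvd_of_dvd_pow (n := 2) ?_)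
  exact_mod_cast (Dvd.intro n hn'.symm : (3 : ℤ) ∣ m ^ 2)

end IsPureCubic

end PureCubic

namespace PureCubic

namespace IsPureCubic
open NumberField Module NumberField.InfinitePlace
variable {K : Type*} [Field K] [NumberField K] {θ : K} {m : ℕ}

lemma idealCount_le_majorant (h : IsPureCubic θ m) {M : ℕ} (hM : M ∣ 6)
    (hM1 : ∀ q k, q.Prime → q ∣ M → idealCount K (q ^ k) ≤ 1) (h2 : 2 ∣ M)
    (h3 : ∀ k, idealCount K (3 ^ k) ≤ k + 1) (n : ℕ) (hn : n ≠ 0) :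
    (idealCount K n : ℤ) ≤ majorant M n := by
  refine le_majorant (fun _ _ => idealCount_mul_le) idealCount_one_le (fun q k hq _ => ?_) n hn
  by_cases h6 : q ∣ 6
  · rw [majorant_prime_pow_of_dvd hq h6]
    split_ifs with hqM
    · exact_mod_cast hM1 q k hq hqM
    · have hq3 : q = 3 := by
        rcases hq.dvd_mul.1 (show q ∣ 2 * 3 from h6) with h7 | h7
        · exact absurd (((Nat.prime_dvd_prime_iff_eq hq Nat.prime_two).1 h7) ▸ h2) hqM
        · exact (Nat.prime_dvd_prime_iff_eq hq Nat.prime_three).1 h7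
      subst hq3
      exact_mod_cast h3 k
  · have hcases : q % 3 = 1 ∨ q % 3 = 2 := by
      have : q % 3 ≠ 0 := fun h0 => by
        rw [← (Nat.prime_dvd_prime_iff_eq Nat.prime_three hq).1 (Nat.dvd_of_mod_eq_zero h0)] at h6
        norm_num at h6
      omega
    rcases hcases with h7 | h7
    · rw [majorant_prime_pow_of_mod_three_eq_one hM hq h7]
      exact_mod_cast idealCount_prime_pow_le_choose_two hq h.finrank_eq k
    · rw [majorant_prime_pow_of_mod_three_eq_two hM hq h7
        (by rintro rfl; norm_num at h6)]
      exact_mod_cast h.idealCount_le_half hq h7 k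

lemma sum_idealCount_le_of_not_dvd (h : IsPureCubic θ m) (h2 : 2 ∣ m) (h3 : ¬ 3 ∣ m)
    (h9 : ¬ (9 : ℤ) ∣ (m : ℤ) ^ 2 - 1) (u : ℝ) (hu : 0 < u) :
    ∑ n ∈ Finset.Ioc 0 ⌊u⌋₊, (idealCount K n : ℝ) ≤ 1 / 3 * (u * Real.log u + 2 * u) + 1 := by
  refine sum_le_of_le_majorant (M := 6) (by norm_num) (by norm_num)
    (fun N hN => (coprimeHarmonic_six_le hN).trans (by linarith))
    (h.idealCount_le_majorant dvd_rfl (fun q k hq hq6 => ?_) (by norm_num) fun k =>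
      (h.idealCount_three_le_one h3 h9 k).trans (by lia)) hu
  rcases hq.dvd_mul.1 (show q ∣ 2 * 3 from hq6) with h7 | h7
  · exact h.idealCount_le_one_of_dvd hq (h7.trans h2) k
  · obtain rfl := (Nat.prime_dvd_prime_iff_eq hq Nat.prime_three).1 h7
    exact h.idealCount_three_le_one h3 h9 k

lemma sum_idealCount_le (h : IsPureCubic θ m) (h2 : 2 ∣ m) (h3 : ¬ 3 ∣ m) (u : ℝ) (hu : 0 < u) :
    ∑ n ∈ Finset.Ioc 0 ⌊u⌋₊, (idealCount K n : ℝ) ≤ 1 / 2 * (u * Real.log u + 2 * u) + 1 :=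
  sum_le_of_le_majorant (M := 2) (by norm_num) (by norm_num)
    (fun N hN => (coprimeHarmonic_two_le hN).trans (by linarith))
    (h.idealCount_le_majorant (by norm_num)
      (fun _ k hq hq2 => h.idealCount_le_one_of_dvd hq (hq2.trans h2) k) dvd_rfl
      (h.idealCount_three_le_succ h3)) hu

lemma classNumber_mul_le_of_not_dvd (h : IsPureCubic θ m) (hm : 14 ≤ m) (h2 : 2 ∣ m)
    (h3 : ¬ 3 ∣ m) (h9 : ¬ (9 : ℤ) ∣ (m : ℤ) ^ 2 - 1) (hcube : ∀ b : ℤ, (b ^ 3 - m) ^ 2 ≠ 1)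
    {X : ℝ} (hX : 2 ≤ X) :
    classNumber K * (Real.log 11 + 2 / 3 * Real.log m) *
      (Real.pi * X / (2 * √|(discr K : ℝ)|) - 1) ≤
        2 * (1 / 3 * X * (2 / 15 * Real.log X - 19 / 450) + Real.log X) := by
  have := h.subsingleton_isReal
  have := h.subsingleton_isComplex
  obtain ⟨⟨w₁⟩, ⟨w₂⟩⟩ := h.exists_places
  have hα := h.realEmb_pos w₁
  have hlog : Real.log (11 * realEmb K w₁ θ ^ 2) = Real.log 11 + 2 / 3 * Real.log m := by
    rw [← h.realEmb_pow_three w₁, Real.log_mul (by norm_num) (by positivity), Real.log_pow,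
      Real.log_pow]
    push_cast
    ring
  have hm0 : 0 ≤ Real.log m := Real.log_natCast_nonneg m
  refine classNumber_mul_le_of_sum_idealCount_le K w₁ w₂ hX
    (add_nonneg (Real.log_nonneg (by norm_num)) (by positivity)) (by norm_num) ?_
    (h.sum_idealCount_le_of_not_dvd h2 h3 h9)
  rw [← hlog]
  exact log_le_abs_log_realEmb w₁ (by positivity)
    (h.eleven_mul_sq_le_realEmb_unit w₁ w₂ hm h3 h9 hcube)

lemma classNumber_mul_le (h : IsPureCubic θ m) (hm : 26 ≤ m) (h2 : 2 ∣ m) (h3 : ¬ 3 ∣ m)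
    {X : ℝ} (hX : 2 ≤ X) :
    classNumber K * (Real.log 0.85 + 2 / 3 * Real.log m) *
      (Real.pi * X / (2 * √|(discr K : ℝ)|) - 1) ≤
        2 * (1 / 2 * X * (2 / 15 * Real.log X - 19 / 450) + Real.log X) := by
  have := h.subsingleton_isReal
  have := h.subsingleton_isComplex
  obtain ⟨⟨w₁⟩, ⟨w₂⟩⟩ := h.exists_places
  have hα := h.realEmb_pos w₁
  have hlog : Real.log (0.85 * realEmb K w₁ θ ^ 2) = Real.log 0.85 + 2 / 3 * Real.log m := by
    rw [← h.realEmb_pow_three w₁, Real.log_mul (by norm_num) (by positivity), Real.log_pow,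
      Real.log_pow]
    push_cast
    ring
  have hα1 : 2 ≤ realEmb K w₁ θ := h.le_realEmb w₁ (by
    have : (26 : ℝ) ≤ m := by exact_mod_cast hm
    norm_num
    linarith)
  refine classNumber_mul_le_of_sum_idealCount_le K w₁ w₂ hX ?_ (by norm_num) ?_
    (h.sum_idealCount_le h2 h3)
  · rw [← hlog]
    exact Real.log_nonneg (by nlinarith)
  · rw [← hlog]
    exact log_le_abs_log_realEmb w₁ (by positivity) (h.mul_sq_le_realEmb_unit w₁ w₂ hm)

end IsPureCubic

end PureCubic

namespace PureCubic

namespace IsPureCubic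
open NumberField Module NumberField.InfinitePlace
variable {K : Type*} [Field K] [NumberField K] {θ : K} {p : ℕ}

lemma le_pi_div {D X t c : ℝ} (hD : 0 < D) (hX : 0 ≤ X) (hDt : D ≤ t ^ 2) (ht : 0 < t)
    (hc : c * (2 * t) ≤ 3.14 * X) : c ≤ Real.pi * X / (2 * √D) := by
  have h1 : √D ≤ t := (Real.sqrt_le_left ht.le).2 hDt
  have h0 : 0 < √D := Real.sqrt_pos.2 hD
  calc c ≤ 3.14 * X / (2 * t) := (le_div_iff₀ (by positivity)).2 hc
    _ ≤ Real.pi * X / (2 * √D) := by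
      gcongr
      exact Real.pi_gt_d2.le

lemma abs_discr_pos : 0 < |(discr K : ℝ)| :=
  abs_pos.2 (by exact_mod_cast discr_ne_zero K)

lemma classNumber_lt_of_not_dvd (h : IsPureCubic θ (2 * p)) (hp : 7 ≤ p) (h3 : ¬ 3 ∣ 2 * p)
    (h9 : ¬ (9 : ℤ) ∣ ((2 * p : ℕ) : ℤ) ^ 2 - 1)
    (hcube : ∀ b : ℤ, (b ^ 3 - (2 * p : ℕ)) ^ 2 ≠ 1) : classNumber K < p := by
  have hpR : (7 : ℝ) ≤ p := by exact_mod_cast hp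
  have hX : (2 : ℝ) ≤ 80 * p := by linarith
  have key := h.classNumber_mul_le_of_not_dvd (by lia) (by simp) h3 h9 hcube hX
  have hd := h.abs_discr_le_mul_sq
  push_cast at key hd
  have hlam : 12 ≤ Real.pi * (80 * p) / (2 * √|(discr K : ℝ)|) :=
    le_pi_div (t := 10.3924 * p) abs_discr_pos (by positivity) (hd.trans (by nlinarith))
      (by positivity) (by linarith)
  by_contra! hle
  have hleR : (p : ℝ) ≤ classNumber K := by exact_mod_cast hle
  have hlog2 := Real.log_two_gt_d9
  have hlog2' := Real.log_two_lt_d9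
  have hlog11 : 38 * Real.log 2 ≤ 11 * Real.log 11 := by
    have := Real.log_le_log (by norm_num) (show (2 : ℝ) ^ 38 ≤ 11 ^ 11 by norm_num)
    rw [Real.log_pow, Real.log_pow] at this
    exact_mod_cast this
  have hlog40 : 3 * Real.log 40 ≤ 16 * Real.log 2 := by
    have := Real.log_le_log (by norm_num) (show (40 : ℝ) ^ 3 ≤ 2 ^ 16 by norm_num)
    rw [Real.log_pow, Real.log_pow] at this
    exact_mod_cast this
  have hlog14 : 6 * Real.log 14 ≤ 23 * Real.log 2 := by
    have := Real.log_le_log (by norm_num) (show (14 : ℝ) ^ 6 ≤ 2 ^ 23 by norm_num)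
    rw [Real.log_pow, Real.log_pow] at this
    exact_mod_cast this
  have hL : Real.log (80 * p) = Real.log 40 + Real.log (2 * p) := by
    rw [← Real.log_mul (by norm_num) (by positivity)]
    ring_nf
  have hℓ : Real.log (2 * p) ≤ Real.log 14 + (p / 7 - 1) := by
    have h1 : Real.log (2 * p) = Real.log 14 + Real.log (p / 7) := by
      rw [← Real.log_mul (by norm_num) (by positivity)]
      ring_nf
    rw [h1]
    gcongr
    exact Real.log_le_sub_one_of_pos (by positivity)
  have hℓ0 : 0 ≤ Real.log (2 * (p : ℝ)) := Real.log_nonneg (by linarith)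
  rw [hL] at key
  set ℓ := Real.log (2 * (p : ℝ))
  have hT : 0 ≤ Real.log 11 + 2 / 3 * ℓ := by linarith
  have hlow : p * (Real.log 11 + 2 / 3 * ℓ) * 11 ≤ classNumber K * (Real.log 11 + 2 / 3 * ℓ) *
      (Real.pi * (80 * p) / (2 * √|(discr K : ℝ)|) - 1) := by
    gcongr
    linarith
  have hup := hlow.trans key
  have hlast : Real.log 40 + ℓ ≤ 0.91 * p := by linarith
  have hmain : (p : ℝ) * (80 / 3 * 2 * (2 / 15 * (Real.log 40 + ℓ) - 19 / 450) + 2 * 0.91) <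
      p * (11 * (Real.log 11 + 2 / 3 * ℓ)) := by
    gcongr
    linarith
  linarith

lemma classNumber_lt (h : IsPureCubic θ (2 * p)) (hp : 13 ≤ p) {σ : ℤ} (hσ : σ ^ 2 = 1)
    (hm : (9 : ℤ) ∣ ((2 * p : ℕ) : ℤ) - σ) : classNumber K < p := by
  have hpR : (13 : ℝ) ≤ p := by exact_mod_cast hp
  have hX : (2 : ℝ) ≤ 16 * p := by linarith
  have h3 : ¬ 3 ∣ 2 * p := by
    rcases sq_eq_one_iff.1 hσ with rfl | rfl <;> lia
  have key := h.classNumber_mul_le (by lia) (by simp) h3 hX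
  have hd := h.abs_discr_le_three_mul_sq hσ hm
  push_cast at key hd
  have hlam : 7.25 ≤ Real.pi * (16 * p) / (2 * √|(discr K : ℝ)|) :=
    le_pi_div (t := 3.4642 * p) abs_discr_pos (by positivity) (hd.trans (by nlinarith))
      (by positivity) (by linarith)
  by_contra! hle
  have hleR : (p : ℝ) ≤ classNumber K := by exact_mod_cast hle
  have hlog2 := Real.log_two_gt_d9
  have hlog2' := Real.log_two_lt_d9
  have hlog85 : -0.18 ≤ Real.log 0.85 := by
    have := Real.one_sub_inv_le_log_of_pos (show (0 : ℝ) < 0.85 by norm_num)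
    norm_num at this ⊢
    linarith
  have hlog8 : Real.log 8 = 3 * Real.log 2 := by
    rw [show (8 : ℝ) = 2 ^ 3 by norm_num, Real.log_pow]
    norm_num
  have hlog26 : 14 * Real.log 2 ≤ 3 * Real.log 26 := by
    have := Real.log_le_log (by norm_num) (show (2 : ℝ) ^ 14 ≤ 26 ^ 3 by norm_num)
    rw [Real.log_pow, Real.log_pow] at this
    exact_mod_cast this
  have hlog26' : Real.log 26 ≤ 5 * Real.log 2 := by
    have := Real.log_le_log (by norm_num) (show (26 : ℝ) ≤ 2 ^ 5 by norm_num)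
    rw [Real.log_pow] at this
    exact_mod_cast this
  have hL : Real.log (16 * p) = Real.log 8 + Real.log (2 * p) := by
    rw [← Real.log_mul (by norm_num) (by positivity)]
    ring_nf
  have hℓ : Real.log (2 * p) ≤ Real.log 26 + (p / 13 - 1) := by
    have h1 : Real.log (2 * p) = Real.log 26 + Real.log (p / 13) := by
      rw [← Real.log_mul (by norm_num) (by positivity)]
      ring_nf
    rw [h1]
    gcongr
    exact Real.log_le_sub_one_of_pos (by positivity)
  have hℓ0 : Real.log 26 ≤ Real.log (2 * (p : ℝ)) := Real.log_le_log (by norm_num) (by linarith)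
  rw [hL] at key
  set ℓ := Real.log (2 * (p : ℝ))
  have hT : 0 ≤ Real.log 0.85 + 2 / 3 * ℓ := by linarith
  have hlow : p * (Real.log 0.85 + 2 / 3 * ℓ) * 6.25 ≤
      classNumber K * (Real.log 0.85 + 2 / 3 * ℓ) *
        (Real.pi * (16 * p) / (2 * √|(discr K : ℝ)|) - 1) := by
    gcongr
    linarith
  have hup := hlow.trans key
  have hlast : Real.log 8 + ℓ ≤ 0.43 * p := by linarith
  have hmain : (p : ℝ) * (16 * (2 / 15 * (Real.log 8 + ℓ) - 19 / 450) + 2 * 0.43) <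
      p * (6.25 * (Real.log 0.85 + 2 / 3 * ℓ)) := by
    gcongr
    linarith
  linarith

end IsPureCubic

/-- A cube `b ^ 3` is adjacent to twice a prime only for `27 = 2 * 13 + 1`. -/
lemma cube_sub_sq_ne_one {p : ℕ} (hp : p.Prime) (h7 : 7 ≤ p) (h13 : p ≠ 13) (b : ℤ) :
    (b ^ 3 - (2 * p : ℕ)) ^ 2 ≠ 1 := by
  intro hb
  have hp0 : (7 : ℤ) ≤ p := by exact_mod_cast h7
  have hpp : Prime (p : ℤ) := Nat.prime_iff_prime_int.1 hp
  have hσ : ∃ σ : ℤ, (σ = 1 ∨ σ = -1) ∧ b ^ 3 - σ = 2 * p := by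
    rcases sq_eq_one_iff.1 hb with h1 | h1
    · exact ⟨1, Or.inl rfl, by push_cast at h1; linarith⟩
    · exact ⟨-1, Or.inr rfl, by push_cast at h1; linarith⟩
  obtain ⟨σ, hσ1, hσ⟩ := hσ
  have hb2 : 2 ≤ b := by
    by_contra! hlt
    have : b ^ 3 ≤ 1 := by
      have := Odd.strictMono_pow (R := ℤ) (show Odd 3 by decide) |>.monotone (show b ≤ 1 by lia)
      simpa using this
    rcases hσ1 with rfl | rfl <;> lia
  have hb3 : b ≠ 2 := by
    rintro rfl
    rcases hσ1 with rfl | rfl <;> lia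
  have hfac : (b - σ) * (b ^ 2 + b * σ + 1) = 2 * p := by
    rw [← hσ]
    rcases hσ1 with rfl | rfl <;> ring
  have hodd : ∃ t, b ^ 2 + b * σ + 1 = 2 * t + 1 := by
    rcases Int.even_or_odd' b with ⟨t, rfl | rfl⟩ <;> rcases hσ1 with rfl | rfl
    · exact ⟨2 * t ^ 2 + t, by ring⟩
    · exact ⟨2 * t ^ 2 - t, by ring⟩
    · exact ⟨2 * t ^ 2 + 3 * t + 1, by ring⟩
    · exact ⟨2 * t ^ 2 + t, by ring⟩
  obtain ⟨t, ht⟩ := hodd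
  rcases hpp.dvd_or_dvd (hfac ▸ dvd_mul_left (p : ℤ) 2) with ⟨k, hk⟩ | ⟨k, hk⟩
  · have h1 : k * (b ^ 2 + b * σ + 1) = 2 := by
      apply mul_left_cancel₀ hpp.ne_zero
      rw [← mul_assoc, ← hk, hfac, mul_comm]
    rcases hσ1 with rfl | rfl
    · have hk0 : 0 < k := pos_of_mul_pos_left (by rw [h1]; norm_num) (by nlinarith)
      nlinarith
    · have hk0 : 0 < k := pos_of_mul_pos_left (by rw [h1]; norm_num) (by nlinarith)
      nlinarith
  · have h1 : (b - σ) * k = 2 := by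
      apply mul_left_cancel₀ hpp.ne_zero
      rw [mul_left_comm, ← hk, hfac, mul_comm]
    have hb4 : b = 3 ∧ σ = 1 := by
      have h2 : b - σ ∣ 2 := Dvd.intro _ h1
      have h3 := Int.le_of_dvd (by norm_num) h2
      rcases hσ1 with rfl | rfl
      · exact ⟨by lia, rfl⟩
      · lia
    obtain ⟨rfl, rfl⟩ := hb4
    lia
end PureCubic

namespace PureCubic

open NumberField

section
variable {K : Type*} [Field K] [NumberField K]

lemma isPrincipal_of_absNorm_span_eq {P : Ideal (𝓞 K)} {x : 𝓞 K} (hx : x ∈ P)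
    (hP0 : Ideal.absNorm P ≠ 0) (hn : Ideal.absNorm (Ideal.span {x}) = Ideal.absNorm P) :
    Submodule.IsPrincipal P := by
  obtain ⟨J, hJ⟩ := Ideal.dvd_span_singleton.2 hx
  have h1 := congrArg Ideal.absNorm hJ
  rw [map_mul, hn] at h1
  have hJ1 : J = 1 := by
    rw [Ideal.one_eq_top, ← Ideal.absNorm_eq_one_iff]
    exact (mul_right_eq_self₀.1 h1.symm).resolve_right hP0
  rw [hJ1, mul_one] at hJ
  exact ⟨x, hJ.symm⟩

omit [NumberField K] in
lemma exists_prime_mem {P : Ideal (𝓞 K)} (hP : P.IsPrime) (n : ℕ) (hn : n ≠ 0)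
    (hnP : (n : 𝓞 K) ∈ P) : ∃ q : ℕ, q.Prime ∧ (q : 𝓞 K) ∈ P := by
  induction n using Nat.recOnMul with
  | zero => exact absurd rfl hn
  | one => exact absurd ((Ideal.eq_top_iff_one P).2 (by simpa using hnP)) hP.ne_top
  | prime q hq => exact ⟨q, hq, hnP⟩
  | mul a b iha ihb =>
    rw [Nat.cast_mul] at hnP
    rcases hP.mem_or_mem hnP with h | h
    · exact iha (left_ne_zero_of_mul hn) h
    · exact ihb (right_ne_zero_of_mul hn) h

end

namespace IsPureCubic
open Module NumberField.InfinitePlace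
variable {K : Type*} [Field K] [NumberField K] {θ : K} {m : ℕ}

/-- Minkowski's bound: it suffices that the primes of small norm are principal. -/
lemma classNumber_eq_one_of_isPrincipal (h : IsPureCubic θ m) {D : ℝ} {B : ℕ}
    (hD : |(discr K : ℝ)| ≤ D) (hDB : D * 64 < (28.26 * (B + 1)) ^ 2)
    (hpr : ∀ (q f : ℕ) (P : Ideal (𝓞 K)), q.Prime → 0 < f → q ^ f ≤ B → P.IsPrime →
      (q : 𝓞 K) ∈ P → Ideal.absNorm P = q ^ f → Submodule.IsPrincipal P) :
    classNumber K = 1 := by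
  rw [classNumber_eq_one_iff]
  refine RingOfIntegers.isPrincipalIdealRing_of_isPrincipal_of_norm_le_of_isPrime
    fun I hI hle => ?_
  have hI0 : Ideal.absNorm (I : Ideal (𝓞 K)) ≠ 0 := Ideal.absNorm_ne_zero_of_nonZeroDivisors I
  obtain ⟨q, hq, hqI⟩ := exists_prime_mem hI _ hI0 (Ideal.absNorm_mem _)
  obtain ⟨f, hf0, hf⟩ := exists_absNorm_eq_pow hq hI hqI
  refine hpr q f I hq hf0 ?_ hI hqI hf
  rw [← hf, ← Nat.lt_add_one_iff]
  rw [h.nrComplexPlaces_eq, h.finrank_eq] at hle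
  have hsqrt : √|(discr K : ℝ)| * 8 < 28.26 * (B + 1) := by
    refine lt_of_pow_lt_pow_left₀ 2 (by positivity) ?_
    rw [mul_pow, Real.sq_sqrt (abs_nonneg _)]
    linarith
  have hpi := Real.pi_gt_d2
  have : (4 / Real.pi) ^ 1 * ((Nat.factorial 3 : ℝ) / 3 ^ 3 * √|(discr K : ℝ)|) < B + 1 := by
    rw [pow_one, div_mul_eq_mul_div, div_lt_iff₀ Real.pi_pos]
    norm_num [Nat.factorial]
    nlinarith
  have h2 := hle.trans_lt (by simpa using this)
  exact_mod_cast h2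

lemma absNorm_eq_of_dvd (h : IsPureCubic θ m) {q f : ℕ} (hq : q.Prime) (hqm : q ∣ m)
    {P : Ideal (𝓞 K)} (hP : P.IsPrime) (hqP : (q : 𝓞 K) ∈ P) (hf0 : 0 < f)
    (hf : Ideal.absNorm P = q ^ f) : Ideal.absNorm P = q := by
  have h1 := Ideal.absNorm_dvd_absNorm_of_le
    ((Ideal.span_singleton_le_iff_mem _).2 (h.gen_mem hqm hP hqP))
  have hn := h.absNorm_span_gen_sub 0
  rw [Int.cast_zero, sub_zero] at hn
  rw [hn, hf] at h1
  norm_num at h1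
  have hf1 : f < 2 := by
    by_contra! hf2
    have h2 : q * q ∣ m := by
      rw [← sq]
      exact (pow_dvd_pow q hf2).trans h1
    exact hq.not_isUnit (h.squarefree q h2)
  rw [hf, show f = 1 by lia, pow_one]

lemma isPrincipal_of_absNorm_eq (h : IsPureCubic θ m) {q : ℕ} (hq : q.Prime)
    {P : Ideal (𝓞 K)} (hP : Ideal.absNorm P = q)
    (hex : ∀ r : ℤ, 0 ≤ r → r < q → (q : ℤ) ∣ m - r ^ 3 → ∃ a b c : ℤ,
      (q : ℤ) ∣ a + b * r + c * r ^ 2 ∧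
        (a ^ 3 + m * b ^ 3 + m ^ 2 * c ^ 3 - 3 * m * a * b * c : ℤ).natAbs = q) :
    Submodule.IsPrincipal P := by
  have hprime := isPrime_of_absNorm_eq hq hP
  have hqP := natCast_mem_of_absNorm_eq hP
  obtain ⟨r', hr'⟩ := exists_int_sub_mem hq hP h.gen
  have hq0 : (0 : ℤ) < q := by exact_mod_cast hq.pos
  obtain ⟨r, hr0, hrq, hr⟩ : ∃ r : ℤ, 0 ≤ r ∧ r < q ∧ h.gen - r ∈ P := by
    refine ⟨r' % q, Int.emod_nonneg _ hq0.ne', Int.emod_lt_of_pos _ hq0, ?_⟩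
    have h1 : ((r' % q + q * (r' / q) : ℤ) : 𝓞 K) = (r' : 𝓞 K) := by
      rw [Int.emod_add_mul_ediv]
    push_cast at h1
    have h2 : h.gen - ((r' % q : ℤ) : 𝓞 K) = (h.gen - r') + q * ((r' / q : ℤ) : 𝓞 K) := by
      linear_combination -h1
    rw [h2]
    exact P.add_mem hr' (P.mul_mem_right _ hqP)
  have hdvd : (q : ℤ) ∣ m - r ^ 3 := by
    refine dvd_of_intCast_mem hq hprime hqP ?_
    have h1 : ((m - r ^ 3 : ℤ) : 𝓞 K) = (h.gen ^ 2 + h.gen * r + r ^ 2) * (h.gen - r) := by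
      push_cast
      linear_combination -h.gen_pow_three
    rw [h1]
    exact P.mul_mem_left _ hr
  obtain ⟨a, b, c, ⟨k, hk⟩, hn⟩ := hex r hr0 hrq hdvd
  refine isPrincipal_of_absNorm_span_eq (x := a + b * h.gen + c * h.gen ^ 2) ?_
    (by rw [hP]; exact hq.ne_zero) (by rw [h.absNorm_span_eq, hn, hP])
  have h1 : (a + b * h.gen + c * h.gen ^ 2 : 𝓞 K) =
      (b + c * (h.gen + r)) * (h.gen - r) + q * k := by
    have hk' : ((a + b * r + c * r ^ 2 : ℤ) : 𝓞 K) = (q * k : ℤ) := by rw [hk]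
    push_cast at hk'
    linear_combination hk'
  rw [h1]
  exact P.add_mem (P.mul_mem_left _ hr) (P.mul_mem_right _ hqP)

lemma classNumber_eq_one_of_two (h : IsPureCubic θ 2) : classNumber K = 1 := by
  refine h.classNumber_eq_one_of_isPrincipal (B := 2) h.abs_discr_le_mul_sq (by norm_num)
    fun q f P hq hf0 hqf hP hqP hf => ?_
  have hq2 : q = 2 := le_antisymm ((Nat.le_self_pow hf0.ne' q).trans hqf) hq.two_le
  subst hq2
  exact h.isPrincipal_of_absNorm_eq hq (h.absNorm_eq_of_dvd hq dvd_rfl hP hqP hf0 hf)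
    fun r hr0 hr2 hr => ⟨0, 1, 0, by interval_cases r <;> revert hr <;> norm_num, by norm_num⟩

lemma classNumber_eq_one_of_six (h : IsPureCubic θ 6) : classNumber K = 1 := by
  refine h.classNumber_eq_one_of_isPrincipal (B := 8) h.abs_discr_le_mul_sq (by norm_num)
    fun q f P hq hf0 hqf hP hqP hf => ?_
  have hq8 : q ≤ 8 := (Nat.le_self_pow hf0.ne' q).trans hqf
  have hf1 : 4 < q → Ideal.absNorm P = q := fun h4 => by
    have : f < 2 := by
      by_contra! hf2
      have := (Nat.pow_le_pow_right hq.pos hf2).trans hqf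
      nlinarith
    rw [hf, show f = 1 by lia, pow_one]
  interval_cases q
  · exact absurd hq (by norm_num)
  · exact absurd hq (by norm_num)
  · exact h.isPrincipal_of_absNorm_eq hq (h.absNorm_eq_of_dvd hq (by norm_num) hP hqP hf0 hf)
      fun r hr0 hr2 hr => ⟨2, -1, 0, by interval_cases r <;> revert hr <;> norm_num, by norm_num⟩
  · exact h.isPrincipal_of_absNorm_eq hq (h.absNorm_eq_of_dvd hq (by norm_num) hP hqP hf0 hf)
      fun r hr0 hr2 hr => ⟨3, 2, 1, by interval_cases r <;> revert hr <;> norm_num, by norm_num⟩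
  · exact absurd hq (by norm_num)
  · exact h.isPrincipal_of_absNorm_eq hq (hf1 (by norm_num))
      fun r hr0 hr2 hr => ⟨-1, 1, 0, by interval_cases r <;> revert hr <;> norm_num, by norm_num⟩
  · exact absurd hq (by norm_num)
  · refine h.isPrincipal_of_absNorm_eq hq (hf1 (by norm_num)) fun r hr0 hr2 hr => ?_
    have hr' : r = 3 ∨ r = 5 ∨ r = 6 := by interval_cases r <;> revert hr <;> norm_num
    rcases hr' with rfl | rfl | rfl
    · exact ⟨-5, 1, 1, by norm_num, by norm_num⟩
    · exact ⟨-7, 2, 1, by norm_num, by norm_num⟩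
    · exact ⟨1, 1, 0, by norm_num, by norm_num⟩
  · exact absurd hq (by norm_num)

lemma algebraMap_gen (h : IsPureCubic θ m) : algebraMap (𝓞 K) K h.gen = θ := rfl

lemma absNorm_span_eq_of_coe_eq (h : IsPureCubic θ m) {x : 𝓞 K} {a b c : ℚ} {n : ℕ}
    (hx : algebraMap (𝓞 K) K x = a + b * θ + c * θ ^ 2)
    (hn : a ^ 3 + m * b ^ 3 + m ^ 2 * c ^ 3 - 3 * m * a * b * c = n) :
    Ideal.absNorm (Ideal.span {x}) = n := by
  rw [Ideal.absNorm_span_singleton]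
  have h2 : ((Algebra.norm ℤ x : ℤ) : ℚ) = Algebra.norm ℚ (algebraMap (𝓞 K) K x) :=
    Algebra.coe_norm_int x
  rw [hx, h.norm_eq, hn] at h2
  have h3 : Algebra.norm ℤ x = n := by exact_mod_cast h2
  rw [h3, Int.natAbs_natCast]

lemma classNumber_eq_one_of_ten (h : IsPureCubic θ 10) : classNumber K = 1 := by
  have h3 := h.pow_three
  refine h.classNumber_eq_one_of_isPrincipal (B := 4)
    (h.abs_discr_le_three_mul_sq (σ := 1) (by norm_num) (by norm_num)) (by norm_num)
    fun q f P hq hf0 hqf hP hqP hf => ?_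
  have hq4 : q ≤ 4 := (Nat.le_self_pow hf0.ne' q).trans hqf
  interval_cases q
  · exact absurd hq (by norm_num)
  · exact absurd hq (by norm_num)
  · exact h.isPrincipal_of_absNorm_eq hq (h.absNorm_eq_of_dvd hq (by norm_num) hP hqP hf0 hf)
      fun r hr0 hr2 hr => ⟨-2, 1, 0, by interval_cases r <;> revert hr <;> norm_num, by norm_num⟩
  · have hf1 : f < 2 := by
      by_contra! hf2
      have := (Nat.pow_le_pow_right hq.pos hf2).trans hqf
      lia
    have hP3 : Ideal.absNorm P = 3 := by rw [hf, show f = 1 by lia, pow_one]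
    let ω : 𝓞 K := ⟨_, h.isIntegral_third (σ := 1) (by norm_num) (by norm_num)⟩
    have hω : algebraMap (𝓞 K) K ω =
        ((1 / 3 : ℚ) : K) + ((1 / 3 : ℚ) : K) * θ + ((1 / 3 : ℚ) : K) * θ ^ 2 := by
      simp only [ω, RingOfIntegers.map_mk, Int.cast_one]
    have hη : algebraMap (𝓞 K) K (ω - h.gen) =
        ((1 / 3 : ℚ) : K) + ((-2 / 3 : ℚ) : K) * θ + ((1 / 3 : ℚ) : K) * θ ^ 2 := by
      rw [map_sub, hω, h.algebraMap_gen]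
      push_cast
      ring
    have hprod : ω * (ω - h.gen) = h.gen - (10 : ℕ) + 3 * 3 := by
      refine RingOfIntegers.ext ?_
      simp only [map_mul, map_add, map_sub, hη, map_natCast, map_ofNat, h.algebraMap_gen]
      rw [hω]
      push_cast
      push_cast at h3
      linear_combination (1 / 9 : K) * (θ - 1) * h3
    have hmem : ω * (ω - h.gen) ∈ P := by
      rw [hprod]
      exact P.add_mem (by exact_mod_cast h.gen_sub_mem hP hqP)
        (P.mul_mem_right _ (by exact_mod_cast hqP))
    rcases hP.mem_or_mem hmem with hωP | hηP
    · refine isPrincipal_of_absNorm_span_eq hωP (by rw [hP3]; norm_num) ?_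
      rw [hP3]
      exact h.absNorm_span_eq_of_coe_eq hω (by norm_num)
    · refine isPrincipal_of_absNorm_span_eq hηP (by rw [hP3]; norm_num) ?_
      rw [hP3]
      exact h.absNorm_span_eq_of_coe_eq hη (by norm_num)
  · exact absurd hq (by norm_num)

end IsPureCubic

end PureCubic

namespace PureCubic

open NumberField
variable {K : Type*} [Field K] [NumberField K] {θ : K}

lemma isPureCubic_two_mul {p : ℕ} (hp : p.Prime) (hp2 : p ≠ 2) (hθ : θ ^ 3 = ((2 * p : ℕ) : K))
    (hgen : Algebra.adjoin ℚ {θ} = ⊤) : IsPureCubic θ (2 * p) where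
  pow_three := hθ
  adjoin_eq_top := hgen
  squarefree := (Nat.squarefree_mul ((Nat.coprime_primes Nat.prime_two hp).2 hp2.symm)).2
    ⟨Nat.prime_two.prime.squarefree, hp.prime.squarefree⟩
  one_lt := by have := hp.two_le; lia

lemma isPureCubic_sq_div_two (hθ : θ ^ 3 = ((2 * 2 : ℕ) : K))
    (hgen : Algebra.adjoin ℚ {θ} = ⊤) : IsPureCubic (θ ^ 2 / 2) 2 where
  pow_three := by
    push_cast at hθ ⊢
    linear_combination (θ ^ 3 + 4) / 8 * hθ
  adjoin_eq_top := by
    rw [eq_top_iff, ← hgen, Algebra.adjoin_le_iff, Set.singleton_subset_iff]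
    have h1 : θ = (θ ^ 2 / 2) ^ 2 := by
      push_cast at hθ
      linear_combination -(θ / 4) * hθ
    have h2 := pow_mem (Algebra.self_mem_adjoin_singleton ℚ (θ ^ 2 / 2)) 2
    rwa [← h1] at h2
  squarefree := Nat.prime_two.prime.squarefree
  one_lt := one_lt_two

lemma IsPureCubic.classNumber_lt_prime {p : ℕ} (h : IsPureCubic θ (2 * p)) (hp : p.Prime)
    (h7 : 7 ≤ p) : classNumber K < p := by
  have h3 : ¬ 3 ∣ 2 * p := fun hd => by
    rcases Nat.prime_three.dvd_mul.1 hd with h1 | h1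
    · norm_num at h1
    · have := (Nat.prime_dvd_prime_iff_eq Nat.prime_three hp).1 h1
      lia
  by_cases h9 : (9 : ℤ) ∣ ((2 * p : ℕ) : ℤ) ^ 2 - 1
  · have h13 : 13 ≤ p := by
      by_contra! hlt
      interval_cases p <;> revert h9 hp <;> norm_num
    have hσ : ∃ σ : ℤ, σ ^ 2 = 1 ∧ (9 : ℤ) ∣ ((2 * p : ℕ) : ℤ) - σ := by
      generalize ((2 * p : ℕ) : ℤ) = n at h9
      have h1 : n % 9 = 1 ∨ n % 9 = 8 := by
        have h4 : (n ^ 2 - 1) % 9 = 0 := Int.emod_eq_zero_of_dvd h9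
        have h5 := Int.emod_nonneg n (show (9 : ℤ) ≠ 0 by norm_num)
        have h6 := Int.emod_lt_of_pos n (show (0 : ℤ) < 9 by norm_num)
        rw [Int.sub_emod, sq, Int.mul_emod] at h4
        generalize n % 9 = r at h4 h5 h6
        interval_cases r <;> revert h4 <;> norm_num
      rcases h1 with h1 | h1
      · exact ⟨1, by norm_num, by lia⟩
      · exact ⟨-1, by norm_num, by lia⟩
    obtain ⟨σ, hσ1, hσ⟩ := hσ
    exact h.classNumber_lt h13 hσ1 hσ
  · have h13 : p ≠ 13 := by
      rintro rfl
      norm_num at h9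
    exact h.classNumber_lt_of_not_dvd h7 h3 h9 (cube_sub_sq_ne_one hp h7 h13)

lemma classNumber_eq_one_or_lt {p : ℕ} (hp : p.Prime) (hθ : θ ^ 3 = ((2 * p : ℕ) : K))
    (hgen : Algebra.adjoin ℚ {θ} = ⊤) : classNumber K = 1 ∨ classNumber K < p := by
  rcases eq_or_ne p 2 with rfl | hp2
  · exact Or.inl (isPureCubic_sq_div_two hθ hgen).classNumber_eq_one_of_two
  have h := isPureCubic_two_mul hp hp2 hθ hgen
  by_cases h7 : 7 ≤ p
  · exact Or.inr (h.classNumber_lt_prime hp h7)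
  have h35 : p = 3 ∨ p = 5 := by
    have := hp.two_le
    interval_cases p
    all_goals (revert hp hp2; norm_num)
  left
  rcases h35 with rfl | rfl
  · exact h.classNumber_eq_one_of_six
  · exact h.classNumber_eq_one_of_ten

end PureCubic

/-- **Lemma 3.4 (2)**: the class number of `ℚ((2p)^{1/3})` is prime to `p`,
for every prime `p`.  Here `ℚ((2p)^{1/3})` is formalized as any number field `K`
generated over `ℚ` by an element `θ` with `θ³ = 2p`. -/
theorem class_number_not_dvd
    (p : ℕ) (hp : p.Prime)
    (K : Type) [Field K] [NumberField K]
    (θ : K) (hθ : θ ^ 3 = ((2 * p : ℕ) : K)) (hgen : Algebra.adjoin ℚ {θ} = ⊤) :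
    ¬ p ∣ NumberField.classNumber K := by
  rcases PureCubic.classNumber_eq_one_or_lt hp hθ hgen with h | h
  · rw [h]
    exact hp.not_dvd_one
  · exact Nat.not_dvd_of_pos_of_lt (Nat.pos_of_ne_zero (NumberField.classNumber_ne_zero K)) h
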